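/- Let n ≥ 1, w ∈ W_n, x ∈ K_w and k ∈ {1,…,l_n}. Then: (1) if y ∈ U^{(k)}_{n,w} then d(x,y) < (k+2)/L_n and R_E(x,y) < ((2/3)k + 10/3)·R_n; (2) if y ∈ K ∖ U^{(k)}_{n,w} then d(x,y) ≥ k/L_n and R_E(x,y) ≥ (k/12)·R_n. Consequently B_d(x, k/L_n) ⊆ U^{(k)}_{n,w} ⊆ B_d(x, (k+2)/L_n) and B_{R_E}(x, (k/12)R_n) ⊆ U^{(k)}_{n,w} ⊆ B_{R_E}(x, ((2/3)k + 10/3)R_n), where B_ρ(x,r) denotes the open ρ-ball. -/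

import Mathlib

open scoped BigOperators ENNReal
open Set Filter MeasureTheory

noncomputable section

abbrev E2 : Type := EuclideanSpace ℝ (Fin 2)

/-- The index set `S_l` of the level-`l` thin Sierpinski gasket. -/
def Sset (l : ℕ) : Set (ℕ × ℕ) :=
  {p | p.1 + p.2 ≤ l - 1 ∧ p.1 * p.2 * (l - 1 - p.1 - p.2) = 0}

/-- The contraction `f^l_i`. -/
def fmap (q : Fin 3 → E2) (l : ℕ) (i : ℕ × ℕ) (x : E2) : E2 :=
  q 0 + ((i.1 : ℝ) / l) • (q 1 - q 0) + ((i.2 : ℝ) / l) • (q 2 - q 0)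
    + (l : ℝ)⁻¹ • (x - q 0)

/-- The closed equilateral triangle `△`. -/
def Tri (q : Fin 3 → E2) : Set E2 := convexHull ℝ (Set.range q)

def V0 (q : Fin 3 → E2) : Set E2 := Set.range q

/-- Words of length `n` (padded by `(0,0)` beyond position `n`). -/
def Wn (l : ℕ → ℕ) (n : ℕ) : Set (ℕ → ℕ × ℕ) :=
  {w | (∀ k, k < n → w k ∈ Sset (l k)) ∧ ∀ k, n ≤ k → w k = (0, 0)}

/-- `wordMap q l w n = f^{l_1}_{w_1} ∘ ⋯ ∘ f^{l_n}_{w_n}` (0-indexed). -/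
def wordMap (q : Fin 3 → E2) (l : ℕ → ℕ) (w : ℕ → ℕ × ℕ) : ℕ → E2 → E2
  | 0 => id
  | n + 1 => wordMap q l w n ∘ fmap q (l n) (w n)

/-- The thin scale irregular Sierpinski gasket `K`. -/
def Gasket (q : Fin 3 → E2) (l : ℕ → ℕ) : Set E2 :=
  ⋂ n, ⋃ w ∈ Wn l n, wordMap q l w n '' Tri q

/-- The cell `K_w = K ∩ f_w(△)`. -/
def Cell (q : Fin 3 → E2) (l : ℕ → ℕ) (n : ℕ) (w : ℕ → ℕ × ℕ) : Set E2 :=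
  Gasket q l ∩ wordMap q l w n '' Tri q

def Vn (q : Fin 3 → E2) (l : ℕ → ℕ) (n : ℕ) : Set E2 :=
  ⋃ w ∈ Wn l n, wordMap q l w n '' V0 q

def Vstar (q : Fin 3 → E2) (l : ℕ → ℕ) : Set E2 := ⋃ n, Vn q l n

def Ln (l : ℕ → ℕ) (n : ℕ) : ℕ := ∏ k ∈ Finset.range n, l k

def Mn (l : ℕ → ℕ) (n : ℕ) : ℕ := ∏ k ∈ Finset.range n, (3 * l k - 3)

def rl (l : ℕ) : ℝ := (2 * (l : ℝ) / 3 + 1 / 9)⁻¹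

def Rn (l : ℕ → ℕ) (n : ℕ) : ℝ := ∏ k ∈ Finset.range n, rl (l k)

def Tn (l : ℕ → ℕ) (n : ℕ) : ℝ := (Mn l n : ℝ) / Rn l n

/-- The basic energy form `E⁰` on `ℝ^{V₀}`. -/
def E0 (q : Fin 3 → E2) (u v : E2 → ℝ) : ℝ :=
  (1 / 2) * ∑ j : Fin 3, ∑ k : Fin 3, (u (q j) - u (q k)) * (v (q j) - v (q k))

/-- The level-`n` energy form `Eⁿ`. -/
def En (q : Fin 3 → E2) (l : ℕ → ℕ) (n : ℕ) (u v : E2 → ℝ) : ℝ :=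
  (Rn l n)⁻¹ * ∑ᶠ w ∈ Wn l n, E0 q (u ∘ wordMap q l w n) (v ∘ wordMap q l w n)

/-- The domain `F` of the limit resistance form. -/
def FDom (q : Fin 3 → E2) (l : ℕ → ℕ) : Set (E2 → ℝ) :=
  {u | ∃ C : ℝ, ∀ n, En q l n u u ≤ C}

/-- The limit form `E(u,v) = lim_n Eⁿ(u,v)`. -/
def EForm (q : Fin 3 → E2) (l : ℕ → ℕ) (u v : E2 → ℝ) : ℝ :=
  limUnder atTop fun n => En q l n u v

/-- The intrinsic (geodesic) distance on `K`, with values in `ℝ≥0∞`. -/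
def pdist (q : Fin 3 → E2) (l : ℕ → ℕ) (x y : E2) : ℝ≥0∞ :=
  ⨅ (γ : ℝ → E2) (_ : ContinuousOn γ (Set.Icc 0 1))
    (_ : Set.MapsTo γ (Set.Icc 0 1) (Gasket q l)) (_ : γ 0 = x) (_ : γ 1 = y),
    eVariationOn γ (Set.Icc 0 1)

def gdist (q : Fin 3 → E2) (l : ℕ → ℕ) (x y : E2) : ℝ := (pdist q l x y).toReal

/-- The set of resistance quotients used to define `R_E`. -/
def REset (q : Fin 3 → E2) (l : ℕ → ℕ) (x y : E2) : Set ℝ :=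
  {t | ∃ u ∈ FDom q l, 0 < EForm q l u u ∧ t = (u x - u y) ^ 2 / EForm q l u u}

/-- The resistance metric `R_E`. -/
def RE (q : Fin 3 → E2) (l : ℕ → ℕ) (x y : E2) : ℝ := sSup (REset q l x y)

/-- Resistance quotients over continuous representatives (i.e. `F` viewed in `C(K)`). -/
def REcSet (q : Fin 3 → E2) (l : ℕ → ℕ) (x y : E2) : Set ℝ :=
  {t | ∃ u ∈ FDom q l, ContinuousOn u (Gasket q l) ∧ 0 < EForm q l u u ∧
    t = (u x - u y) ^ 2 / EForm q l u u}

def REc (q : Fin 3 → E2) (l : ℕ → ℕ) (x y : E2) : ℝ := sSup (REcSet q l x y)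

/-- The open `d`-ball in `K`. -/
def Bd (q : Fin 3 → E2) (l : ℕ → ℕ) (x : E2) (s : ℝ) : Set E2 :=
  {y ∈ Gasket q l | gdist q l x y < s}

/-- The open `R_E`-ball in `K`. -/
def BRc (q : Fin 3 → E2) (l : ℕ → ℕ) (x : E2) (s : ℝ) : Set E2 :=
  {y ∈ Gasket q l | REc q l x y < s}

/-- `Λ^{(k)}_{n,w}`: words within `k` cell-steps of `w`. -/
def Lam (q : Fin 3 → E2) (l : ℕ → ℕ) (n : ℕ) (w : ℕ → ℕ × ℕ) (k : ℕ) :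
    Set (ℕ → ℕ × ℕ) :=
  {v ∈ Wn l n | ∃ c : ℕ → ℕ → ℕ × ℕ, c 0 = w ∧ c k = v ∧ (∀ j ≤ k, c j ∈ Wn l n) ∧
    ∀ j < k, (Cell q l n (c j) ∩ Cell q l n (c (j + 1))).Nonempty}

/-- `U^{(k)}_{n,w}`. -/
def Unwk (q : Fin 3 → E2) (l : ℕ → ℕ) (n : ℕ) (w : ℕ → ℕ × ℕ) (k : ℕ) : Set E2 :=
  ⋃ v ∈ Lam q l n w k, Cell q l n v

def betaZero (l : ℕ → ℕ) : ℝ :=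
  ⨅ n : ℕ, Real.logb (l n) (2 * (l n : ℝ) ^ 2 - (5 / 3) * (l n : ℝ) - 1 / 3)

def betaOne (l : ℕ → ℕ) : ℝ :=
  ⨆ n : ℕ, Real.logb (l n) (2 * (l n : ℝ) ^ 2 - (5 / 3) * (l n : ℝ) - 1 / 3)

def betaM (l : ℕ → ℕ) : ℝ := ⨅ n : ℕ, Real.logb (l n) (3 * (l n : ℝ) - 3)

def betaR (l : ℕ → ℕ) : ℝ := ⨆ n : ℕ, Real.logb (l n) ((rl (l n))⁻¹)

/-- The value of `Ψ` on the interval `[1/L_{n+1}, 1/L_n]`. -/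
def psiPiece (l : ℕ → ℕ) (n : ℕ) (s : ℝ) : ℝ :=
  (Tn l (n + 1))⁻¹
    * (1 + ((3 * (l n : ℝ) - 4) / ((l n : ℝ) - 1)) * ((Ln l (n + 1) : ℝ) * s - 1))
    * (1 + (((2 / 3) * (l n : ℝ) - 8 / 9) / ((l n : ℝ) - 1)) * ((Ln l (n + 1) : ℝ) * s - 1))

/-- `Ψ = Ψ_𝒍` is characterized by these defining clauses. -/
def IsPsi (l : ℕ → ℕ) (Psi : ℝ → ℝ) : Prop :=
  (∀ n : ℕ, ∀ s : ℝ, ((Ln l (n + 1) : ℝ))⁻¹ ≤ s → s ≤ ((Ln l n : ℝ))⁻¹ →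
      Psi s = psiPiece l n s) ∧
  (∀ s : ℝ, 1 ≤ s → Psi s = s ^ betaZero l) ∧ Psi 0 = 0

def psiMPiece (l : ℕ → ℕ) (n : ℕ) (s : ℝ) : ℝ :=
  ((Mn l (n + 1) : ℝ))⁻¹
    * (1 + ((3 * (l n : ℝ) - 4) / ((l n : ℝ) - 1)) * ((Ln l (n + 1) : ℝ) * s - 1))

def IsPsiM (l : ℕ → ℕ) (PsiM : ℝ → ℝ) : Prop :=
  (∀ n : ℕ, ∀ s : ℝ, ((Ln l (n + 1) : ℝ))⁻¹ ≤ s → s ≤ ((Ln l n : ℝ))⁻¹ →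
      PsiM s = psiMPiece l n s) ∧
  (∀ s : ℝ, 1 ≤ s → PsiM s = s ^ betaM l) ∧ PsiM 0 = 0

def psiRPiece (l : ℕ → ℕ) (n : ℕ) (s : ℝ) : ℝ :=
  Rn l (n + 1)
    * (1 + (((2 / 3) * (l n : ℝ) - 8 / 9) / ((l n : ℝ) - 1)) * ((Ln l (n + 1) : ℝ) * s - 1))

def IsPsiR (l : ℕ → ℕ) (PsiR : ℝ → ℝ) : Prop :=
  (∀ n : ℕ, ∀ s : ℝ, ((Ln l (n + 1) : ℝ))⁻¹ ≤ s → s ≤ ((Ln l n : ℝ))⁻¹ →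
      PsiR s = psiRPiece l n s) ∧
  (∀ s : ℝ, 1 ≤ s → PsiR s = s ^ betaR l) ∧ PsiR 0 = 0

/-- `μ` is the uniform distribution on `K`: a Borel measure carried by `K`
with `μ(K_w) = 1/M_{|w|}` for every word `w`. -/
def IsUnif (q : Fin 3 → E2) (l : ℕ → ℕ) (μ : Measure E2) : Prop :=
  μ (Gasket q l)ᶜ = 0 ∧ ∀ n : ℕ, ∀ w ∈ Wn l n, μ (Cell q l n w) = ((Mn l n : ℝ≥0∞))⁻¹

/-- `μ` is the energy measure of `u`: a Borel measure carried by `K` with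
`μ(K_w) = R_{|w|}⁻¹ E^{𝒍^{|w|}}(u∘F_w, u∘F_w)` for every word `w`. -/
def IsEnergyMeasure (q : Fin 3 → E2) (l : ℕ → ℕ) (u : E2 → ℝ) (μ : Measure E2) : Prop :=
  μ (Gasket q l)ᶜ = 0 ∧ ∀ n : ℕ, ∀ w ∈ Wn l n,
    μ (Cell q l n w) = ENNReal.ofReal ((Rn l n)⁻¹ *
      EForm q (fun k => l (k + n)) (u ∘ wordMap q l w n) (u ∘ wordMap q l w n))


/-! ### Coordinates -/

/-- Shifted sequence. -/
def sh (l : ℕ → ℕ) (n : ℕ) : ℕ → ℕ := fun k => l (k + n)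

/-- Affine lattice coordinates. -/
def PP (q : Fin 3 → E2) (s t : ℝ) : E2 := q 0 + s • (q 1 - q 0) + t • (q 2 - q 0)

/-- Equilateral triangle hypothesis. -/
def Equi (q : Fin 3 → E2) : Prop := ∀ j k : Fin 3, j ≠ k → dist (q j) (q k) = 1

lemma PP_dist_sq (q : Fin 3 → E2) (hq : Equi q) (s t s' t' : ℝ) :
    dist (PP q s t) (PP q s' t') ^ 2
      = (s - s') ^ 2 + (s - s') * (t - t') + (t - t') ^ 2 := by
  have h1 : ‖q 1 - q 0‖ = 1 := by rw [← dist_eq_norm]; exact hq 1 0 (by decide)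
  have h2 : ‖q 2 - q 0‖ = 1 := by rw [← dist_eq_norm]; exact hq 2 0 (by decide)
  have h3 : ‖(q 1 - q 0) - (q 2 - q 0)‖ = 1 := by
    rw [sub_sub_sub_cancel_right, ← dist_eq_norm]; exact hq 1 2 (by decide)
  have h4 := norm_sub_sq_real (q 1 - q 0) (q 2 - q 0)
  rw [h1, h2, h3] at h4
  have h5 : inner ℝ (q 1 - q 0) (q 2 - q 0) = (1 / 2 : ℝ) := by linarith
  have h6 : PP q s t - PP q s' t' = (s - s') • (q 1 - q 0) + (t - t') • (q 2 - q 0) := by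
    simp only [PP]; module
  rw [dist_eq_norm, h6, norm_add_sq_real, norm_smul, norm_smul, h1, h2, inner_smul_left,
    inner_smul_right, h5]
  simp only [mul_one, Real.norm_eq_abs, sq_abs, conj_trivial]
  ring

lemma PP_inj (q : Fin 3 → E2) (hq : Equi q) {s t s' t' : ℝ} (h : PP q s t = PP q s' t') :
    s = s' ∧ t = t' := by
  have := PP_dist_sq q hq s t s' t'
  rw [h, dist_self] at this
  have h1 : (s - s') = 0 := by nlinarith [sq_nonneg (s - s'), sq_nonneg ((s - s') + 2 * (t - t'))]
  have h2 : (t - t') = 0 := by nlinarith [sq_nonneg (t - t'), sq_nonneg (2 * (s - s') + (t - t'))]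
  constructor <;> linarith

/-- corner coordinates -/
def ev : Fin 3 → ℕ × ℕ := ![(0, 0), (1, 0), (0, 1)]

lemma q_eq (q : Fin 3 → E2) (j : Fin 3) : q j = PP q (ev j).1 (ev j).2 := by
  fin_cases j <;> simp [PP, ev]

lemma ev_cases (j : Fin 3) : (j = 0 ∧ ev j = (0, 0)) ∨ (j = 1 ∧ ev j = (1, 0)) ∨
    (j = 2 ∧ ev j = (0, 1)) := by
  fin_cases j <;> simp [ev]

lemma ev_inj {i j : Fin 3} (h : ev i = ev j) : i = j := by
  revert h; revert i j; decide

lemma q_inj (q : Fin 3 → E2) (hq : Equi q) {i j : Fin 3} (h : q i = q j) : i = j := by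
  by_contra hne
  have := hq i j hne
  rw [h, dist_self] at this
  norm_num at this

lemma mem_Tri_iff (q : Fin 3 → E2) (x : E2) :
    x ∈ Tri q ↔ ∃ s t : ℝ, 0 ≤ s ∧ 0 ≤ t ∧ s + t ≤ 1 ∧ x = PP q s t := by
  constructor
  · intro hx
    have : Tri q ⊆ {x | ∃ s t : ℝ, 0 ≤ s ∧ 0 ≤ t ∧ s + t ≤ 1 ∧ x = PP q s t} := by
      apply convexHull_min
      · rintro _ ⟨j, rfl⟩
        refine ⟨(ev j).1, (ev j).2, by positivity, by positivity, ?_, q_eq q j⟩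
        fin_cases j <;> simp [ev]
      · rintro _ ⟨s, t, hs, ht, hst, rfl⟩ _ ⟨s', t', hs', ht', hst', rfl⟩ a b ha hb hab
        refine ⟨a * s + b * s', a * t + b * t', by positivity, by positivity, by nlinarith, ?_⟩
        obtain rfl : b = 1 - a := by linarith
        simp only [PP]; module
    exact this hx
  · rintro ⟨s, t, hs, ht, hst, rfl⟩
    have hc : Convex ℝ (Tri q) := convex_convexHull ℝ _
    have hm : ∀ j, q j ∈ Tri q := fun j => subset_convexHull ℝ _ ⟨j, rfl⟩
    have := hc.sum_mem (t := Finset.univ) (w := ![1 - s - t, s, t]) (z := q)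
      (by intro i _; fin_cases i <;> simp <;> linarith)
      (by simp [Fin.sum_univ_three]; ring) (fun i _ => hm i)
    convert this using 1
    simp [Fin.sum_univ_three, PP]
    module

lemma q_mem_Tri (q : Fin 3 → E2) (j : Fin 3) : q j ∈ Tri q := subset_convexHull ℝ _ ⟨j, rfl⟩

lemma fmap_PP (q : Fin 3 → E2) (l : ℕ) (i : ℕ × ℕ) (s t : ℝ) :
    fmap q l i (PP q s t) = PP q ((i.1 + s) / l) ((i.2 + t) / l) := by
  simp only [fmap, PP, div_eq_mul_inv]; module

/-- integer position of the cell. -/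
def pos (l : ℕ → ℕ) (w : ℕ → ℕ × ℕ) : ℕ → ℕ × ℕ
  | 0 => (0, 0)
  | n + 1 => (l n * (pos l w n).1 + (w n).1, l n * (pos l w n).2 + (w n).2)

lemma Ln_pos {l : ℕ → ℕ} (hl : ∀ m, 5 ≤ l m) (n : ℕ) : 0 < Ln l n :=
  Finset.prod_pos fun k _ => by have := hl k; omega

lemma Ln_succ (l : ℕ → ℕ) (n : ℕ) : Ln l (n + 1) = Ln l n * l n := by
  simp [Ln, Finset.prod_range_succ]

lemma Rn_succ (l : ℕ → ℕ) (n : ℕ) : Rn l (n + 1) = Rn l n * rl (l n) := by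
  simp [Rn, Finset.prod_range_succ]

lemma rl_pos (l : ℕ) : 0 < rl l := by unfold rl; positivity

lemma Rn_pos (l : ℕ → ℕ) (n : ℕ) : 0 < Rn l n := Finset.prod_pos fun k _ => rl_pos _

lemma wordMap_PP (q : Fin 3 → E2) (l : ℕ → ℕ) (hl : ∀ m, 5 ≤ l m) (w : ℕ → ℕ × ℕ) (n : ℕ)
    (s t : ℝ) : wordMap q l w n (PP q s t)
      = PP q (((pos l w n).1 + s) / Ln l n) (((pos l w n).2 + t) / Ln l n) := by
  induction n generalizing s t with
  | zero => simp [wordMap, pos, Ln]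
  | succ n ih =>
    have h0 : (l n : ℝ) ≠ 0 := by have := hl n; positivity
    have h1 : (Ln l n : ℝ) ≠ 0 := by have := Ln_pos hl n; positivity
    simp only [wordMap, Function.comp, fmap_PP, ih, Ln_succ, pos]
    congr 1 <;> (push_cast; field_simp; ring)

lemma wordMap_dist (q : Fin 3 → E2) (l : ℕ → ℕ) (w : ℕ → ℕ × ℕ) (n : ℕ)
    (x y : E2) : dist (wordMap q l w n x) (wordMap q l w n y) = (Ln l n : ℝ)⁻¹ * dist x y := by
  induction n generalizing x y with
  | zero => simp [wordMap, Ln]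
  | succ n ih =>
    simp only [wordMap, Function.comp, ih, Ln_succ]
    have : dist (fmap q (l n) (w n) x) (fmap q (l n) (w n) y) = (l n : ℝ)⁻¹ * dist x y := by
      rw [dist_eq_norm, dist_eq_norm]
      have : fmap q (l n) (w n) x - fmap q (l n) (w n) y = (l n : ℝ)⁻¹ • (x - y) := by
        simp only [fmap]; module
      rw [this, norm_smul]; simp
    rw [this]; push_cast; rw [mul_inv]; ring

lemma wordMap_continuous (q : Fin 3 → E2) (l : ℕ → ℕ) (w : ℕ → ℕ × ℕ) (n : ℕ) :
    Continuous (wordMap q l w n) := by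
  have : LipschitzWith (Real.toNNReal (Ln l n : ℝ)⁻¹) (wordMap q l w n) :=
    LipschitzWith.of_dist_le_mul fun x y => by
      rw [wordMap_dist, Real.coe_toNNReal _ (by positivity)]
  exact this.continuous

lemma wordMap_inj (q : Fin 3 → E2) (l : ℕ → ℕ) (hl : ∀ m, 5 ≤ l m) (w : ℕ → ℕ × ℕ) (n : ℕ) :
    Function.Injective (wordMap q l w n) := by
  intro x y h
  have h1 := wordMap_dist q l w n x y
  rw [h, dist_self] at h1
  have h2 : (0 : ℝ) < (Ln l n : ℝ)⁻¹ := by have := Ln_pos hl n; positivity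
  have : dist x y = 0 := by
    rcases mul_eq_zero.1 h1.symm with h | h
    · exact absurd h h2.ne'
    · exact h
  exact dist_eq_zero.1 this

lemma wordMap_q (q : Fin 3 → E2) (l : ℕ → ℕ) (hl : ∀ m, 5 ≤ l m) (w : ℕ → ℕ × ℕ) (n : ℕ)
    (j : Fin 3) : wordMap q l w n (q j)
      = PP q (((pos l w n + ev j).1 : ℕ) / Ln l n) (((pos l w n + ev j).2 : ℕ) / Ln l n) := by
  rw [q_eq q j, wordMap_PP q l hl]; simp

lemma Sset_lt {l : ℕ} (hl : 5 ≤ l) {i : ℕ × ℕ} (hi : i ∈ Sset l) : i.1 < l ∧ i.2 < l := by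
  have := hi.1; omega

lemma digit_unique {l a b x y : ℕ} (hx : x < l) (hy : y < l) (h : l * a + x = l * b + y) :
    a = b ∧ x = y := by
  have hl : 0 < l := by omega
  have h1 : (l * a + x) / l = a := by
    rw [Nat.mul_add_div hl, Nat.div_eq_of_lt hx, add_zero]
  have h2 : (l * b + y) / l = b := by
    rw [Nat.mul_add_div hl, Nat.div_eq_of_lt hy, add_zero]
  have : a = b := by rw [← h1, ← h2, h]
  subst this
  exact ⟨rfl, by omega⟩

lemma pos_inj {l : ℕ → ℕ} (hl : ∀ m, 5 ≤ l m) (n : ℕ) {w v : ℕ → ℕ × ℕ}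
    (hw : ∀ k < n, w k ∈ Sset (l k)) (hv : ∀ k < n, v k ∈ Sset (l k))
    (h : pos l w n = pos l v n) : ∀ k < n, w k = v k := by
  induction n with
  | zero => intro k hk; omega
  | succ n ih =>
    simp only [pos, Prod.mk.injEq] at h
    have a1 := Sset_lt (hl n) (hw n (by omega))
    have a2 := Sset_lt (hl n) (hv n (by omega))
    have b1 := digit_unique a1.1 a2.1 h.1
    have b2 := digit_unique a1.2 a2.2 h.2
    intro k hk
    rcases Nat.lt_succ_iff_lt_or_eq.1 hk with hk | rfl
    · exact ih (fun k hk => hw k (by omega)) (fun k hk => hv k (by omega))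
        (Prod.ext b1.1 b2.1) k hk
    · exact Prod.ext b1.2 b2.2

lemma word_eq_of_pos {l : ℕ → ℕ} (hl : ∀ m, 5 ≤ l m) (n : ℕ) {w v : ℕ → ℕ × ℕ}
    (hw : w ∈ Wn l n) (hv : v ∈ Wn l n) (h : pos l w n = pos l v n) : w = v := by
  funext k
  rcases lt_or_ge k n with hk | hk
  · exact pos_inj hl n hw.1 hv.1 h k hk
  · rw [hw.2 k hk, hv.2 k hk]

/-- The tiny arithmetic fact about intersections of lattice triangles. -/
lemma lattice_inter {X Y X' Y' : ℕ} {s t s' t' : ℝ} (hs : 0 ≤ s) (ht : 0 ≤ t) (hst : s + t ≤ 1)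
    (hs' : 0 ≤ s') (ht' : 0 ≤ t') (hst' : s' + t' ≤ 1)
    (h1 : (X : ℝ) + s = X' + s') (h2 : (Y : ℝ) + t = Y' + t') (hne : ¬ (X = X' ∧ Y = Y')) :
    ∃ j j' : Fin 3, s = (ev j).1 ∧ t = (ev j).2 ∧ s' = (ev j').1 ∧ t' = (ev j').2 := by
  have a1 : (X : ℤ) ≤ X' + 1 := by
    have : (X : ℝ) ≤ X' + 1 := by linarith
    exact_mod_cast this
  have a2 : (X' : ℤ) ≤ X + 1 := by
    have : (X' : ℝ) ≤ X + 1 := by linarith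
    exact_mod_cast this
  have a3 : (Y : ℤ) ≤ Y' + 1 := by
    have : (Y : ℝ) ≤ Y' + 1 := by linarith
    exact_mod_cast this
  have a4 : (Y' : ℤ) ≤ Y + 1 := by
    have : (Y' : ℝ) ≤ Y + 1 := by linarith
    exact_mod_cast this
  have a5 : (X : ℤ) + Y ≤ X' + Y' + 1 := by
    have : (X : ℝ) + Y ≤ X' + Y' + 1 := by linarith
    exact_mod_cast this
  have a6 : (X' : ℤ) + Y' ≤ X + Y + 1 := by
    have : (X' : ℝ) + Y' ≤ X + Y + 1 := by linarith
    exact_mod_cast this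
  have key : (X' = X + 1 ∧ Y' = Y) ∨ (X = X' + 1 ∧ Y = Y') ∨ (X' = X ∧ Y' = Y + 1) ∨
      (X = X' ∧ Y = Y' + 1) ∨ (X' = X + 1 ∧ Y = Y' + 1) ∨ (X = X' + 1 ∧ Y' = Y + 1) := by omega
  rcases key with ⟨rfl, rfl⟩ | ⟨rfl, rfl⟩ | ⟨rfl, rfl⟩ | ⟨rfl, rfl⟩ | ⟨rfl, rfl⟩ | ⟨rfl, rfl⟩ <;>
    push_cast at h1 h2
  · refine ⟨1, 0, ?_⟩; simp [ev]; refine ⟨?_, ?_, ?_, ?_⟩ <;> linarith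
  · refine ⟨0, 1, ?_⟩; simp [ev]; refine ⟨?_, ?_, ?_, ?_⟩ <;> linarith
  · refine ⟨2, 0, ?_⟩; simp [ev]; refine ⟨?_, ?_, ?_, ?_⟩ <;> linarith
  · refine ⟨0, 2, ?_⟩; simp [ev]; refine ⟨?_, ?_, ?_, ?_⟩ <;> linarith
  · refine ⟨1, 2, ?_⟩; simp [ev]; refine ⟨?_, ?_, ?_, ?_⟩ <;> linarith
  · refine ⟨2, 1, ?_⟩; simp [ev]; refine ⟨?_, ?_, ?_, ?_⟩ <;> linarith

/-- Distinct cells only meet at common vertices. -/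
lemma cell_inter (q : Fin 3 → E2) (hq : Equi q) {l : ℕ → ℕ} (hl : ∀ m, 5 ≤ l m) (n : ℕ)
    {w v : ℕ → ℕ × ℕ} (hw : w ∈ Wn l n) (hv : v ∈ Wn l n) (hne : w ≠ v) {x y : E2}
    (hx : x ∈ Tri q) (hy : y ∈ Tri q) (h : wordMap q l w n x = wordMap q l v n y) :
    ∃ j j' : Fin 3, x = q j ∧ y = q j' := by
  obtain ⟨s, t, hs, ht, hst, rfl⟩ := (mem_Tri_iff q x).1 hx
  obtain ⟨s', t', hs', ht', hst', rfl⟩ := (mem_Tri_iff q y).1 hy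
  rw [wordMap_PP q l hl, wordMap_PP q l hl] at h
  have h1 : (Ln l n : ℝ) ≠ 0 := by have := Ln_pos hl n; positivity
  obtain ⟨e1, e2⟩ := PP_inj q hq h
  rw [div_left_inj' h1] at e1 e2
  obtain ⟨j, j', r1, r2, r3, r4⟩ := lattice_inter hs ht hst hs' ht' hst' e1 e2 (by
    rintro ⟨c1, c2⟩
    exact hne (word_eq_of_pos hl n hw hv (Prod.ext c1 c2)))
  refine ⟨j, j', ?_, ?_⟩
  · rw [q_eq q j, r1, r2]
  · rw [q_eq q j', r3, r4]

/-- Equality of vertices in terms of lattice positions. -/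
lemma vertex_eq_iff (q : Fin 3 → E2) (hq : Equi q) {l : ℕ → ℕ} (hl : ∀ m, 5 ≤ l m) (n : ℕ)
    {w v : ℕ → ℕ × ℕ} (j j' : Fin 3) :
    wordMap q l w n (q j) = wordMap q l v n (q j') ↔ pos l w n + ev j = pos l v n + ev j' := by
  rw [wordMap_q q l hl, wordMap_q q l hl]
  have h1 : (Ln l n : ℝ) ≠ 0 := by have := Ln_pos hl n; positivity
  constructor
  · intro h
    obtain ⟨e1, e2⟩ := PP_inj q hq h
    rw [div_left_inj' h1] at e1 e2
    exact Prod.ext (by exact_mod_cast e1) (by exact_mod_cast e2)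
  · intro h; rw [h]

/-- Two distinct cells share at most one vertex. -/
lemma share_one (q : Fin 3 → E2) (hq : Equi q) {l : ℕ → ℕ} (hl : ∀ m, 5 ≤ l m) (n : ℕ)
    {w v : ℕ → ℕ × ℕ} (hw : w ∈ Wn l n) (hv : v ∈ Wn l n) (hne : w ≠ v) {a b c d : Fin 3}
    (h : wordMap q l w n (q a) = wordMap q l v n (q b))
    (h' : wordMap q l w n (q c) = wordMap q l v n (q d)) : a = c ∧ b = d := by
  rw [vertex_eq_iff q hq hl] at h h'
  have h0 : pos l w n ≠ pos l v n := fun e => hne (word_eq_of_pos hl n hw hv e)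
  generalize pos l w n = P at *
  generalize pos l v n = P' at *
  obtain ⟨X, Y⟩ := P
  obtain ⟨X', Y'⟩ := P'
  rcases ev_cases a with ⟨rfl, e1⟩ | ⟨rfl, e1⟩ | ⟨rfl, e1⟩ <;>
  rcases ev_cases b with ⟨rfl, e2⟩ | ⟨rfl, e2⟩ | ⟨rfl, e2⟩ <;>
  rcases ev_cases c with ⟨rfl, e3⟩ | ⟨rfl, e3⟩ | ⟨rfl, e3⟩ <;>
  rcases ev_cases d with ⟨rfl, e4⟩ | ⟨rfl, e4⟩ | ⟨rfl, e4⟩ <;>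
  simp only [e1, e2, e3, e4, Prod.mk_add_mk, Prod.mk.injEq, ne_eq] at h h' h0 <;>
  first | exact ⟨rfl, rfl⟩ | (exfalso; omega)

/-- No lattice vertex belongs to three cells (positions version). -/
lemma no_three_pos {l : ℕ → ℕ} (hl : ∀ m, 5 ≤ l m) (n : ℕ) {w v u : ℕ → ℕ × ℕ}
    (hw : ∀ k < n, w k ∈ Sset (l k)) (hv : ∀ k < n, v k ∈ Sset (l k))
    (hu : ∀ k < n, u k ∈ Sset (l k)) (h1 : pos l w n = pos l v n + (1, 0))
    (h2 : pos l w n = pos l u n + (0, 1)) : False := by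
  induction n with
  | zero => simp [pos] at h1
  | succ n ih =>
    simp only [pos, Prod.mk_add_mk, Prod.mk.injEq, add_zero] at h1 h2
    obtain ⟨w1, w2⟩ := hw n (by omega)
    obtain ⟨v1, v2⟩ := hv n (by omega)
    obtain ⟨u1, u2⟩ := hu n (by omega)
    have h5 := hl n
    have lw := Sset_lt h5 (hw n (by omega))
    have lv := Sset_lt h5 (hv n (by omega))
    have lu := Sset_lt h5 (hu n (by omega))
    obtain ⟨e1, e2⟩ := digit_unique lw.2 lv.2 h1.2
    obtain ⟨e3, e4⟩ := digit_unique lw.1 lu.1 h2.1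
    -- first coordinate against v
    have A : ((pos l w n).1 = (pos l v n).1 ∧ (w n).1 = (v n).1 + 1) ∨
        ((pos l w n).1 = (pos l v n).1 + 1 ∧ (w n).1 = 0 ∧ (v n).1 + 1 = l n) := by
      rcases Nat.lt_or_ge ((v n).1 + 1) (l n) with hlt | hge
      · left
        exact digit_unique lw.1 hlt (by omega)
      · right
        have : (v n).1 + 1 = l n := by omega
        have h' : l n * (pos l w n).1 + (w n).1 = l n * ((pos l v n).1 + 1) + 0 := by
          rw [mul_add]; omega
        have := digit_unique lw.1 (by omega) h'
        exact ⟨this.1, this.2, by omega⟩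
    have B : ((pos l w n).2 = (pos l u n).2 ∧ (w n).2 = (u n).2 + 1) ∨
        ((pos l w n).2 = (pos l u n).2 + 1 ∧ (w n).2 = 0 ∧ (u n).2 + 1 = l n) := by
      rcases Nat.lt_or_ge ((u n).2 + 1) (l n) with hlt | hge
      · left
        exact digit_unique lw.2 hlt (by omega)
      · right
        have : (u n).2 + 1 = l n := by omega
        have h' : l n * (pos l w n).2 + (w n).2 = l n * ((pos l u n).2 + 1) + 0 := by
          rw [mul_add]; omega
        have := digit_unique lw.2 (by omega) h'
        exact ⟨this.1, this.2, by omega⟩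
    simp only [mul_eq_zero] at w2 v2 u2
    rcases A with ⟨a1, a2⟩ | ⟨a1, a2, a3⟩ <;> rcases B with ⟨b1, b2⟩ | ⟨b1, b2, b3⟩
    · omega
    · omega
    · omega
    · exact ih (fun k hk => hw k (by omega)) (fun k hk => hv k (by omega))
        (fun k hk => hu k (by omega)) (Prod.ext a1 e1) (Prod.ext e3 b1)

/-- No vertex belongs to three distinct cells. -/
lemma no_three (q : Fin 3 → E2) (hq : Equi q) {l : ℕ → ℕ} (hl : ∀ m, 5 ≤ l m) (n : ℕ)
    {w v u : ℕ → ℕ × ℕ} (hw : w ∈ Wn l n) (hv : v ∈ Wn l n) (hu : u ∈ Wn l n)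
    (hwv : w ≠ v) (hwu : w ≠ u) (hvu : v ≠ u) {a b c : Fin 3}
    (h : wordMap q l w n (q a) = wordMap q l v n (q b))
    (h' : wordMap q l w n (q a) = wordMap q l u n (q c)) : False := by
  rw [vertex_eq_iff q hq hl] at h h'
  have e1 : a ≠ b := by
    rintro rfl; exact hwv (word_eq_of_pos hl n hw hv (add_right_cancel h))
  have e2 : a ≠ c := by
    rintro rfl; exact hwu (word_eq_of_pos hl n hw hu (add_right_cancel h'))
  have e3 : b ≠ c := by
    rintro rfl; exact hvu (word_eq_of_pos hl n hv hu (add_right_cancel (h.symm.trans h')))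
  have k1 := @no_three_pos l hl n w v u hw.1 hv.1 hu.1
  have k2 := @no_three_pos l hl n w u v hw.1 hu.1 hv.1
  have k3 := @no_three_pos l hl n v w u hv.1 hw.1 hu.1
  have k4 := @no_three_pos l hl n v u w hv.1 hu.1 hw.1
  have k5 := @no_three_pos l hl n u v w hu.1 hv.1 hw.1
  have k6 := @no_three_pos l hl n u w v hu.1 hw.1 hv.1
  generalize pos l w n = P at *
  generalize pos l v n = P' at *
  obtain ⟨X, Y⟩ := P
  obtain ⟨X', Y'⟩ := P'
  generalize pos l u n = P2 at *
  obtain ⟨X2, Y2⟩ := P2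
  rcases ev_cases a with ⟨rfl, r1⟩ | ⟨rfl, r1⟩ | ⟨rfl, r1⟩ <;>
  rcases ev_cases b with ⟨rfl, r2⟩ | ⟨rfl, r2⟩ | ⟨rfl, r2⟩ <;>
  rcases ev_cases c with ⟨rfl, r3⟩ | ⟨rfl, r3⟩ | ⟨rfl, r3⟩ <;>
  simp only [r1, r2, r3, Prod.mk_add_mk, Prod.mk.injEq] at h h' k1 k2 k3 k4 k5 k6 <;>
  first | exact absurd rfl e1 | exact absurd rfl e2 | exact absurd rfl e3 |
    exact k1 (by omega) (by omega) | exact k2 (by omega) (by omega) |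
    exact k3 (by omega) (by omega) | exact k4 (by omega) (by omega) |
    exact k5 (by omega) (by omega) | exact k6 (by omega) (by omega)

/-! ### Words -/

lemma sh_five {l : ℕ → ℕ} (hl : ∀ m, 5 ≤ l m) (n : ℕ) : ∀ m, 5 ≤ sh l n m := fun m => hl _

lemma sh_zero (l : ℕ → ℕ) : sh l 0 = l := rfl

lemma sh_sh (l : ℕ → ℕ) (n m : ℕ) : sh (sh l n) m = sh l (n + m) := by
  funext k; simp only [sh]; congr 1; omega

/-- Concatenation of words. -/
def cat (n : ℕ) (w v : ℕ → ℕ × ℕ) : ℕ → ℕ × ℕ := fun k => if k < n then w k else v (k - n)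

/-- First part of a word. -/
def pre (n : ℕ) (w : ℕ → ℕ × ℕ) : ℕ → ℕ × ℕ := fun k => if k < n then w k else (0, 0)

/-- Last part of a word. -/
def suf (n : ℕ) (w : ℕ → ℕ × ℕ) : ℕ → ℕ × ℕ := fun k => w (k + n)

/-- One letter word. -/
def single (i : ℕ × ℕ) : ℕ → ℕ × ℕ := fun k => if k = 0 then i else (0, 0)

lemma cat_pre_suf (n : ℕ) (w : ℕ → ℕ × ℕ) : cat n (pre n w) (suf n w) = w := by
  funext k
  simp only [cat, pre, suf]
  split_ifs with h
  · rfl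
  · congr 1; omega

lemma cat_mem {l : ℕ → ℕ} {n m : ℕ} {w v : ℕ → ℕ × ℕ} (hw : w ∈ Wn l n)
    (hv : v ∈ Wn (sh l n) m) : cat n w v ∈ Wn l (n + m) := by
  constructor
  · intro k hk
    simp only [cat]
    split_ifs with h
    · exact hw.1 k h
    · have := hv.1 (k - n) (by omega)
      simp only [sh] at this
      rwa [Nat.sub_add_cancel (by omega)] at this
  · intro k hk
    simp only [cat]
    rw [if_neg (by omega)]
    exact hv.2 _ (by omega)

lemma pre_mem {l : ℕ → ℕ} {n m : ℕ} {w : ℕ → ℕ × ℕ} (hw : w ∈ Wn l (n + m)) :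
    pre n w ∈ Wn l n := by
  constructor
  · intro k hk
    simp only [pre, if_pos hk]; exact hw.1 k (by omega)
  · intro k hk
    simp only [pre]; rw [if_neg (by omega)]

lemma suf_mem {l : ℕ → ℕ} {n m : ℕ} {w : ℕ → ℕ × ℕ} (hw : w ∈ Wn l (n + m)) :
    suf n w ∈ Wn (sh l n) m := by
  constructor
  · intro k hk
    exact hw.1 (k + n) (by omega)
  · intro k hk
    exact hw.2 (k + n) (by omega)

lemma pre_cat {l : ℕ → ℕ} {n : ℕ} {w v : ℕ → ℕ × ℕ} (hw : w ∈ Wn l n) :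
    pre n (cat n w v) = w := by
  funext k
  simp only [pre, cat]
  split_ifs with h
  · rfl
  · exact (hw.2 k (by omega)).symm

lemma suf_cat (n : ℕ) (w v : ℕ → ℕ × ℕ) : suf n (cat n w v) = v := by
  funext k
  simp only [suf, cat]
  rw [if_neg (by omega)]; congr 1; omega

lemma single_mem {l : ℕ → ℕ} {i : ℕ × ℕ} (hi : i ∈ Sset (l 0)) : single i ∈ Wn l 1 := by
  constructor
  · intro k hk
    obtain rfl : k = 0 := by omega
    exact hi
  · intro k hk
    simp only [single]; rw [if_neg (by omega)]

lemma eq_single {l : ℕ → ℕ} {w : ℕ → ℕ × ℕ} (hw : w ∈ Wn l 1) : w = single (w 0) := by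
  funext k
  simp only [single]
  split_ifs with h
  · rw [h]
  · exact hw.2 k (by omega)

lemma wordMap_congr (q : Fin 3 → E2) (l : ℕ → ℕ) {w v : ℕ → ℕ × ℕ} (n : ℕ)
    (h : ∀ k < n, w k = v k) : wordMap q l w n = wordMap q l v n := by
  induction n with
  | zero => rfl
  | succ n ih => simp only [wordMap]; rw [ih (fun k hk => h k (by omega)), h n (by omega)]

lemma wordMap_cat (q : Fin 3 → E2) (l : ℕ → ℕ) (w v : ℕ → ℕ × ℕ) (n m : ℕ) :
    wordMap q l (cat n w v) (n + m) = wordMap q l w n ∘ wordMap q (sh l n) v m := by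
  induction m with
  | zero =>
    show wordMap q l (cat n w v) n = _
    rw [wordMap_congr q l (v := w) n (fun k hk => by simp [cat, hk])]
    rfl
  | succ m ih =>
    show wordMap q l (cat n w v) (n + m) ∘ fmap q (l (n + m)) (cat n w v (n + m)) = _
    rw [ih]
    simp only [wordMap, cat, sh]
    rw [if_neg (by omega), Nat.add_sub_cancel_left, Nat.add_comm m n]
    rfl

lemma wordMap_split (q : Fin 3 → E2) (l : ℕ → ℕ) (w : ℕ → ℕ × ℕ) (n m : ℕ) :
    wordMap q l w (n + m) = wordMap q l (pre n w) n ∘ wordMap q (sh l n) (suf n w) m := by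
  conv_lhs => rw [← cat_pre_suf n w]
  exact wordMap_cat q l _ _ n m

lemma wordMap_single (q : Fin 3 → E2) (l : ℕ → ℕ) (i : ℕ × ℕ) :
    wordMap q l (single i) 1 = fmap q (l 0) i := by
  simp [wordMap, single]

lemma Sset_finite (l : ℕ) : (Sset l).Finite := by
  apply Set.Finite.subset ((Finset.range (l + 1) ×ˢ Finset.range (l + 1)).finite_toSet)
  intro p hp
  have := hp.1
  simp only [Finset.coe_product, Finset.coe_range, Set.mem_prod, Set.mem_Iio]
  omega

lemma Wn_zero (l : ℕ → ℕ) : Wn l 0 = {fun _ => (0, 0)} := by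
  ext w
  simp only [Wn, Set.mem_setOf_eq, Set.mem_singleton_iff]
  constructor
  · intro h; funext k; exact h.2 k (by omega)
  · rintro rfl; exact ⟨fun k hk => by omega, fun k _ => rfl⟩

lemma Wn_finite (l : ℕ → ℕ) (n : ℕ) : (Wn l n).Finite := by
  induction n with
  | zero => rw [Wn_zero]; exact Set.finite_singleton _
  | succ n ih =>
    apply Set.Finite.subset ((ih.prod (Sset_finite (l n))).image
      fun p => cat n p.1 (single p.2))
    intro w hw
    refine ⟨(pre n w, w n), ⟨pre_mem (m := 1) hw, hw.1 n (by omega)⟩, ?_⟩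
    have := eq_single (suf_mem (m := 1) hw)
    have h2 : suf n w 0 = w n := by simp [suf]
    rw [h2] at this
    show cat n (pre n w) (single (w n)) = w
    rw [← this, cat_pre_suf]

/-- Words as a finset. -/
def WF (l : ℕ → ℕ) (n : ℕ) : Finset (ℕ → ℕ × ℕ) := (Wn_finite l n).toFinset

/-- `S_l` as a finset. -/
def SF (l : ℕ) : Finset (ℕ × ℕ) := (Sset_finite l).toFinset

lemma mem_WF {l : ℕ → ℕ} {n : ℕ} {w : ℕ → ℕ × ℕ} : w ∈ WF l n ↔ w ∈ Wn l n := by simp [WF]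

lemma mem_SF {l : ℕ} {i : ℕ × ℕ} : i ∈ SF l ↔ i ∈ Sset l := by simp [SF]

lemma sum_WF_add (l : ℕ → ℕ) (n m : ℕ) (F : (ℕ → ℕ × ℕ) → ℝ) :
    ∑ w ∈ WF l (n + m), F w = ∑ w ∈ WF l n, ∑ v ∈ WF (sh l n) m, F (cat n w v) := by
  rw [← Finset.sum_product']
  symm
  apply Finset.sum_bij' (fun p _ => cat n p.1 p.2) (fun w _ => (pre n w, suf n w))
  · rintro ⟨w, v⟩ h
    rw [Finset.mem_product, mem_WF, mem_WF] at h
    exact mem_WF.2 (cat_mem h.1 h.2)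
  · intro w h
    rw [mem_WF] at h
    rw [Finset.mem_product, mem_WF, mem_WF]
    exact ⟨pre_mem h, suf_mem h⟩
  · rintro ⟨w, v⟩ h
    rw [Finset.mem_product, mem_WF, mem_WF] at h
    rw [pre_cat h.1, suf_cat]
  · intro w h
    exact cat_pre_suf n w
  · intros; rfl

lemma sum_WF_one (l : ℕ → ℕ) (F : (ℕ → ℕ × ℕ) → ℝ) :
    ∑ w ∈ WF l 1, F w = ∑ i ∈ SF (l 0), F (single i) := by
  symm
  apply Finset.sum_bij' (fun i _ => single i) (fun w _ => w 0)
  · intro i h; exact mem_WF.2 (single_mem (mem_SF.1 h))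
  · intro w h; exact mem_SF.2 ((mem_WF.1 h).1 0 (by omega))
  · intro i h; simp [single]
  · intro w h; exact (eq_single (mem_WF.1 h)).symm
  · intros; rfl

lemma sum_WF_zero (l : ℕ → ℕ) (F : (ℕ → ℕ × ℕ) → ℝ) :
    ∑ w ∈ WF l 0, F w = F (fun _ => (0, 0)) := by
  have : WF l 0 = {fun _ => (0, 0)} := by
    ext w; rw [mem_WF, Wn_zero]; simp
  rw [this, Finset.sum_singleton]

/-! ### Energy -/

/-- Energy of a triangle. -/
def e3 (a b c : ℝ) : ℝ := (a - b) ^ 2 + (b - c) ^ 2 + (c - a) ^ 2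

lemma e3_nonneg (a b c : ℝ) : 0 ≤ e3 a b c := by unfold e3; positivity

/-- Energy of a function on the vertices. -/
def e0 (q : Fin 3 → E2) (u : E2 → ℝ) : ℝ := e3 (u (q 0)) (u (q 1)) (u (q 2))

/-- Diagonal energies. -/
def EN (q : Fin 3 → E2) (l : ℕ → ℕ) (n : ℕ) (u : E2 → ℝ) : ℝ :=
  (Rn l n)⁻¹ * ∑ w ∈ WF l n, e0 q (u ∘ wordMap q l w n)

lemma En_eq (q : Fin 3 → E2) (l : ℕ → ℕ) (n : ℕ) (u : E2 → ℝ) : En q l n u u = EN q l n u := by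
  unfold En EN
  congr 1
  rw [finsum_mem_eq_finite_toFinset_sum _ (Wn_finite l n)]
  apply Finset.sum_congr rfl
  intro w _
  simp only [E0, e0, e3, Fin.sum_univ_three]
  ring

lemma Rn_add (l : ℕ → ℕ) (n m : ℕ) : Rn l (n + m) = Rn l n * Rn (sh l n) m := by
  simp only [Rn, Finset.prod_range_add, sh]
  congr 1
  apply Finset.prod_congr rfl
  intro k _; rw [add_comm]

lemma Ln_add (l : ℕ → ℕ) (n m : ℕ) : Ln l (n + m) = Ln l n * Ln (sh l n) m := by
  simp only [Ln, Finset.prod_range_add, sh]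
  congr 1
  apply Finset.prod_congr rfl
  intro k _; rw [add_comm]

lemma EN_add (q : Fin 3 → E2) (l : ℕ → ℕ) (n m : ℕ) (u : E2 → ℝ) :
    EN q l (n + m) u = (Rn l n)⁻¹ * ∑ w ∈ WF l n, EN q (sh l n) m (u ∘ wordMap q l w n) := by
  simp only [EN]
  rw [← Finset.mul_sum, sum_WF_add, Rn_add, mul_inv, mul_assoc]
  congr 2
  apply Finset.sum_congr rfl
  intro w _
  apply Finset.sum_congr rfl
  intro v _
  rw [wordMap_cat]; rfl

lemma EN_zero (q : Fin 3 → E2) (l : ℕ → ℕ) (u : E2 → ℝ) : EN q l 0 u = e0 q u := by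
  simp only [EN, sum_WF_zero, Rn]
  simp [wordMap]

lemma EN_one (q : Fin 3 → E2) (l : ℕ → ℕ) (u : E2 → ℝ) :
    EN q l 1 u = (rl (l 0))⁻¹ * ∑ i ∈ SF (l 0), e0 q (u ∘ fmap q (l 0) i) := by
  simp only [EN, sum_WF_one, wordMap_single, Rn]
  simp

/-- Decomposition with respect to the first letter. -/
lemma EN_succ' (q : Fin 3 → E2) (l : ℕ → ℕ) (m : ℕ) (u : E2 → ℝ) :
    EN q l (1 + m) u = (rl (l 0))⁻¹ * ∑ i ∈ SF (l 0), EN q (sh l 1) m (u ∘ fmap q (l 0) i) := by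
  rw [EN_add, sum_WF_one]
  simp only [wordMap_single, Rn]
  simp

/-- Decomposition with respect to the last letter. -/
lemma EN_succ (q : Fin 3 → E2) (l : ℕ → ℕ) (n : ℕ) (u : E2 → ℝ) :
    EN q l (n + 1) u = (Rn l n)⁻¹ * ∑ w ∈ WF l n, ((rl (l n))⁻¹ *
      ∑ i ∈ SF (l n), e0 q (u ∘ wordMap q l w n ∘ fmap q (l n) i)) := by
  rw [EN_add]
  simp only [EN_one, sh, Nat.zero_add]
  rfl

lemma e0_nonneg (q : Fin 3 → E2) (u : E2 → ℝ) : 0 ≤ e0 q u := e3_nonneg _ _ _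

lemma EN_nonneg (q : Fin 3 → E2) (l : ℕ → ℕ) (n : ℕ) (u : E2 → ℝ) : 0 ≤ EN q l n u := by
  unfold EN
  have := Rn_pos l n
  have : 0 ≤ ∑ w ∈ WF l n, e0 q (u ∘ wordMap q l w n) :=
    Finset.sum_nonneg fun _ _ => e0_nonneg _ _
  positivity

/-! ### The gasket -/

/-- level `n` approximation. -/
def Kn (q : Fin 3 → E2) (l : ℕ → ℕ) (n : ℕ) : Set E2 := ⋃ w ∈ Wn l n, wordMap q l w n '' Tri q

lemma mem_Kn {q : Fin 3 → E2} {l : ℕ → ℕ} {n : ℕ} {x : E2} :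
    x ∈ Kn q l n ↔ ∃ w ∈ Wn l n, ∃ t ∈ Tri q, wordMap q l w n t = x := by
  simp only [Kn, Set.mem_iUnion, Set.mem_image, exists_prop]

lemma mem_Gasket {q : Fin 3 → E2} {l : ℕ → ℕ} {x : E2} :
    x ∈ Gasket q l ↔ ∀ n, x ∈ Kn q l n := by
  simp only [Gasket, Set.mem_iInter]; rfl

lemma fmap_Tri (q : Fin 3 → E2) {l : ℕ} (hl : 5 ≤ l) {i : ℕ × ℕ} (hi : i ∈ Sset l) {x : E2}
    (hx : x ∈ Tri q) : fmap q l i x ∈ Tri q := by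
  obtain ⟨s, t, hs, ht, hst, rfl⟩ := (mem_Tri_iff q x).1 hx
  rw [fmap_PP, mem_Tri_iff]
  refine ⟨_, _, by positivity, by positivity, ?_, rfl⟩
  rw [← add_div, div_le_one (by positivity)]
  have h1 : i.1 + i.2 + 1 ≤ l := by have := hi.1; omega
  have h2 : (i.1 : ℝ) + i.2 + 1 ≤ l := by exact_mod_cast h1
  linarith

lemma Kn_succ (q : Fin 3 → E2) {l : ℕ → ℕ} (hl : ∀ m, 5 ≤ l m) (n : ℕ) :
    Kn q l (n + 1) ⊆ Kn q l n := by
  intro x hx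
  obtain ⟨w, hw, t, ht, rfl⟩ := mem_Kn.1 hx
  rw [mem_Kn]
  refine ⟨pre n w, pre_mem (m := 1) hw, fmap q (l n) (w n) t,
    fmap_Tri q (hl n) (hw.1 n (by omega)) ht, ?_⟩
  simp only [wordMap, Function.comp]
  rw [wordMap_congr q l n (w := pre n w) (v := w) (fun k hk => by simp [pre, hk])]

lemma Kn_anti (q : Fin 3 → E2) {l : ℕ → ℕ} (hl : ∀ m, 5 ≤ l m) : Antitone (Kn q l) :=
  antitone_nat_of_succ_le fun n => Kn_succ q hl n

lemma mem_Kn_add {q : Fin 3 → E2} {l : ℕ → ℕ} {n m : ℕ} {x : E2} :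
    x ∈ Kn q l (n + m) ↔ ∃ w ∈ Wn l n, ∃ z ∈ Kn q (sh l n) m, wordMap q l w n z = x := by
  constructor
  · intro h
    obtain ⟨w, hw, t, ht, rfl⟩ := mem_Kn.1 h
    refine ⟨pre n w, pre_mem hw, wordMap q (sh l n) (suf n w) m t,
      mem_Kn.2 ⟨_, suf_mem hw, t, ht, rfl⟩, ?_⟩
    rw [wordMap_split q l w n m]; rfl
  · rintro ⟨w, hw, z, hz, rfl⟩
    obtain ⟨v, hv, t, ht, rfl⟩ := mem_Kn.1 hz
    refine mem_Kn.2 ⟨cat n w v, cat_mem hw hv, t, ht, ?_⟩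
    rw [wordMap_cat]; rfl

lemma wordMap_mem_Gasket {q : Fin 3 → E2} {l : ℕ → ℕ} (hl : ∀ m, 5 ≤ l m) {n : ℕ}
    {w : ℕ → ℕ × ℕ} (hw : w ∈ Wn l n) {z : E2} (hz : z ∈ Gasket q (sh l n)) :
    wordMap q l w n z ∈ Gasket q l := by
  rw [mem_Gasket]
  intro m
  apply Kn_anti q hl (show m ≤ n + m by omega)
  exact mem_Kn_add.2 ⟨w, hw, z, mem_Gasket.1 hz m, rfl⟩

lemma exists_word {q : Fin 3 → E2} {l : ℕ → ℕ} (hl : ∀ m, 5 ≤ l m) (n : ℕ) {x : E2}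
    (hx : x ∈ Gasket q l) : ∃ w ∈ Wn l n, ∃ z ∈ Gasket q (sh l n), wordMap q l w n z = x := by
  have h1 : ∀ m, ∃ w ∈ Wn l n, ∃ z ∈ Kn q (sh l n) m, wordMap q l w n z = x := fun m =>
    mem_Kn_add.1 (mem_Gasket.1 hx (n + m))
  choose w hw z hz hwz using h1
  haveI : Finite (Wn l n) := (Wn_finite l n)
  obtain ⟨v, hv⟩ := Finite.exists_infinite_fiber (fun m => (⟨w m, hw m⟩ : Wn l n))
  have hv' : Set.Infinite ((fun m => (⟨w m, hw m⟩ : Wn l n)) ⁻¹' {v}) := Set.infinite_coe_iff.1 hv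
  obtain ⟨m0, hm0⟩ := hv'.nonempty
  have e0 : w m0 = v := congrArg Subtype.val hm0
  refine ⟨v, v.2, z m0, ?_, by rw [← e0]; exact hwz m0⟩
  rw [mem_Gasket]
  intro m
  obtain ⟨m1, hm1, hlt⟩ := hv'.exists_gt m
  have e1 : w m1 = v := congrArg Subtype.val hm1
  have : z m0 = z m1 := by
    apply wordMap_inj q l hl v n
    have a := hwz m0
    have b := hwz m1
    rw [e0] at a; rw [e1] at b
    rw [a, b]
  rw [this]
  exact Kn_anti q (sh_five hl n) hlt.le (hz m1)

/-- Boundary of the triangle. -/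
lemma bdry_step {l : ℕ} (hl : 5 ≤ l) {s t : ℝ} (hs : 0 ≤ s) (ht : 0 ≤ t) (hst : s + t ≤ 1)
    (h : s * t * (1 - s - t) = 0) : ∃ i ∈ Sset l, ∃ s' t' : ℝ, 0 ≤ s' ∧ 0 ≤ t' ∧ s' + t' ≤ 1 ∧
      s' * t' * (1 - s' - t') = 0 ∧ s = (i.1 + s') / l ∧ t = (i.2 + t') / l := by
  have hl0 : (0 : ℝ) < l := by positivity
  have key : ∀ s : ℝ, 0 ≤ s → s ≤ 1 → ∃ i : ℕ, i ≤ l - 1 ∧ 0 ≤ s * l - i ∧ s * l - i ≤ 1 := by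
    intro s hs hs1
    rcases eq_or_lt_of_le hs1 with rfl | hlt
    · refine ⟨l - 1, le_rfl, ?_, ?_⟩ <;> rw [Nat.cast_sub (by omega)] <;> push_cast <;> linarith
    · refine ⟨⌊s * l⌋₊, ?_, ?_, ?_⟩
      · have : ⌊s * l⌋₊ < l := by
          rw [Nat.floor_lt (by positivity)]
          nlinarith
        omega
      · have := Nat.floor_le (show 0 ≤ s * l by positivity); linarith
      · have := Nat.lt_floor_add_one (s * l); linarith
  rcases mul_eq_zero.1 h with h | h
  · rcases mul_eq_zero.1 h with rfl | rfl
    · obtain ⟨i, h1, h2, h3⟩ := key t ht (by linarith)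
      refine ⟨(0, i), ⟨by simpa using h1, by simp⟩, 0, t * l - i, le_rfl, h2, by linarith,
        by ring, by simp, by field_simp; ring⟩
    · obtain ⟨i, h1, h2, h3⟩ := key s hs (by linarith)
      refine ⟨(i, 0), ⟨by simpa using h1, by simp⟩, s * l - i, 0, h2, le_rfl, by linarith,
        by ring, by field_simp; ring, by simp⟩
  · obtain ⟨i, h1, h2, h3⟩ := key s hs (by linarith)
    have h4 : ((l - 1 - i : ℕ) : ℝ) = l - 1 - i := by
      rw [Nat.cast_sub h1, Nat.cast_sub (by omega)]; simp
    have h5 : t = 1 - s := by linarith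
    refine ⟨(i, l - 1 - i), ⟨by simp; omega, ?_⟩, s * l - i, 1 - (s * l - i), h2, by linarith,
        by linarith, by ring, by field_simp; ring, ?_⟩
    · simp
    · simp only [h4]
      rw [h5]
      field_simp
      ring

lemma bdry_mem_Kn (q : Fin 3 → E2) {l : ℕ → ℕ} (hl : ∀ m, 5 ≤ l m) (n : ℕ) {s t : ℝ}
    (hs : 0 ≤ s) (ht : 0 ≤ t) (hst : s + t ≤ 1) (h : s * t * (1 - s - t) = 0) :
    PP q s t ∈ Kn q l n := by
  induction n generalizing l s t with
  | zero =>
    rw [mem_Kn]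
    exact ⟨fun _ => (0, 0), by rw [Wn_zero]; rfl, PP q s t,
      (mem_Tri_iff q _).2 ⟨s, t, hs, ht, hst, rfl⟩, rfl⟩
  | succ n ih =>
    rw [add_comm n 1, mem_Kn_add]
    obtain ⟨i, hi, s', t', a1, a2, a3, a4, a5, a6⟩ := bdry_step (hl 0) hs ht hst h
    refine ⟨single i, single_mem hi, PP q s' t', ih (sh_five hl 1) a1 a2 a3 a4, ?_⟩
    rw [wordMap_single, fmap_PP, ← a5, ← a6]

lemma bdry_mem (q : Fin 3 → E2) {l : ℕ → ℕ} (hl : ∀ m, 5 ≤ l m) {s t : ℝ}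
    (hs : 0 ≤ s) (ht : 0 ≤ t) (hst : s + t ≤ 1) (h : s * t * (1 - s - t) = 0) :
    PP q s t ∈ Gasket q l := mem_Gasket.2 fun n => bdry_mem_Kn q hl n hs ht hst h

lemma q_mem (q : Fin 3 → E2) {l : ℕ → ℕ} (hl : ∀ m, 5 ≤ l m) (j : Fin 3) : q j ∈ Gasket q l := by
  rw [q_eq q j]
  apply bdry_mem q hl <;> fin_cases j <;> simp [ev]

lemma Gasket_sub_Tri (q : Fin 3 → E2) (l : ℕ → ℕ) : Gasket q l ⊆ Tri q := by
  intro x hx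
  obtain ⟨w, hw, t, ht, rfl⟩ := mem_Kn.1 (mem_Gasket.1 hx 0)
  exact ht

lemma Cell_eq {q : Fin 3 → E2} (hq : Equi q) {l : ℕ → ℕ} (hl : ∀ m, 5 ≤ l m) {n : ℕ}
    {w : ℕ → ℕ × ℕ} (hw : w ∈ Wn l n) : Cell q l n w = wordMap q l w n '' Gasket q (sh l n) := by
  ext x
  constructor
  · rintro ⟨hx, t, ht, rfl⟩
    obtain ⟨v, hv, z, hz, e⟩ := exists_word hl n hx
    by_cases hvw : v = w
    · subst hvw; exact ⟨z, hz, e⟩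
    · obtain ⟨j, j', h1, h2⟩ := cell_inter q hq hl n hv hw hvw (Gasket_sub_Tri q _ hz) ht e
      subst h2
      exact ⟨q j', q_mem q (sh_five hl n) j', rfl⟩
  · rintro ⟨z, hz, rfl⟩
    exact ⟨wordMap_mem_Gasket hl hw hz, z, Gasket_sub_Tri q _ hz, rfl⟩

lemma Tri_compact (q : Fin 3 → E2) : IsCompact (Tri q) :=
  (Set.finite_range q).isCompact_convexHull ℝ

lemma Gasket_closed (q : Fin 3 → E2) (l : ℕ → ℕ) : IsClosed (Gasket q l) := by
  apply isClosed_iInter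
  intro n
  apply (Wn_finite l n).isClosed_biUnion
  intro w _
  exact ((Tri_compact q).image (wordMap_continuous q l w n)).isClosed

lemma Cell_closed (q : Fin 3 → E2) (l : ℕ → ℕ) (n : ℕ) (w : ℕ → ℕ × ℕ) :
    IsClosed (Cell q l n w) :=
  (Gasket_closed q l).inter ((Tri_compact q).image (wordMap_continuous q l w n)).isClosed

lemma exists_Cell {q : Fin 3 → E2} {l : ℕ → ℕ} (hl : ∀ m, 5 ≤ l m) (n : ℕ) {x : E2}
    (hx : x ∈ Gasket q l) : ∃ w ∈ Wn l n, x ∈ Cell q l n w := by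
  obtain ⟨w, hw, z, hz, rfl⟩ := exists_word hl n hx
  exact ⟨w, hw, hx, z, Gasket_sub_Tri q _ hz, rfl⟩

/-- Local covering. -/
lemma local_cover {q : Fin 3 → E2} {l : ℕ → ℕ} (hl : ∀ m, 5 ≤ l m) (n : ℕ) (x : E2) :
    ∃ ε > 0, ∀ z ∈ Gasket q l, dist z x < ε →
      ∃ w ∈ Wn l n, x ∈ Cell q l n w ∧ z ∈ Cell q l n w := by
  have hc : IsClosed (⋃ w ∈ {w ∈ Wn l n | x ∉ Cell q l n w}, Cell q l n w) :=
    ((Wn_finite l n).subset (Set.sep_subset _ _)).isClosed_biUnion fun w _ => Cell_closed q l n w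
  have hx : x ∈ (⋃ w ∈ {w ∈ Wn l n | x ∉ Cell q l n w}, Cell q l n w)ᶜ := by
    simp only [Set.mem_compl_iff, Set.mem_iUnion, not_exists]
    rintro w ⟨_, h⟩ h'
    exact h h'
  obtain ⟨ε, hε, h⟩ := Metric.isOpen_iff.1 hc.isOpen_compl x hx
  refine ⟨ε, hε, fun z hz hd => ?_⟩
  obtain ⟨w, hw, hzw⟩ := exists_Cell hl n hz
  refine ⟨w, hw, ?_, hzw⟩
  by_contra hxw
  exact h (Metric.mem_ball.2 hd) (Set.mem_iUnion₂.2 ⟨w, ⟨hw, hxw⟩, hzw⟩)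

lemma Tri_dist {q : Fin 3 → E2} (hq : Equi q) {x y : E2} (hx : x ∈ Tri q) (hy : y ∈ Tri q) :
    dist x y ≤ 1 := by
  obtain ⟨s, t, hs, ht, hst, rfl⟩ := (mem_Tri_iff q x).1 hx
  obtain ⟨s', t', hs', ht', hst', rfl⟩ := (mem_Tri_iff q y).1 hy
  have h := PP_dist_sq q hq s t s' t'
  have h0 : 0 ≤ dist (PP q s t) (PP q s' t') := dist_nonneg
  have : (s - s') ^ 2 + (s - s') * (t - t') + (t - t') ^ 2 ≤ 1 := by
    have a1 : s - s' ≤ 1 := by linarith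
    have a2 : -1 ≤ s - s' := by linarith
    have b1 : t - t' ≤ 1 := by linarith
    have b2 : -1 ≤ t - t' := by linarith
    have c1 : (s - s') + (t - t') ≤ 1 := by linarith
    have c2 : -1 ≤ (s - s') + (t - t') := by linarith
    generalize s - s' = a at *
    generalize t - t' = b at *
    have q1 : a ^ 2 ≤ 1 := by nlinarith
    have q2 : b ^ 2 ≤ 1 := by nlinarith
    have q3 : (a + b) ^ 2 ≤ 1 := by nlinarith
    rcases le_total 0 a with ha | ha <;> rcases le_total 0 b with hb | hb <;>
      rcases le_total 0 (a + b) with hab | hab <;> nlinarith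
  nlinarith

lemma mem_Vn {q : Fin 3 → E2} {l : ℕ → ℕ} {n : ℕ} {x : E2} :
    x ∈ Vn q l n ↔ ∃ w ∈ Wn l n, ∃ j, wordMap q l w n (q j) = x := by
  simp only [Vn, V0, Set.mem_iUnion, Set.mem_image, Set.mem_range, exists_prop,
    exists_exists_eq_and]

lemma five_pow_le {l : ℕ → ℕ} (hl : ∀ m, 5 ≤ l m) (n : ℕ) : 5 ^ n ≤ Ln l n := by
  have := Finset.pow_card_le_prod (s := Finset.range n) l 5 (fun k _ => hl k)
  simpa [Ln] using this

/-! ### The level one graph -/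

lemma sum_SF (m : ℕ) (hm : 1 ≤ m) (F : ℕ × ℕ → ℝ) : ∑ i ∈ SF (m + 1), F i
    = ∑ s ∈ Finset.range m, (F (s, 0) + F (m - s, s) + F (0, m - s)) := by
  have h : ∀ s, F (s, 0) + F (m - s, s) + F (0, m - s)
      = ∑ j : Fin 3, F ((![(s, 0), (m - s, s), (0, m - s)] : Fin 3 → ℕ × ℕ) j) := by
    intro s; simp [Fin.sum_univ_three]
  simp only [h]
  rw [← Finset.sum_product']
  symm
  apply Finset.sum_bij' (fun p _ => (![(p.1, 0), (m - p.1, p.1), (0, m - p.1)] : Fin 3 → ℕ × ℕ) p.2)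
    (fun i _ => if i.2 = 0 ∧ i.1 < m then (i.1, (0 : Fin 3)) else
      if i.1 + i.2 = m ∧ 1 ≤ i.1 then (i.2, 1) else (m - i.2, 2))
  · rintro ⟨s, j⟩ hs
    simp only [Finset.mem_product, Finset.mem_range, Finset.mem_univ, and_true] at hs
    rw [mem_SF]
    fin_cases j
    · simp [Sset]; omega
    · simp [Sset]; omega
    · simp [Sset]
  · rintro ⟨i, j⟩ hi
    rw [mem_SF] at hi
    obtain ⟨h1, h2⟩ := hi
    simp only [mul_eq_zero] at h1 h2
    simp only [Finset.mem_product, Finset.mem_univ, and_true, Finset.mem_range]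
    split_ifs <;> simp <;> omega
  · rintro ⟨s, j⟩ hs
    simp only [Finset.mem_product, Finset.mem_range, Finset.mem_univ, and_true] at hs
    fin_cases j
    · simp [hs]
    · have key : ∀ s < m, (if s = 0 ∧ m - s < m then (m - s, (0 : Fin 3)) else
          if m - s + s = m ∧ 1 ≤ m - s then (s, 1) else (m - s, 2)) = (s, 1) := by
        intro s hs
        rw [if_neg (by omega), if_pos (by omega)]
      exact key s hs
    · have key : ∀ s < m, (if m - s = 0 ∧ 0 < m then (0, (0 : Fin 3)) else
          if 0 + (m - s) = m ∧ 1 ≤ 0 then (m - s, 1) else (m - (m - s), 2)) = (s, 2) := by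
        intro s hs
        rw [if_neg (by omega), if_neg (by omega)]
        simp; omega
      exact key s hs
  · rintro ⟨i, j⟩ hi
    rw [mem_SF] at hi
    obtain ⟨h1, h2⟩ := hi
    simp only [mul_eq_zero] at h1 h2
    simp only
    split_ifs with a b
    · simp [a.1]
    · simp; omega
    · simp; omega
  · intros; rfl

lemma sum_range_four (p : ℕ) (F : ℕ → ℝ) : ∑ s ∈ Finset.range (p + 4), F s
    = F 0 + F 1 + ∑ t ∈ Finset.range (p + 1), F (t + 2) + F (p + 3) := by
  rw [Finset.sum_range_succ, Finset.sum_range_succ', Finset.sum_range_succ']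
  simp only [Nat.zero_add]
  ring

/-- Energy of a lattice function on a cell. -/
def eU (U : ℕ → ℕ → ℝ) (i : ℕ × ℕ) : ℝ :=
  e3 (U i.1 i.2) (U (i.1 + 1) i.2) (U i.1 (i.2 + 1))

lemma eU_nonneg (U : ℕ → ℕ → ℝ) (i : ℕ × ℕ) : 0 ≤ eU U i := e3_nonneg _ _ _

lemma sum_SF' (p : ℕ) (F : ℕ × ℕ → ℝ) : ∑ i ∈ SF (p + 5), F i
    = (F (0, 0) + F (p + 4, 0) + F (0, p + 4)) + (F (1, 0) + F (p + 3, 1) + F (0, p + 3))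
      + (F (p + 3, 0) + F (1, p + 3) + F (0, 1))
      + (∑ t ∈ Finset.range (p + 1), F (t + 2, 0) + ∑ t ∈ Finset.range (p + 1), F (p + 2 - t, t + 2)
        + ∑ t ∈ Finset.range (p + 1), F (0, p + 2 - t)) := by
  rw [sum_SF (p + 4) (by omega), sum_range_four, ← Finset.sum_add_distrib, ← Finset.sum_add_distrib]
  have h1 : p + 4 - (p + 3) = 1 := by omega
  have h2 : p + 4 - 1 = p + 3 := by omega
  have h3 : ∀ t, p + 4 - (t + 2) = p + 2 - t := by intro t; omega
  simp only [h1, h2, h3, Nat.sub_zero]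
  ring

lemma tele_cs (M : ℕ) (hM : 1 ≤ M) (f : ℕ → ℝ) :
    (f M - f 0) ^ 2 / M ≤ ∑ t ∈ Finset.range M, (f (t + 1) - f t) ^ 2 := by
  have h := sq_sum_le_card_mul_sum_sq (s := Finset.range M) (f := fun t => f (t + 1) - f t)
  rw [Finset.sum_range_sub, Finset.card_range] at h
  rw [div_le_iff₀ (by positivity)]
  linarith

lemma three_cells (v p p' a b m : ℝ) :
    (3 / 5) * e3 v p p' ≤ e3 v a b + e3 a p m + e3 b m p' := by
  have : e3 v a b + e3 a p m + e3 b m p' - (3 / 5) * e3 v p p'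
      = 2 * (a - (2 * v + 2 * p + p') / 5) ^ 2 + 2 * (b - (2 * v + 2 * p' + p) / 5) ^ 2
        + 2 * (m - (2 * p + 2 * p' + v) / 5) ^ 2
        + ((a - (2 * v + 2 * p + p') / 5) - (b - (2 * v + 2 * p' + p) / 5)) ^ 2
        + ((a - (2 * v + 2 * p + p') / 5) - (m - (2 * p + 2 * p' + v) / 5)) ^ 2
        + ((b - (2 * v + 2 * p' + p) / 5) - (m - (2 * p + 2 * p' + v) / 5)) ^ 2 := by
    unfold e3; ring
  have h2 : 0 ≤ e3 v a b + e3 a p m + e3 b m p' - (3 / 5) * e3 v p p' := by rw [this]; positivity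
  linarith

lemma hexagon (N : ℝ) (hN : 0 < N) (v0 v1 v2 a b c d e f : ℝ) :
    9 / (6 * N + 25) * e3 v0 v1 v2 ≤ (3 / 5) * e3 v0 a b + (3 / 5) * e3 v1 c d + (3 / 5) * e3 v2 e f
      + 3 / 2 * ((a - c) ^ 2 / N) + 3 / 2 * ((d - e) ^ 2 / N) + 3 / 2 * ((f - b) ^ 2 / N) := by
  have hD : 0 < 6 * N + 25 := by positivity
  have key : (3 / 5) * e3 v0 a b + (3 / 5) * e3 v1 c d + (3 / 5) * e3 v2 e f
      + 3 / 2 * ((a - c) ^ 2 / N) + 3 / 2 * ((d - e) ^ 2 / N) + 3 / 2 * ((f - b) ^ 2 / N)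
      - 9 / (6 * N + 25) * e3 v0 v1 v2
    = (3 / 5) * e3 0 (a - ((6 * N + 10) * v0 + 10 * v1 + 5 * v2) / (6 * N + 25))
          (b - ((6 * N + 10) * v0 + 10 * v2 + 5 * v1) / (6 * N + 25))
      + (3 / 5) * e3 0 (c - ((6 * N + 10) * v1 + 10 * v0 + 5 * v2) / (6 * N + 25))
          (d - ((6 * N + 10) * v1 + 10 * v2 + 5 * v0) / (6 * N + 25))
      + (3 / 5) * e3 0 (e - ((6 * N + 10) * v2 + 10 * v1 + 5 * v0) / (6 * N + 25))
          (f - ((6 * N + 10) * v2 + 10 * v0 + 5 * v1) / (6 * N + 25))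
      + 3 / 2 * (((a - ((6 * N + 10) * v0 + 10 * v1 + 5 * v2) / (6 * N + 25))
          - (c - ((6 * N + 10) * v1 + 10 * v0 + 5 * v2) / (6 * N + 25))) ^ 2 / N)
      + 3 / 2 * (((d - ((6 * N + 10) * v1 + 10 * v2 + 5 * v0) / (6 * N + 25))
          - (e - ((6 * N + 10) * v2 + 10 * v1 + 5 * v0) / (6 * N + 25))) ^ 2 / N)
      + 3 / 2 * (((f - ((6 * N + 10) * v2 + 10 * v0 + 5 * v1) / (6 * N + 25))
          - (b - ((6 * N + 10) * v0 + 10 * v2 + 5 * v1) / (6 * N + 25))) ^ 2 / N) := by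
    unfold e3; field_simp; ring
  have : 0 ≤ (3 / 5) * e3 v0 a b + (3 / 5) * e3 v1 c d + (3 / 5) * e3 v2 e f
      + 3 / 2 * ((a - c) ^ 2 / N) + 3 / 2 * ((d - e) ^ 2 / N) + 3 / 2 * ((f - b) ^ 2 / N)
      - 9 / (6 * N + 25) * e3 v0 v1 v2 := by
    rw [key]
    unfold e3
    positivity
  linarith

lemma rl_eq (p : ℕ) : rl (p + 5) = 9 / (6 * ((p + 1 : ℕ) : ℝ) + 25) := by
  unfold rl
  push_cast
  rw [inv_eq_one_div, div_eq_div_iff (by positivity) (by positivity)]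
  ring

lemma e3_ge (a b c : ℝ) : 3 / 2 * (a - b) ^ 2 ≤ e3 a b c := by
  unfold e3; nlinarith [sq_nonneg (2 * c - a - b)]

lemma e3_perm1 (a b c : ℝ) : e3 a b c = e3 b c a := by unfold e3; ring
lemma e3_perm2 (a b c : ℝ) : e3 a b c = e3 b a c := by unfold e3; ring

/-- Trace inequality. -/
lemma trace_ineq {l : ℕ} (hl : 5 ≤ l) (U : ℕ → ℕ → ℝ) :
    rl l * e3 (U 0 0) (U l 0) (U 0 l) ≤ ∑ i ∈ SF l, eU U i := by
  obtain ⟨p, rfl⟩ : ∃ p, l = p + 5 := ⟨l - 5, by omega⟩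
  rw [sum_SF', rl_eq]
  have hN : (0 : ℝ) < ((p + 1 : ℕ) : ℝ) := by positivity
  have c0 := three_cells (U 0 0) (U 2 0) (U 0 2) (U 1 0) (U 0 1) (U 1 1)
  have c1 := three_cells (U (p + 5) 0) (U (p + 3) 0) (U (p + 3) 2) (U (p + 4) 0) (U (p + 4) 1)
    (U (p + 3) 1)
  have c2 := three_cells (U 0 (p + 5)) (U 2 (p + 3)) (U 0 (p + 3)) (U 1 (p + 4)) (U 0 (p + 4))
    (U 1 (p + 3))
  have hx := hexagon _ hN (U 0 0) (U (p + 5) 0) (U 0 (p + 5)) (U 2 0) (U 0 2) (U (p + 3) 0)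
    (U (p + 3) 2) (U 2 (p + 3)) (U 0 (p + 3))
  have s0 : 3 / 2 * ((U 2 0 - U (p + 3) 0) ^ 2 / ((p + 1 : ℕ) : ℝ))
      ≤ ∑ t ∈ Finset.range (p + 1), eU U (t + 2, 0) := by
    have := tele_cs (p + 1) (by omega) (fun t => U (t + 2) 0)
    have h2 : ∑ t ∈ Finset.range (p + 1), 3 / 2 * (U (t + 1 + 2) 0 - U (t + 2) 0) ^ 2
        ≤ ∑ t ∈ Finset.range (p + 1), eU U (t + 2, 0) := by
      apply Finset.sum_le_sum
      intro t _
      unfold eU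
      refine le_trans (le_of_eq ?_) (e3_ge _ _ _)
      ring_nf
    rw [← Finset.mul_sum] at h2
    rw [sub_sq_comm]
    simp only [Nat.zero_add] at this
    rw [show p + 1 + 2 = p + 3 from rfl] at this
    linarith
  have s1 : 3 / 2 * ((U (p + 3) 2 - U 2 (p + 3)) ^ 2 / ((p + 1 : ℕ) : ℝ))
      ≤ ∑ t ∈ Finset.range (p + 1), eU U (p + 2 - t, t + 2) := by
    have := tele_cs (p + 1) (by omega) (fun t => U (p + 3 - t) (t + 2))
    have h2 : ∑ t ∈ Finset.range (p + 1), 3 / 2 * (U (p + 3 - (t + 1)) (t + 1 + 2)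
          - U (p + 3 - t) (t + 2)) ^ 2
        ≤ ∑ t ∈ Finset.range (p + 1), eU U (p + 2 - t, t + 2) := by
      apply Finset.sum_le_sum
      intro t ht
      rw [Finset.mem_range] at ht
      unfold eU
      rw [e3_perm1]
      refine le_trans (le_of_eq ?_) (e3_ge _ _ _)
      simp only
      rw [show p + 3 - (t + 1) = p + 2 - t by omega, show p + 2 - t + 1 = p + 3 - t by omega,
        show t + 1 + 2 = t + 2 + 1 by omega]
      ring
    rw [← Finset.mul_sum] at h2
    rw [sub_sq_comm]
    simp only [Nat.zero_add, Nat.sub_zero] at this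
    rw [show p + 1 + 2 = p + 3 from rfl, show p + 3 - (p + 1) = 2 by omega] at this
    linarith
  have s2 : 3 / 2 * ((U 0 (p + 3) - U 0 2) ^ 2 / ((p + 1 : ℕ) : ℝ))
      ≤ ∑ t ∈ Finset.range (p + 1), eU U (0, p + 2 - t) := by
    have := tele_cs (p + 1) (by omega) (fun t => U 0 (p + 3 - t))
    have h2 : ∑ t ∈ Finset.range (p + 1), 3 / 2 * (U 0 (p + 3 - (t + 1)) - U 0 (p + 3 - t)) ^ 2
        ≤ ∑ t ∈ Finset.range (p + 1), eU U (0, p + 2 - t) := by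
      apply Finset.sum_le_sum
      intro t ht
      rw [Finset.mem_range] at ht
      unfold eU
      rw [e3_perm1, e3_perm1]
      refine le_trans (le_of_eq ?_) (e3_ge _ _ _)
      simp only
      rw [show p + 3 - (t + 1) = p + 2 - t by omega, show p + 2 - t + 1 = p + 3 - t by omega]
      ring
    rw [← Finset.mul_sum] at h2
    rw [sub_sq_comm]
    simp only [Nat.sub_zero] at this
    rw [show p + 3 - (p + 1) = 2 by omega] at this
    linarith
  have d0 : eU U (0, 0) + eU U (1, 0) + eU U (0, 1)
      = e3 (U 0 0) (U 1 0) (U 0 1) + e3 (U 1 0) (U 2 0) (U 1 1) + e3 (U 0 1) (U 1 1) (U 0 2) := rfl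
  have d1 : eU U (p + 4, 0) + eU U (p + 3, 0) + eU U (p + 3, 1)
      = e3 (U (p + 5) 0) (U (p + 4) 0) (U (p + 4) 1) + e3 (U (p + 4) 0) (U (p + 3) 0) (U (p + 3) 1)
        + e3 (U (p + 4) 1) (U (p + 3) 1) (U (p + 3) 2) := by
    simp only [eU, e3]; ring
  have d2 : eU U (0, p + 4) + eU U (1, p + 3) + eU U (0, p + 3)
      = e3 (U 0 (p + 5)) (U 1 (p + 4)) (U 0 (p + 4)) + e3 (U 1 (p + 4)) (U 2 (p + 3)) (U 1 (p + 3))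
        + e3 (U 0 (p + 4)) (U 1 (p + 3)) (U 0 (p + 3)) := by
    simp only [eU, e3]; ring
  linarith

/-! ### Harmonic extension -/

/-- Values along a side. -/
def hS (l : ℕ) (x y z : ℝ) (s : ℕ) : ℝ :=
  if s = 0 then x else if s = l then y else
  if s = 1 then ((6 * l - 8) * x + 5 * y + 4 * z) / (6 * l + 1) else
  if s + 1 = l then ((6 * l - 8) * y + 5 * x + 4 * z) / (6 * l + 1) else
  ((6 * (l - s) - 2) * x + (6 * s - 2) * y + 5 * z) / (6 * l + 1)

/-- Values at the middle vertices near the corners. -/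
def hM (l : ℕ) (x y z : ℝ) : ℝ := ((6 * l - 11) * x + 6 * y + 6 * z) / (6 * l + 1)

/-- Values at the free vertices. -/
def hA (l : ℕ) (x y z : ℝ) (s : ℕ) : ℝ :=
  ((6 * (l - s) - 5) * x + (6 * s + 1) * y + 5 * z) / (6 * l + 1)

/-- The harmonic extension. -/
def hU (l : ℕ) (v : Fin 3 → ℝ) (i j : ℕ) : ℝ :=
  if j = 0 then hS l (v 0) (v 1) (v 2) i else
  if i = 0 then hS l (v 0) (v 2) (v 1) j else
  if i + j = l then hS l (v 1) (v 2) (v 0) j else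
  if i = 1 ∧ j = 1 then hM l (v 0) (v 1) (v 2) else
  if i + 2 = l ∧ j = 1 then hM l (v 1) (v 0) (v 2) else
  if i = 1 ∧ j + 2 = l then hM l (v 2) (v 0) (v 1) else
  if j = 1 then hA l (v 0) (v 1) (v 2) i else
  if i = 1 then hA l (v 0) (v 2) (v 1) j else hA l (v 1) (v 2) (v 0) j

lemma hU_zero {l : ℕ} (hl : 5 ≤ l) (v : Fin 3 → ℝ) : hU l v 0 0 = v 0 ∧ hU l v l 0 = v 1 ∧
    hU l v 0 l = v 2 := by
  have : l ≠ 0 := by omega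
  simp [hU, hS, this]

set_option maxHeartbeats 1000000 in
lemma hU_energy {l : ℕ} (hl : 5 ≤ l) (v : Fin 3 → ℝ) :
    ∑ i ∈ SF l, eU (hU l v) i = rl l * e3 (v 0) (v 1) (v 2) := by
  obtain ⟨p, rfl⟩ : ∃ p, l = p + 5 := ⟨l - 5, by omega⟩
  rw [sum_SF', rl_eq]
  have hD : (6 * (p + 5) + 1 : ℝ) ≠ 0 := by positivity
  have s0 : ∀ t ∈ Finset.range (p + 1), eU (hU (p + 5) v) (t + 2, 0)
      = 3 / 2 * (6 * (v 0 - v 1) / (6 * (p + 5) + 1)) ^ 2 := by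
    intro t ht
    rw [Finset.mem_range] at ht
    have a1 : hU (p + 5) v (t + 2) 0 = ((6 * (p + 5 - (t + 2)) - 2) * v 0 + (6 * (t + 2) - 2) * v 1
        + 5 * v 2) / (6 * (p + 5) + 1) := by
      rw [hU, if_pos rfl, hS, if_neg (by omega), if_neg (by omega), if_neg (by omega),
        if_neg (by omega)]
      push_cast; ring
    have a2 : hU (p + 5) v (t + 3) 0 = ((6 * (p + 5 - (t + 3)) - 2) * v 0 + (6 * (t + 3) - 2) * v 1
        + 5 * v 2) / (6 * (p + 5) + 1) := by
      rw [hU, if_pos rfl, hS, if_neg (by omega), if_neg (by omega), if_neg (by omega),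
        if_neg (by omega)]
      push_cast; ring
    have a3 : hU (p + 5) v (t + 2) 1 = ((6 * (p + 5 - (t + 2)) - 5) * v 0 + (6 * (t + 2) + 1) * v 1
        + 5 * v 2) / (6 * (p + 5) + 1) := by
      rw [hU, if_neg (by omega), if_neg (by omega), if_neg (by omega), if_neg (by omega),
        if_neg (by omega), if_neg (by omega), if_pos rfl, hA]
      push_cast; ring
    simp only [eU, Nat.zero_add, show t + 2 + 1 = t + 3 from rfl]
    rw [a1, a2, a3, e3]
    field_simp
    ring
  have s1 : ∀ t ∈ Finset.range (p + 1), eU (hU (p + 5) v) (p + 2 - t, t + 2)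
      = 3 / 2 * (6 * (v 1 - v 2) / (6 * (p + 5) + 1)) ^ 2 := by
    intro t ht
    rw [Finset.mem_range] at ht
    have a1 : hU (p + 5) v (p + 2 - t + 1) (t + 2) = ((6 * (p + 5 - (t + 2)) - 2) * v 1
        + (6 * (t + 2) - 2) * v 2 + 5 * v 0) / (6 * (p + 5) + 1) := by
      rw [hU, if_neg (by omega), if_neg (by omega), if_pos (by omega), hS, if_neg (by omega),
        if_neg (by omega), if_neg (by omega), if_neg (by omega)]
      push_cast; ring
    have a2 : hU (p + 5) v (p + 2 - t) (t + 3) = ((6 * (p + 5 - (t + 3)) - 2) * v 1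
        + (6 * (t + 3) - 2) * v 2 + 5 * v 0) / (6 * (p + 5) + 1) := by
      rw [hU, if_neg (by omega), if_neg (by omega), if_pos (by omega), hS, if_neg (by omega),
        if_neg (by omega), if_neg (by omega), if_neg (by omega)]
      push_cast; ring
    have a3 : hU (p + 5) v (p + 2 - t) (t + 2) = ((6 * (p + 5 - (t + 2)) - 5) * v 1
        + (6 * (t + 2) + 1) * v 2 + 5 * v 0) / (6 * (p + 5) + 1) := by
      rw [hU, if_neg (by omega), if_neg (by omega), if_neg (by omega), if_neg (by omega),
        if_neg (by omega), if_neg (by omega), if_neg (by omega), if_neg (by omega), hA]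
      push_cast; ring
    simp only [eU, show t + 2 + 1 = t + 3 from rfl]
    rw [a1, a2, a3, e3]
    field_simp
    ring
  have s2 : ∀ t ∈ Finset.range (p + 1), eU (hU (p + 5) v) (0, p + 2 - t)
      = 3 / 2 * (6 * (v 0 - v 2) / (6 * (p + 5) + 1)) ^ 2 := by
    intro t ht
    rw [Finset.mem_range] at ht
    obtain ⟨j, hj⟩ : ∃ j, p + 2 - t = j + 2 := ⟨p - t, by omega⟩
    have a1 : hU (p + 5) v 0 (j + 2) = ((6 * (p + 5 - (j + 2)) - 2) * v 0 + (6 * (j + 2) - 2) * v 2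
        + 5 * v 1) / (6 * (p + 5) + 1) := by
      rw [hU, if_neg (by omega), if_pos rfl, hS, if_neg (by omega), if_neg (by omega),
        if_neg (by omega), if_neg (by omega)]
      push_cast; ring
    have a2 : hU (p + 5) v 0 (j + 3) = ((6 * (p + 5 - (j + 3)) - 2) * v 0 + (6 * (j + 3) - 2) * v 2
        + 5 * v 1) / (6 * (p + 5) + 1) := by
      rw [hU, if_neg (by omega), if_pos rfl, hS, if_neg (by omega), if_neg (by omega),
        if_neg (by omega), if_neg (by omega)]
      push_cast; ring
    have a3 : hU (p + 5) v 1 (j + 2) = ((6 * (p + 5 - (j + 2)) - 5) * v 0 + (6 * (j + 2) + 1) * v 2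
        + 5 * v 1) / (6 * (p + 5) + 1) := by
      rw [hU, if_neg (by omega), if_neg (by omega), if_neg (by omega), if_neg (by omega),
        if_neg (by omega), if_neg (by omega), if_neg (by omega), if_pos rfl, hA]
      push_cast; ring
    rw [hj]
    simp only [eU, Nat.zero_add, show j + 2 + 1 = j + 3 from rfl]
    rw [a1, a2, a3, e3]
    field_simp
    ring
  rw [Finset.sum_congr rfl s0, Finset.sum_congr rfl s1, Finset.sum_congr rfl s2]
  simp only [Finset.sum_const, Finset.card_range, nsmul_eq_mul]
  clear s0 s1 s2
  obtain ⟨a, ha⟩ : ∃ a, v 1 = v 0 + (6 * (p + 5) + 1) * a :=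
    ⟨(v 1 - v 0) / (6 * (p + 5) + 1), by field_simp; ring⟩
  obtain ⟨b, hb⟩ : ∃ b, v 2 = v 0 + (6 * (p + 5) + 1) * b :=
    ⟨(v 2 - v 0) / (6 * (p + 5) + 1), by field_simp; ring⟩
  have b0 : hU (p + 5) v 1 0 = v 0 + 5 * a + 4 * b := by
    rw [hU]
    rw [if_pos (by omega), hS, if_neg (by omega), if_neg (by omega), if_pos (by omega)]
    push_cast
    rw [ha, hb]
    rw [div_eq_iff hD]
    ring
  have b1 : hU (p + 5) v 2 0 = v 0 + 10 * a + 5 * b := by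
    rw [hU]
    rw [if_pos (by omega), hS, if_neg (by omega), if_neg (by omega), if_neg (by omega), if_neg (by omega)]
    push_cast
    rw [ha, hb]
    rw [div_eq_iff hD]
    ring
  have b2 : hU (p + 5) v 0 1 = v 0 + 4 * a + 5 * b := by
    rw [hU]
    rw [if_neg (by omega), if_pos (by omega), hS, if_neg (by omega), if_neg (by omega), if_pos (by omega)]
    push_cast
    rw [ha, hb]
    rw [div_eq_iff hD]
    ring
  have b3 : hU (p + 5) v 0 2 = v 0 + 5 * a + 10 * b := by
    rw [hU]
    rw [if_neg (by omega), if_pos (by omega), hS, if_neg (by omega), if_neg (by omega), if_neg (by omega), if_neg (by omega)]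
    push_cast
    rw [ha, hb]
    rw [div_eq_iff hD]
    ring
  have b4 : hU (p + 5) v 1 1 = v 0 + 6 * a + 6 * b := by
    rw [hU]
    rw [if_neg (by omega), if_neg (by omega), if_neg (by omega), if_pos (by omega), hM]
    push_cast
    rw [ha, hb]
    rw [div_eq_iff hD]
    ring
  have b5 : hU (p + 5) v (p + 4) 0 = v 0 + (6 * (p + 5) - 8) * a + 4 * b := by
    rw [hU]
    rw [if_pos (by omega), hS, if_neg (by omega), if_neg (by omega), if_neg (by omega), if_pos (by omega)]
    push_cast
    rw [ha, hb]
    rw [div_eq_iff hD]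
    ring
  have b6 : hU (p + 5) v (p + 3) 0 = v 0 + (6 * (p + 3) - 2) * a + 5 * b := by
    rw [hU]
    rw [if_pos (by omega), hS, if_neg (by omega), if_neg (by omega), if_neg (by omega), if_neg (by omega)]
    push_cast
    rw [ha, hb]
    rw [div_eq_iff hD]
    ring
  have b7 : hU (p + 5) v (p + 4) 1 = v 0 + (6 * (p + 5) - 8) * a + 5 * b := by
    rw [hU]
    rw [if_neg (by omega), if_neg (by omega), if_pos (by omega), hS, if_neg (by omega), if_neg (by omega), if_pos (by omega)]
    push_cast
    rw [ha, hb]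
    rw [div_eq_iff hD]
    ring
  have b8 : hU (p + 5) v (p + 3) 2 = v 0 + (6 * (p + 3) - 2) * a + 10 * b := by
    rw [hU]
    rw [if_neg (by omega), if_neg (by omega), if_pos (by omega), hS, if_neg (by omega), if_neg (by omega), if_neg (by omega), if_neg (by omega)]
    push_cast
    rw [ha, hb]
    rw [div_eq_iff hD]
    ring
  have b9 : hU (p + 5) v (p + 3) 1 = v 0 + (6 * (p + 5) - 11) * a + 6 * b := by
    rw [hU]
    rw [if_neg (by omega), if_neg (by omega), if_neg (by omega), if_neg (by omega), if_pos (by omega), hM]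
    push_cast
    rw [ha, hb]
    rw [div_eq_iff hD]
    ring
  have b10 : hU (p + 5) v 0 (p + 4) = v 0 + 4 * a + (6 * (p + 5) - 8) * b := by
    rw [hU]
    rw [if_neg (by omega), if_pos (by omega), hS, if_neg (by omega), if_neg (by omega), if_neg (by omega), if_pos (by omega)]
    push_cast
    rw [ha, hb]
    rw [div_eq_iff hD]
    ring
  have b11 : hU (p + 5) v 0 (p + 3) = v 0 + 5 * a + (6 * (p + 3) - 2) * b := by
    rw [hU]
    rw [if_neg (by omega), if_pos (by omega), hS, if_neg (by omega), if_neg (by omega), if_neg (by omega), if_neg (by omega)]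
    push_cast
    rw [ha, hb]
    rw [div_eq_iff hD]
    ring
  have b12 : hU (p + 5) v 1 (p + 4) = v 0 + 5 * a + (6 * (p + 5) - 8) * b := by
    rw [hU]
    rw [if_neg (by omega), if_neg (by omega), if_pos (by omega), hS, if_neg (by omega), if_neg (by omega), if_neg (by omega), if_pos (by omega)]
    push_cast
    rw [ha, hb]
    rw [div_eq_iff hD]
    ring
  have b13 : hU (p + 5) v 2 (p + 3) = v 0 + 10 * a + (6 * (p + 3) - 2) * b := by
    rw [hU]
    rw [if_neg (by omega), if_neg (by omega), if_pos (by omega), hS, if_neg (by omega), if_neg (by omega), if_neg (by omega), if_neg (by omega)]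
    push_cast
    rw [ha, hb]
    rw [div_eq_iff hD]
    ring
  have b14 : hU (p + 5) v 1 (p + 3) = v 0 + 6 * a + (6 * (p + 5) - 11) * b := by
    rw [hU]
    rw [if_neg (by omega), if_neg (by omega), if_neg (by omega), if_neg (by omega), if_neg (by omega), if_pos (by omega), hM]
    push_cast
    rw [ha, hb]
    rw [div_eq_iff hD]
    ring
  obtain ⟨z0, z1, z2⟩ := hU_zero (l := p + 5) (by omega) v
  simp only [eU, Nat.zero_add, show p + 4 + 1 = p + 5 from rfl, show p + 3 + 1 = p + 4 from rfl,
    show 1 + 1 = 2 from rfl, z0, z1, z2, b0, b1, b2, b3, b4, b5, b6, b7, b8, b9, b10, b11, b12, b13, b14]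
  rw [ha, hb]
  have g0 : 6 * (v 0 - (v 0 + (6 * (p + 5) + 1) * a)) / (6 * (p + 5) + 1) = - (6 * a) := by
    rw [div_eq_iff hD]; ring
  have g1 : 6 * ((v 0 + (6 * (p + 5) + 1) * a) - (v 0 + (6 * (p + 5) + 1) * b))
      / (6 * (p + 5) + 1) = 6 * (a - b) := by
    rw [div_eq_iff hD]; ring
  have g2 : 6 * (v 0 - (v 0 + (6 * (p + 5) + 1) * b)) / (6 * (p + 5) + 1) = - (6 * b) := by
    rw [div_eq_iff hD]; ring
  have g3 : 9 / (6 * ((p + 1 : ℕ) : ℝ) + 25) * e3 (v 0) (v 0 + (6 * (p + 5) + 1) * a)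
      (v 0 + (6 * (p + 5) + 1) * b) = 9 * (6 * (p + 5) + 1) * e3 0 a b := by
    have : 6 * ((p + 1 : ℕ) : ℝ) + 25 = 6 * (p + 5) + 1 := by push_cast; ring
    rw [this, div_mul_eq_mul_div, div_eq_iff hD]
    simp only [e3]; ring
  rw [g0, g1, g2, g3]
  simp only [e3]
  push_cast
  ring

/-! ### Chains -/

/-- Chains of length `k` for a relation. -/
def Ch {α : Type*} (r : α → α → Prop) (k : ℕ) (x y : α) : Prop :=
  ∃ c : ℕ → α, c 0 = x ∧ c k = y ∧ ∀ j < k, r (c j) (c (j + 1))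

lemma Ch_zero {α : Type*} (r : α → α → Prop) (x : α) : Ch r 0 x x :=
  ⟨fun _ => x, rfl, rfl, fun j hj => by omega⟩

lemma Ch_one {α : Type*} {r : α → α → Prop} {x y : α} (h : r x y) : Ch r 1 x y :=
  ⟨fun j => if j = 0 then x else y, by simp, by simp, fun j hj => by
    obtain rfl : j = 0 := by omega
    simpa using h⟩

lemma Ch_trans {α : Type*} {r : α → α → Prop} {k m : ℕ} {x y z : α} (h1 : Ch r k x y)
    (h2 : Ch r m y z) : Ch r (k + m) x z := by
  obtain ⟨c, a1, a2, a3⟩ := h1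
  obtain ⟨d, b1, b2, b3⟩ := h2
  refine ⟨fun j => if j ≤ k then c j else d (j - k), by simp [a1], ?_, ?_⟩
  · by_cases h : m = 0
    · subst h; simp only [add_zero, le_refl, if_true]; rw [a2, ← b1, b2]
    · simp only; rw [if_neg (by omega), Nat.add_sub_cancel_left, b2]
  · intro j hj
    simp only
    rcases lt_trichotomy j k with h | h | h
    · rw [if_pos h.le, if_pos (by omega)]; exact a3 j h
    · subst h
      rw [if_pos le_rfl, if_neg (by omega), a2, ← b1, Nat.add_sub_cancel_left]
      exact b3 0 (by omega)
    · rw [if_neg (by omega), if_neg (by omega), show j + 1 - k = j - k + 1 by omega]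
      exact b3 _ (by omega)

lemma Ch_symm {α : Type*} {r : α → α → Prop} (hr : ∀ x y, r x y → r y x) {k : ℕ} {x y : α}
    (h : Ch r k x y) : Ch r k y x := by
  obtain ⟨c, a1, a2, a3⟩ := h
  refine ⟨fun j => c (k - j), by simp [a2], by simp [a1], fun j hj => ?_⟩
  have := a3 (k - (j + 1)) (by omega)
  rw [show k - (j + 1) + 1 = k - j by omega] at this
  exact hr _ _ this

lemma Ch_map {α β : Type*} {r : α → α → Prop} {s : β → β → Prop} (f : α → β)
    (hf : ∀ x y, r x y → s (f x) (f y)) {k : ℕ} {x y : α} (h : Ch r k x y) :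
    Ch s k (f x) (f y) := by
  obtain ⟨c, a1, a2, a3⟩ := h
  exact ⟨fun j => f (c j), by simp [a1], by simp [a2], fun j hj => hf _ _ (a3 j hj)⟩

lemma Ch_split {α : Type*} {r : α → α → Prop} {k : ℕ} {x y : α} (h : Ch r k x y) {a b : ℕ}
    (hab : a ≤ b) (hb : b ≤ k) (c : ℕ → α) (h0 : c 0 = x) (hk : c k = y)
    (hc : ∀ j < k, r (c j) (c (j + 1))) (e : c a = c b) : Ch r (k - (b - a)) x y := by
  have h1 : Ch r a x (c a) := ⟨c, h0, rfl, fun j hj => hc j (by omega)⟩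
  have h2 : Ch r (k - b) (c a) y := by
    refine ⟨fun j => c (b + j), by simp [e], ?_, fun j hj => hc (b + j) (by omega)⟩
    simp only; rw [Nat.add_sub_cancel' hb, hk]
  have := Ch_trans h1 h2
  rwa [show a + (k - b) = k - (b - a) by omega] at this

/-- Chains can be made injective. -/
lemma Ch_inj {α : Type*} {r : α → α → Prop} {k : ℕ} {x y : α} (h : Ch r k x y) :
    ∃ k' ≤ k, ∃ c : ℕ → α, c 0 = x ∧ c k' = y ∧ (∀ j < k', r (c j) (c (j + 1))) ∧
      ∀ a ≤ k', ∀ b ≤ k', c a = c b → a = b := by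
  classical
  have hex : ∃ m, Ch r m x y := ⟨k, h⟩
  have hm := Nat.find_spec hex
  obtain ⟨c, h0, hk, hc⟩ := id hm
  refine ⟨Nat.find hex, Nat.find_min' hex h, c, h0, hk, hc, ?_⟩
  have key : ∀ a b, a < b → b ≤ Nat.find hex → c a ≠ c b := by
    intro a b hab hb e
    have := Ch_split hm hab.le hb c h0 hk hc e
    exact Nat.find_min hex (by omega) this
  intro a ha b hb e
  rcases lt_trichotomy a b with h | h | h
  · exact absurd e (key a b h hb)
  · exact h
  · exact absurd e.symm (key b a h ha)

/-! ### The ring of cells -/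

/-- Adjacency of first level cells. -/
def adj1 (l : ℕ) (i i' : ℕ × ℕ) : Prop :=
  i ∈ Sset l ∧ i' ∈ Sset l ∧ ∃ j j' : Fin 3, i + ev j = i' + ev j'

lemma adj1_symm {l : ℕ} (i i' : ℕ × ℕ) (h : adj1 l i i') : adj1 l i' i := by
  obtain ⟨a, b, j, j', e⟩ := h
  exact ⟨b, a, j', j, e.symm⟩

/-- Non-corner cells; here `l = n + 2`. -/
def rc (n τ : ℕ) : ℕ × ℕ :=
  if τ < n then (τ + 1, 0) else if τ < 2 * n then (2 * n - τ, τ - n + 1) else (0, 3 * n - τ)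

/-- Corner cells. -/
def cc (n : ℕ) (a : Fin 3) : ℕ × ℕ := ![(0, 0), (n + 1, 0), (0, n + 1)] a

/-- node of corner. -/
def cn (n : ℕ) (a : Fin 3) : ℕ := ![0, n, 2 * n] a

lemma cc_cases (n : ℕ) (a : Fin 3) : (a = 0 ∧ cc n a = (0, 0) ∧ cn n a = 0) ∨
    (a = 1 ∧ cc n a = (n + 1, 0) ∧ cn n a = n) ∨ (a = 2 ∧ cc n a = (0, n + 1) ∧ cn n a = 2 * n) := by
  fin_cases a <;> simp [cc, cn]

/-- Node of a lattice vertex. -/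
def nd (n i j : ℕ) : ℕ :=
  if j = 0 then min (i - 1) n else
  if i = 0 then 2 * n + min (n + 1 - j) n else
  if i + j = n + 2 then n + min (j - 1) n else
  if i = 1 ∧ j = 1 then 0 else
  if i + j = n + 1 then (if i = 1 then 2 * n else n + (j - 1)) else
  if j = 1 then i - 1 else 2 * n + (n - j)

lemma rc_mem {n τ : ℕ} (hn : 3 ≤ n) (h : τ < 3 * n) : rc n τ ∈ Sset (n + 2) := by
  unfold rc
  split_ifs
  · refine ⟨?_, ?_⟩ <;> simp; omega
  · refine ⟨?_, ?_⟩
    · show 2 * n - τ + (τ - n + 1) ≤ n + 2 - 1; omega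
    · show (2 * n - τ) * (τ - n + 1) * (n + 2 - 1 - (2 * n - τ) - (τ - n + 1)) = 0
      rw [show n + 2 - 1 - (2 * n - τ) - (τ - n + 1) = 0 by omega, mul_zero]
  · refine ⟨?_, ?_⟩ <;> simp; omega

lemma cc_mem (n : ℕ) (a : Fin 3) : cc n a ∈ Sset (n + 2) := by
  rcases cc_cases n a with ⟨-, h, -⟩ | ⟨-, h, -⟩ | ⟨-, h, -⟩ <;> rw [h] <;> simp [Sset]

lemma cell_cases {n : ℕ} (hn : 3 ≤ n) {i : ℕ × ℕ} (hi : i ∈ Sset (n + 2)) :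
    (∃ τ < 3 * n, i = rc n τ) ∨ ∃ a, i = cc n a := by
  obtain ⟨x, y⟩ := i
  obtain ⟨h1, h2⟩ := hi
  simp only [mul_eq_zero] at h1 h2
  by_cases c0 : x = 0 ∧ y = 0
  · right; exact ⟨0, by simp [cc, c0.1, c0.2]⟩
  by_cases c1 : x = n + 1 ∧ y = 0
  · right; exact ⟨1, by simp [cc, c1.1, c1.2]⟩
  by_cases c2 : x = 0 ∧ y = n + 1
  · right; exact ⟨2, by simp [cc, c2.1, c2.2]⟩
  left
  by_cases d0 : y = 0
  · refine ⟨x - 1, by omega, ?_⟩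
    unfold rc; rw [if_pos (by omega)]; simp [d0]; omega
  by_cases d1 : x = 0
  · refine ⟨3 * n - y, by omega, ?_⟩
    unfold rc; rw [if_neg (by omega), if_neg (by omega)]; simp [d1]; omega
  · refine ⟨n + y - 1, by omega, ?_⟩
    unfold rc; rw [if_neg (by omega), if_pos (by omega)]; simp; omega

/-- Nodes of a non-corner cell. -/
lemma nd_rc {n τ : ℕ} (hn : 3 ≤ n) (h : τ < 3 * n) (g : ℕ → ℝ) (hg : g (3 * n) = g 0) :
    (fun i j => g (nd n i j)) (rc n τ).1 (rc n τ).2 ∈ ({g τ, g (τ + 1)} : Set ℝ) ∧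
    (fun i j => g (nd n i j)) ((rc n τ).1 + 1) (rc n τ).2 ∈ ({g τ, g (τ + 1)} : Set ℝ) ∧
    (fun i j => g (nd n i j)) (rc n τ).1 ((rc n τ).2 + 1) ∈ ({g τ, g (τ + 1)} : Set ℝ) := by
  have key : ∀ x, (x = τ ∨ x = τ + 1 ∨ (x = 0 ∧ τ + 1 = 3 * n)) →
      g x ∈ ({g τ, g (τ + 1)} : Set ℝ) := by
    rintro x (rfl | rfl | ⟨rfl, h⟩)
    · left; rfl
    · right; rfl
    · right; rw [h, hg]; rfl
  rcases Nat.lt_or_ge τ n with h1 | h1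
  · rw [rc, if_pos h1]
    refine ⟨key _ ?_, key _ ?_, key _ ?_⟩ <;> unfold nd <;> simp only <;> split_ifs <;>
      first | omega | contradiction | (simp <;> omega)
  rcases Nat.lt_or_ge τ (2 * n) with h2 | h2
  · rw [rc, if_neg (by omega), if_pos h2]
    refine ⟨key _ ?_, key _ ?_, key _ ?_⟩ <;> unfold nd <;> simp only <;> split_ifs <;>
      first | omega | contradiction | (simp <;> omega)
  · rw [rc, if_neg (by omega), if_neg (by omega)]
    refine ⟨key _ ?_, key _ ?_, key _ ?_⟩ <;> unfold nd <;> simp only <;> split_ifs <;>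
      first | omega | contradiction | (simp <;> omega)

lemma nd_cc {n : ℕ} (hn : 3 ≤ n) (a : Fin 3) (g : ℕ → ℝ) (hg : g (3 * n) = g 0) (b : Fin 3) :
    (fun i j => g (nd n i j)) ((cc n a).1 + (ev b).1) ((cc n a).2 + (ev b).2) = g (cn n a) := by
  have key : ∀ x, (x = cn n a ∨ (x = 3 * n ∧ cn n a = 0)) → g x = g (cn n a) := by
    rintro x (rfl | ⟨rfl, h⟩)
    · rfl
    · rw [h, hg]
  apply key
  rcases cc_cases n a with ⟨-, h, h'⟩ | ⟨-, h, h'⟩ | ⟨-, h, h'⟩ <;>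
  rcases ev_cases b with ⟨-, e⟩ | ⟨-, e⟩ | ⟨-, e⟩ <;>
  rw [h, h', e] <;> unfold nd <;> simp only <;> split_ifs <;>
  first | omega | contradiction | (simp <;> omega)

lemma eU_pair (x y a b c : ℝ) (ha : a ∈ ({x, y} : Set ℝ)) (hb : b ∈ ({x, y} : Set ℝ))
    (hc : c ∈ ({x, y} : Set ℝ)) : e3 a b c ≤ 2 * (y - x) ^ 2 := by
  simp only [Set.mem_insert_iff, Set.mem_singleton_iff] at ha hb hc
  rcases ha with ha | ha <;> rcases hb with hb | hb <;> rcases hc with hc | hc <;>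
    rw [ha, hb, hc] <;> unfold e3 <;> nlinarith [sq_nonneg (y - x)]

/-- Energy of a function of the node. -/
lemma ring_energy {n : ℕ} (hn : 3 ≤ n) (g : ℕ → ℝ) (hg : g (3 * n) = g 0) :
    ∑ i ∈ SF (n + 2), eU (fun i j => g (nd n i j)) i
      ≤ 2 * ∑ τ ∈ Finset.range (3 * n), (g (τ + 1) - g τ) ^ 2 := by
  rw [sum_SF (n + 1) (by omega), Finset.sum_range_succ']
  have hc : ∀ a : Fin 3, eU (fun i j => g (nd n i j)) (cc n a) = 0 := by
    intro a
    have h0 := nd_cc hn a g hg 0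
    have h1 := nd_cc hn a g hg 1
    have h2 := nd_cc hn a g hg 2
    rw [show ev 0 = (0, 0) from rfl] at h0
    rw [show ev 1 = (1, 0) from rfl] at h1
    rw [show ev 2 = (0, 1) from rfl] at h2
    simp only [add_zero] at h0 h1 h2
    simp only [eU, h0, h1, h2, e3]; ring
  have c0 := hc 0
  have c1 := hc 1
  have c2 := hc 2
  simp only [cc, Matrix.cons_val_zero, Matrix.cons_val_one, Matrix.cons_val] at c0 c1 c2
  simp only [Nat.sub_zero]
  rw [c0, c1, c2]
  have hr : ∀ τ < 3 * n, eU (fun i j => g (nd n i j)) (rc n τ) ≤ 2 * (g (τ + 1) - g τ) ^ 2 := by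
    intro τ hτ
    obtain ⟨a, b, c⟩ := nd_rc hn hτ g hg
    exact eU_pair _ _ _ _ _ a b c
  rw [Finset.mul_sum, show 3 * n = n + n + n by ring, Finset.sum_range_add, Finset.sum_range_add,
    ← Finset.sum_add_distrib, ← Finset.sum_add_distrib]
  simp only [add_zero]
  apply Finset.sum_le_sum
  intro r hr'
  rw [Finset.mem_range] at hr'
  have a0 := hr r (by omega)
  have a1 := hr (n + r) (by omega)
  have a2 := hr (n + n + r) (by omega)
  rw [rc, if_pos hr'] at a0
  rw [rc, if_neg (by omega), if_pos (by omega)] at a1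
  rw [rc, if_neg (by omega), if_neg (by omega)] at a2
  rw [show 2 * n - (n + r) = n + 1 - (r + 1) by omega, show n + r - n + 1 = r + 1 by omega] at a1
  rw [show 3 * n - (n + n + r) = n + 1 - (r + 1) by omega] at a2
  linarith

lemma adj1_of {l : ℕ} {i i' : ℕ × ℕ} (hi : i ∈ Sset l) (hi' : i' ∈ Sset l)
    (h : ∃ a b, (a = (0, 0) ∨ a = (1, 0) ∨ a = (0, 1)) ∧ (b = (0, 0) ∨ b = (1, 0) ∨ b = (0, 1)) ∧
      i.1 + a.1 = i'.1 + b.1 ∧ i.2 + a.2 = i'.2 + b.2) : adj1 l i i' := by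
  obtain ⟨a, b, ha, hb, h1, h2⟩ := h
  have key : ∀ a : ℕ × ℕ, (a = (0, 0) ∨ a = (1, 0) ∨ a = (0, 1)) → ∃ j, a = ev j := by
    rintro a (rfl | rfl | rfl)
    · exact ⟨0, rfl⟩
    · exact ⟨1, rfl⟩
    · exact ⟨2, rfl⟩
  obtain ⟨j, rfl⟩ := key a ha
  obtain ⟨j', rfl⟩ := key b hb
  exact ⟨hi, hi', j, j', Prod.ext h1 h2⟩

/-- Arithmetical description of adjacency. -/
lemma adj1_of' {l : ℕ} {i i' : ℕ × ℕ} (hi : i ∈ Sset l) (hi' : i' ∈ Sset l)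
    (h : (i.1 = i'.1 + 1 ∧ i.2 = i'.2) ∨ (i'.1 = i.1 + 1 ∧ i'.2 = i.2) ∨
      (i.1 = i'.1 ∧ i.2 = i'.2 + 1) ∨ (i.1 = i'.1 ∧ i'.2 = i.2 + 1) ∨
      (i.1 = i'.1 + 1 ∧ i'.2 = i.2 + 1) ∨ (i'.1 = i.1 + 1 ∧ i.2 = i'.2 + 1)) : adj1 l i i' := by
  apply adj1_of hi hi'
  rcases h with ⟨h1, h2⟩ | ⟨h1, h2⟩ | ⟨h1, h2⟩ | ⟨h1, h2⟩ | ⟨h1, h2⟩ | ⟨h1, h2⟩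
  · exact ⟨(0, 0), (1, 0), by simp, by simp, by simp; omega, by simp; omega⟩
  · exact ⟨(1, 0), (0, 0), by simp, by simp, by simp; omega, by simp; omega⟩
  · exact ⟨(0, 0), (0, 1), by simp, by simp, by simp; omega, by simp; omega⟩
  · exact ⟨(0, 1), (0, 0), by simp, by simp, by simp; omega, by simp; omega⟩
  · exact ⟨(0, 1), (1, 0), by simp, by simp, by simp; omega, by simp; omega⟩
  · exact ⟨(1, 0), (0, 1), by simp, by simp, by simp; omega, by simp; omega⟩

lemma adj_rc {n τ : ℕ} (hn : 3 ≤ n) (h : τ + 1 < 3 * n) :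
    adj1 (n + 2) (rc n τ) (rc n (τ + 1)) := by
  apply adj1_of' (rc_mem hn (by omega)) (rc_mem hn h)
  unfold rc; split_ifs <;> simp only <;> first | omega | (simp <;> omega)

lemma adj_rc_last {n : ℕ} (hn : 3 ≤ n) : adj1 (n + 2) (rc n (3 * n - 1)) (rc n 0) := by
  apply adj1_of' (rc_mem hn (by omega)) (rc_mem hn (by omega))
  unfold rc; split_ifs <;> simp only <;> first | omega | (simp <;> omega)

lemma adj_cc {n : ℕ} (hn : 3 ≤ n) (a : Fin 3) : adj1 (n + 2) (cc n a) (rc n (cn n a)) := by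
  rcases cc_cases n a with ⟨-, h, h'⟩ | ⟨-, h, h'⟩ | ⟨-, h, h'⟩ <;>
  · apply adj1_of' (cc_mem n a) (rc_mem hn (by omega))
    rw [h, h']
    unfold rc; split_ifs <;> simp only <;> first | omega | (simp <;> omega)

lemma adj_cc' {n : ℕ} (hn : 3 ≤ n) (a : Fin 3) (ha : 1 ≤ cn n a) :
    adj1 (n + 2) (rc n (cn n a - 1)) (cc n a) := by
  rcases cc_cases n a with ⟨-, h, h'⟩ | ⟨-, h, h'⟩ | ⟨-, h, h'⟩ <;>
  · apply adj1_of' (rc_mem hn (by omega)) (cc_mem n a)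
    rw [h, h']
    unfold rc; split_ifs <;> simp only <;> first | omega | (simp <;> omega)

lemma adj_cc_zero {n : ℕ} (hn : 3 ≤ n) : adj1 (n + 2) (rc n (3 * n - 1)) (cc n 0) := by
  apply adj1_of' (rc_mem hn (by omega)) (cc_mem n 0)
  unfold rc cc; split_ifs <;> simp only [Matrix.cons_val_zero] <;> first | omega | (simp <;> omega)

/-- interval of nodes of a cell -/
def Iv (n : ℕ) (i : ℕ × ℕ) (lo hi : ℕ) : Prop :=
  (∃ τ < 3 * n, i = rc n τ ∧ lo = τ ∧ hi = τ + 1) ∨ ∃ a, i = cc n a ∧ lo = cn n a ∧ hi = cn n a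

lemma Iv_exists {n : ℕ} (hn : 3 ≤ n) {i : ℕ × ℕ} (hi : i ∈ Sset (n + 2)) : ∃ lo h, Iv n i lo h := by
  rcases cell_cases hn hi with ⟨τ, h, rfl⟩ | ⟨a, rfl⟩
  · exact ⟨_, _, Or.inl ⟨τ, h, rfl, rfl, rfl⟩⟩
  · exact ⟨_, _, Or.inr ⟨a, rfl, rfl, rfl⟩⟩

lemma Iv_bd {n : ℕ} {i : ℕ × ℕ} {lo hi : ℕ} (h : Iv n i lo hi) : lo ≤ hi ∧ hi ≤ lo + 1 ∧
    hi ≤ 3 * n := by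
  rcases h with ⟨τ, h, -, rfl, rfl⟩ | ⟨a, -, rfl, rfl⟩
  · omega
  · rcases cc_cases n a with ⟨-, -, h⟩ | ⟨-, -, h⟩ | ⟨-, -, h⟩ <;> omega

lemma Iv_mem {n : ℕ} (hn : 3 ≤ n) {i : ℕ × ℕ} {lo hi : ℕ} (h : Iv n i lo hi) :
    i ∈ Sset (n + 2) := by
  rcases h with ⟨τ, h, rfl, -, -⟩ | ⟨a, rfl, -, -⟩
  · exact rc_mem hn h
  · exact cc_mem n a

lemma Iv_order {n : ℕ} (hn : 3 ≤ n) {i i' : ℕ × ℕ} {lo hi lo' hi' : ℕ} (h : Iv n i lo hi)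
    (h' : Iv n i' lo' hi') (hne : i ≠ i') : hi ≤ lo' ∨ hi' ≤ lo := by
  rcases h with ⟨τ, h, rfl, rfl, rfl⟩ | ⟨a, rfl, rfl, rfl⟩ <;>
  rcases h' with ⟨τ', h', rfl, rfl, rfl⟩ | ⟨a', rfl, rfl, rfl⟩
  · have : lo ≠ lo' := by rintro rfl; exact hne rfl
    omega
  · omega
  · omega
  · omega

/-- Exiting a cell upwards. -/
lemma Iv_up {n : ℕ} (hn : 3 ≤ n) {i : ℕ × ℕ} {lo hi : ℕ} (h : Iv n i lo hi) (h3 : hi < 3 * n) :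
    adj1 (n + 2) i (rc n hi) := by
  rcases h with ⟨τ, h, rfl, rfl, rfl⟩ | ⟨a, rfl, rfl, rfl⟩
  · exact adj_rc hn h3
  · exact adj_cc hn a

lemma Iv_up_last {n : ℕ} (hn : 3 ≤ n) {i : ℕ × ℕ} {lo hi : ℕ} (h : Iv n i lo hi) (h3 : hi = 3 * n) :
    adj1 (n + 2) i (rc n 0) := by
  rcases h with ⟨τ, h, rfl, rfl, rfl⟩ | ⟨a, rfl, rfl, rfl⟩
  · obtain rfl : lo = 3 * n - 1 := by omega
    exact adj_rc_last hn
  · rcases cc_cases n a with ⟨-, -, h⟩ | ⟨-, -, h⟩ | ⟨-, -, h⟩ <;> omega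

/-- Entering a cell from below. -/
lemma Iv_down {n : ℕ} (hn : 3 ≤ n) {i : ℕ × ℕ} {lo hi : ℕ} (h : Iv n i lo hi) (h1 : 1 ≤ lo) :
    adj1 (n + 2) (rc n (lo - 1)) i := by
  rcases h with ⟨τ, h, rfl, rfl, rfl⟩ | ⟨a, rfl, rfl, rfl⟩
  · have := @adj_rc n (lo - 1) hn (by omega)
    rwa [show lo - 1 + 1 = lo by omega] at this
  · exact adj_cc' hn a h1

lemma Iv_down_zero {n : ℕ} (hn : 3 ≤ n) {i : ℕ × ℕ} {lo hi : ℕ} (h : Iv n i lo hi) (h1 : lo = 0) :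
    adj1 (n + 2) (rc n (3 * n - 1)) i := by
  rcases h with ⟨τ, h, rfl, rfl, rfl⟩ | ⟨a, rfl, rfl, rfl⟩
  · subst h1; exact adj_rc_last hn
  · rcases cc_cases n a with ⟨rfl, -, h⟩ | ⟨-, -, h⟩ | ⟨-, -, h⟩
    · exact adj_cc_zero hn
    · omega
    · omega

lemma Ch_rc {n : ℕ} (hn : 3 ≤ n) (τ k : ℕ) (h : τ + k < 3 * n) :
    Ch (adj1 (n + 2)) k (rc n τ) (rc n (τ + k)) :=
  ⟨fun j => rc n (τ + j), rfl, rfl, fun j hj => adj_rc hn (by omega)⟩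

/-- Chain in the increasing direction. -/
lemma Ch_Iv {n : ℕ} (hn : 3 ≤ n) {i i' : ℕ × ℕ} {lo hi lo' hi' : ℕ} (h : Iv n i lo hi)
    (h' : Iv n i' lo' hi') (hne : i ≠ i') (hle : hi ≤ lo') :
    Ch (adj1 (n + 2)) (lo' - hi + 1) i i' := by
  have b' := Iv_bd h'
  rcases Nat.eq_or_lt_of_le hle with e | hlt
  · rw [show lo' - hi + 1 = 1 by omega]
    apply Ch_one
    rcases h with ⟨τ, h, rfl, rfl, rfl⟩ | ⟨a, rfl, rfl, rfl⟩
    · have := Iv_down hn h' (by omega)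
      rwa [← e, Nat.add_sub_cancel] at this
    · rcases h' with ⟨τ', h', rfl, rfl, rfl⟩ | ⟨a', rfl, rfl, rfl⟩
      · rw [← e]; exact adj_cc hn a
      · exfalso; apply hne
        rcases cc_cases n a with ⟨rfl, -, h⟩ | ⟨rfl, -, h⟩ | ⟨rfl, -, h⟩ <;>
        rcases cc_cases n a' with ⟨rfl, -, h'⟩ | ⟨rfl, -, h'⟩ | ⟨rfl, -, h'⟩ <;>
        first | rfl | omega
  · have c1 := Ch_one (Iv_up hn h (by omega))
    have c2 := Ch_rc hn hi (lo' - 1 - hi) (by omega)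
    rw [show hi + (lo' - 1 - hi) = lo' - 1 by omega] at c2
    have c3 := Ch_one (Iv_down hn h' (by omega))
    have := Ch_trans (Ch_trans c1 c2) c3
    rwa [show 1 + (lo' - 1 - hi) + 1 = lo' - hi + 1 by omega] at this

/-- Chain in the other direction. -/
lemma Ch_Iv' {n : ℕ} (hn : 3 ≤ n) {i i' : ℕ × ℕ} {lo hi lo' hi' : ℕ} (h : Iv n i lo hi)
    (h' : Iv n i' lo' hi') (hne : i ≠ i') (hle : hi ≤ lo') :
    Ch (adj1 (n + 2)) (3 * n + lo - hi' + 1) i i' := by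
  apply Ch_symm adj1_symm
  have b' := Iv_bd h'
  have b := Iv_bd h
  rcases Nat.eq_or_lt_of_le b'.2.2 with e | hlt
  · -- third case
    rcases Nat.eq_zero_or_pos lo with e0 | hpos
    · rw [show 3 * n + lo - hi' + 1 = 1 by omega]
      apply Ch_one
      rcases h' with ⟨τ', h', rfl, rfl, rfl⟩ | ⟨a', rfl, rfl, rfl⟩
      · obtain rfl : lo' = 3 * n - 1 := by omega
        exact Iv_down_zero hn h e0
      · rcases cc_cases n a' with ⟨-, -, h⟩ | ⟨-, -, h⟩ | ⟨-, -, h⟩ <;> omega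
    · have c1 := Ch_one (Iv_up_last hn h' e)
      have c2 := Ch_rc hn 0 (lo - 1) (by omega)
      rw [Nat.zero_add] at c2
      have c3 := Ch_one (Iv_down hn h hpos)
      have := Ch_trans (Ch_trans c1 c2) c3
      rwa [show 1 + (lo - 1) + 1 = 3 * n + lo - hi' + 1 by omega] at this
  · have c1 := Ch_one (Iv_up hn h' hlt)
    have c2 := Ch_rc hn hi' (3 * n - 1 - hi') (by omega)
    rw [show hi' + (3 * n - 1 - hi') = 3 * n - 1 by omega] at c2
    have c12 := Ch_trans c1 c2
    rcases Nat.eq_zero_or_pos lo with e0 | hpos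
    · have := Ch_trans c12 (Ch_one (Iv_down_zero hn h e0))
      rwa [show 1 + (3 * n - 1 - hi') + 1 = 3 * n + lo - hi' + 1 by omega] at this
    · have c3 := Ch_one (adj_rc_last hn)
      have c4 := Ch_rc hn 0 (lo - 1) (by omega)
      rw [Nat.zero_add] at c4
      have c5 := Ch_one (Iv_down hn h hpos)
      have := Ch_trans (Ch_trans (Ch_trans c12 c3) c4) c5
      rwa [show 1 + (3 * n - 1 - hi') + 1 + (lo - 1) + 1 = 3 * n + lo - hi' + 1 by omega] at this

/-- Any two cells are joined by a short chain. -/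
lemma Ch_short {l : ℕ} (hl : 5 ≤ l) {i i' : ℕ × ℕ} (hi : i ∈ Sset l) (hi' : i' ∈ Sset l) :
    ∃ t, 2 * t + 5 ≤ 3 * l ∧ Ch (adj1 l) t i i' := by
  obtain ⟨n, rfl⟩ : ∃ n, l = n + 2 := ⟨l - 2, by omega⟩
  have hn : 3 ≤ n := by omega
  by_cases hne : i = i'
  · subst hne; exact ⟨0, by omega, Ch_zero _ _⟩
  have key : ∀ {i i' : ℕ × ℕ} {lo h lo' h' : ℕ}, Iv n i lo h → Iv n i' lo' h' → i ≠ i' → h ≤ lo' →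
      ∃ t, 2 * t + 5 ≤ 3 * (n + 2) ∧ Ch (adj1 (n + 2)) t i i' := by
    intro i i' lo h lo' h' a a' hne hle
    have b := Iv_bd a
    have b' := Iv_bd a'
    by_cases hc : lo = h ∧ lo' = h'
    · -- both are corners
      rcases a with ⟨τ, a0, a1, a2, a3⟩ | ⟨c, ac⟩
      · omega
      rcases a' with ⟨τ, a0, a1, a2, a3⟩ | ⟨c', ac'⟩
      · omega
      have p1 := Ch_Iv hn (Or.inr ⟨c, ac⟩) (Or.inr ⟨c', ac'⟩) hne hle
      have p2 := Ch_Iv' hn (Or.inr ⟨c, ac⟩) (Or.inr ⟨c', ac'⟩) hne hle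
      rcases cc_cases n c with ⟨rfl, -, e⟩ | ⟨rfl, -, e⟩ | ⟨rfl, -, e⟩ <;>
      rcases cc_cases n c' with ⟨rfl, -, e'⟩ | ⟨rfl, -, e'⟩ | ⟨rfl, -, e'⟩ <;>
      first | exact ⟨_, by omega, p1⟩ | exact ⟨_, by omega, p2⟩ |
        (exfalso; exact hne (ac.1.trans ac'.1.symm)) | (exfalso; omega)
    · rcases Nat.lt_or_ge (3 * n + lo - h') (lo' - h) with hlt | hge
      · exact ⟨_, by omega, Ch_Iv' hn a a' hne hle⟩
      · exact ⟨_, by omega, Ch_Iv hn a a' hne hle⟩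
  obtain ⟨lo, h, a⟩ := Iv_exists hn hi
  obtain ⟨lo', h', a'⟩ := Iv_exists hn hi'
  rcases Iv_order hn a a' hne with hle | hle
  · exact key a a' hne hle
  · obtain ⟨t, ht, hc⟩ := key a' a (Ne.symm hne) hle
    exact ⟨t, ht, Ch_symm adj1_symm hc⟩

/-! ### Monotonicity of the energies -/

lemma fmap_q (q : Fin 3 → E2) (l : ℕ) (i : ℕ × ℕ) (j : Fin 3) :
    fmap q l i (q j) = PP q (((i + ev j).1 : ℕ) / (l : ℝ)) (((i + ev j).2 : ℕ) / (l : ℝ)) := by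
  rw [q_eq q j, fmap_PP, Prod.fst_add, Prod.snd_add]; push_cast; rfl

/-- Lattice values of a function. -/
def latU (q : Fin 3 → E2) (l : ℕ) (u : E2 → ℝ) (a b : ℕ) : ℝ := u (PP q ((a : ℝ) / l) ((b : ℝ) / l))

lemma u_fmap_q (q : Fin 3 → E2) (l : ℕ) (u : E2 → ℝ) (i : ℕ × ℕ) (j : Fin 3) :
    u (fmap q l i (q j)) = latU q l u (i.1 + (ev j).1) (i.2 + (ev j).2) := by
  rw [fmap_q]; rfl

lemma e0_fmap (q : Fin 3 → E2) (l : ℕ) (u : E2 → ℝ) (i : ℕ × ℕ) :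
    e0 q (u ∘ fmap q l i) = eU (latU q l u) i := by
  unfold e0 eU
  simp only [Function.comp]
  rw [u_fmap_q q l u, u_fmap_q q l u, u_fmap_q q l u]; rfl

lemma e0_lat (q : Fin 3 → E2) {l : ℕ} (hl : 5 ≤ l) (u : E2 → ℝ) :
    e0 q u = e3 (latU q l u 0 0) (latU q l u l 0) (latU q l u 0 l) := by
  have h : (l : ℝ) ≠ 0 := by positivity
  unfold e0 latU
  rw [q_eq q 0, q_eq q 1, q_eq q 2]
  simp [ev, div_self h]

lemma e0_le (q : Fin 3 → E2) {l : ℕ} (hl : 5 ≤ l) (u : E2 → ℝ) :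
    rl l * e0 q u ≤ ∑ i ∈ SF l, e0 q (u ∘ fmap q l i) := by
  simp only [e0_fmap]
  rw [e0_lat q hl]
  exact trace_ineq hl _

lemma EN_mono (q : Fin 3 → E2) {l : ℕ → ℕ} (hl : ∀ m, 5 ≤ l m) (u : E2 → ℝ) :
    Monotone (fun n => EN q l n u) := by
  apply monotone_nat_of_le_succ
  intro n
  rw [EN_succ]
  unfold EN
  apply mul_le_mul_of_nonneg_left _ (inv_nonneg.2 (Rn_pos l n).le)
  apply Finset.sum_le_sum
  intro w _
  rw [← div_eq_inv_mul, le_div_iff₀ (rl_pos _), mul_comm]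
  exact e0_le q (hl n) (u ∘ wordMap q l w n)

lemma EForm_tendsto (q : Fin 3 → E2) {l : ℕ → ℕ} (hl : ∀ m, 5 ≤ l m) {u : E2 → ℝ}
    (hu : u ∈ FDom q l) : Tendsto (fun n => EN q l n u) atTop (nhds (EForm q l u u)) := by
  have h : ∃ a, Tendsto (fun n => En q l n u u) atTop (nhds a) := by
    obtain ⟨C, hC⟩ := hu
    simp only [En_eq] at hC ⊢
    exact ⟨_, tendsto_atTop_ciSup (EN_mono q hl u) ⟨C, by rintro _ ⟨n, rfl⟩; exact hC n⟩⟩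
  have := tendsto_nhds_limUnder h
  simpa only [En_eq, EForm] using this

lemma EN_le_EForm (q : Fin 3 → E2) {l : ℕ → ℕ} (hl : ∀ m, 5 ≤ l m) {u : E2 → ℝ}
    (hu : u ∈ FDom q l) (n : ℕ) : EN q l n u ≤ EForm q l u u :=
  (EN_mono q hl u).ge_of_tendsto (EForm_tendsto q hl hu) n

lemma FDom_of {q : Fin 3 → E2} {l : ℕ → ℕ} {u : E2 → ℝ} {C : ℝ} (h : ∀ n, EN q l n u ≤ C) :
    u ∈ FDom q l := ⟨C, fun n => by rw [En_eq]; exact h n⟩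

lemma EForm_le (q : Fin 3 → E2) {l : ℕ → ℕ} (hl : ∀ m, 5 ≤ l m) {u : E2 → ℝ} {C : ℝ}
    (h : ∀ n, EN q l n u ≤ C) : EForm q l u u ≤ C :=
  le_of_tendsto' (EForm_tendsto q hl (FDom_of h)) h

/-! ### Chaining -/

lemma chain_cs (b ρ e : ℕ → ℝ) (M : ℕ) (hρ : ∀ j, 0 ≤ ρ j) (he : ∀ j, 0 ≤ e j)
    (h : ∀ j < M, (b (j + 1) - b j) ^ 2 ≤ ρ j * e j) :
    (b M - b 0) ^ 2 ≤ (∑ j ∈ Finset.range M, ρ j) * ∑ j ∈ Finset.range M, e j := by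
  rw [← Finset.sum_range_sub]
  exact Finset.sum_sq_le_sum_mul_sum_of_sq_le_mul _ (fun j _ => hρ j) (fun j _ => he j)
    (fun j hj => h j (Finset.mem_range.1 hj))

lemma chain_main {α : Type*} (r : α → α → Prop) (S : Finset α) (hS : ∀ x y, r x y → x ∈ S ∧ y ∈ S)
    (ε : α → ℝ) (hε : ∀ x, 0 ≤ ε x) (val : α → Fin 3 → ℝ)
    (hr : ∀ x y, r x y → ∃ j j', val x j = val y j')
    (hv : ∀ x j j', (val x j - val x j') ^ 2 ≤ 2 / 3 * ε x)
    {k : ℕ} {x y : α} (h : Ch r k x y) (hxy : x ≠ y) {X Y ρ₀ ρ₁ : ℝ} (h0 : 0 ≤ ρ₀) (h1 : 0 ≤ ρ₁)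
    (hX : ∀ j, (X - val x j) ^ 2 ≤ ρ₀ * ε x) (hY : ∀ j, (Y - val y j) ^ 2 ≤ ρ₁ * ε y) :
    (X - Y) ^ 2 ≤ (ρ₀ + 2 / 3 * ((k : ℝ) - 1) + ρ₁) * ∑ z ∈ S, ε z := by
  classical
  obtain ⟨k', hk', c, c0, ck, hc, hinj⟩ := Ch_inj h
  obtain ⟨K, rfl⟩ : ∃ K, k' = K + 1 := by
    rcases Nat.eq_zero_or_pos k' with h' | h'
    · subst h'; exact absurd (c0.symm.trans ck) hxy
    · exact ⟨k' - 1, by omega⟩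
  have hex : ∀ j, ∃ p : Fin 3 × Fin 3, j < K + 1 → val (c j) p.1 = val (c (j + 1)) p.2 := by
    intro j
    by_cases hj : j < K + 1
    · obtain ⟨a, b, e⟩ := hr _ _ (hc j hj)
      exact ⟨(a, b), fun _ => e⟩
    · exact ⟨(0, 0), fun h => absurd h hj⟩
  choose p hp using hex
  set b : ℕ → ℝ := fun j => if j = 0 then X else if j = K + 2 then Y else
    val (c (j - 1)) (p (j - 1)).1 with hb
  set ρ : ℕ → ℝ := fun j => if j = 0 then ρ₀ else if j = K + 1 then ρ₁ else 2 / 3 with hρ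
  have main := chain_cs b ρ (fun j => ε (c j)) (K + 2)
    (fun j => by simp only [hρ]; split_ifs <;> first | assumption | norm_num) (fun j => hε _) (by
      intro j hj
      rcases Nat.eq_zero_or_pos j with h0 | h0
      · subst h0
        have := hX (p 0).1
        rw [← c0] at this
        simp only [hb, hρ]
        simp only [if_true, Nat.zero_add]
        rw [if_neg (by omega), if_neg (by omega)]
        simpa [sub_sq_comm] using (sub_sq_comm X (val (c 0) (p 0).1)) ▸ this
      rcases Nat.eq_or_lt_of_le (show j ≤ K + 1 by omega) with h2 | h2
      · subst h2
        simp only [hb, hρ]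
        rw [if_neg (by omega), if_pos trivial, if_neg (by omega), if_neg (by omega), if_neg (by omega),
          if_pos trivial, Nat.add_sub_cancel, hp K (by omega), ck]
        exact hY _
      · simp only [hb, hρ]
        rw [if_neg (by omega), if_neg (by omega), if_neg (by omega), if_neg (by omega),
          if_neg (by omega), if_neg (by omega), hp (j - 1) (by omega), Nat.add_sub_cancel,
          show j - 1 + 1 = j by omega]
        exact hv _ _ _)
  have hb0 : b 0 = X := by simp [hb]
  have hbK : b (K + 2) = Y := by simp [hb]
  rw [hb0, hbK] at main
  have hsρ : ∑ j ∈ Finset.range (K + 2), ρ j = ρ₀ + 2 / 3 * (K : ℝ) + ρ₁ := by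
    rw [Finset.sum_range_succ, Finset.sum_range_succ']
    have : ∀ j ∈ Finset.range K, ρ (j + 1) = 2 / 3 := by
      intro j hj
      rw [Finset.mem_range] at hj
      simp only [hρ]; rw [if_neg (by omega), if_neg (by omega)]
    rw [Finset.sum_congr rfl this]
    simp [hρ]; ring
  have hse : ∑ j ∈ Finset.range (K + 2), ε (c j) ≤ ∑ z ∈ S, ε z := by
    rw [← Finset.sum_image (s := Finset.range (K + 2)) (g := c) (f := ε)]
    · apply Finset.sum_le_sum_of_subset_of_nonneg
      · intro z hz
        obtain ⟨j, hj, rfl⟩ := Finset.mem_image.1 hz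
        rw [Finset.mem_range] at hj
        rcases Nat.eq_or_lt_of_le (show j ≤ K + 1 by omega) with h2 | h2
        · subst h2; exact (hS _ _ (hc K (by omega))).2
        · exact (hS _ _ (hc j h2)).1
      · intro z _ _; exact hε z
    · intro a ha b hb e
      simp only [Finset.coe_range, Set.mem_Iio] at ha hb
      exact hinj a (by omega) b (by omega) e
  have hsum0 : 0 ≤ ∑ z ∈ S, ε z := Finset.sum_nonneg fun z _ => hε z
  have hKk : (K : ℝ) + 1 ≤ k := by exact_mod_cast hk'
  calc (X - Y) ^ 2 = (Y - X) ^ 2 := by ring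
    _ ≤ _ := main
    _ ≤ (∑ j ∈ Finset.range (K + 2), ρ j) * ∑ z ∈ S, ε z := by
        apply mul_le_mul_of_nonneg_left hse
        rw [hsρ]; positivity
    _ ≤ _ := by
        apply mul_le_mul_of_nonneg_right _ hsum0
        rw [hsρ]; linarith

lemma e0_ge (q : Fin 3 → E2) (u : E2 → ℝ) (j j' : Fin 3) :
    (u (q j) - u (q j')) ^ 2 ≤ 2 / 3 * e0 q u := by
  unfold e0
  have h1 := e3_ge (u (q 0)) (u (q 1)) (u (q 2))
  have h2 := e3_ge (u (q 1)) (u (q 2)) (u (q 0))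
  have h3 := e3_ge (u (q 2)) (u (q 0)) (u (q 1))
  rw [← e3_perm1] at h2
  rw [e3_perm1] at h3
  have h0 := e3_nonneg (u (q 0)) (u (q 1)) (u (q 2))
  have : ∀ j : Fin 3, j = 0 ∨ j = 1 ∨ j = 2 := by decide
  rcases this j with rfl | rfl | rfl <;> rcases this j' with rfl | rfl | rfl <;>
    first | nlinarith | (simp; linarith)

lemma e0_le_EN (q : Fin 3 → E2) {l : ℕ → ℕ} (hl : ∀ m, 5 ≤ l m) (u : E2 → ℝ) (m : ℕ) :
    e0 q u ≤ EN q l m u := by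
  rw [← EN_zero q l]; exact EN_mono q hl u (Nat.zero_le m)

lemma adj1_vertex (q : Fin 3 → E2) {l : ℕ} {i i' : ℕ × ℕ} (h : adj1 l i i') :
    ∃ j j' : Fin 3, fmap q l i (q j) = fmap q l i' (q j') := by
  obtain ⟨-, -, j, j', e⟩ := h
  exact ⟨j, j', by rw [fmap_q, fmap_q, e]⟩

lemma Vn_one_add {q : Fin 3 → E2} {l : ℕ → ℕ} {m : ℕ} {x : E2} (hx : x ∈ Vn q l (1 + m)) :
    ∃ i ∈ Sset (l 0), ∃ z ∈ Vn q (sh l 1) m, fmap q (l 0) i z = x := by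
  obtain ⟨w, hw, j, rfl⟩ := mem_Vn.1 hx
  refine ⟨w 0, hw.1 0 (by omega), wordMap q (sh l 1) (suf 1 w) m (q j),
    mem_Vn.2 ⟨_, suf_mem hw, j, rfl⟩, ?_⟩
  rw [wordMap_split, eq_single (pre_mem hw), wordMap_single]
  rfl

lemma corner_fix (q : Fin 3 → E2) {l : ℕ} (hl : 5 ≤ l) (j : Fin 3) :
    fmap q l (cc (l - 2) j) (q j) = q j := by
  have h : (l : ℝ) ≠ 0 := by positivity
  rw [fmap_q, q_eq q j]
  obtain ⟨n, rfl⟩ : ∃ n, l = n + 2 := ⟨l - 2, by omega⟩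
  have h2 : ((n : ℝ) + 2) ≠ 0 := by positivity
  have h3 : ((n : ℝ) + 1 + 1) ≠ 0 := by positivity
  rcases cc_cases (n + 2 - 2) j with ⟨rfl, h, -⟩ | ⟨rfl, h, -⟩ | ⟨rfl, h, -⟩ <;> rw [h] <;>
    simp [ev, h2] <;> congr 1 <;> field_simp <;> ring

lemma cc_mem' {l : ℕ} (hl : 5 ≤ l) (j : Fin 3) : cc (l - 2) j ∈ Sset l := by
  have := cc_mem (l - 2) j
  rwa [show l - 2 + 2 = l by omega] at this

lemma sum_EN_one (q : Fin 3 → E2) (l : ℕ → ℕ) (m : ℕ) (u : E2 → ℝ) :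
    ∑ i ∈ SF (l 0), EN q (sh l 1) m (u ∘ fmap q (l 0) i) = rl (l 0) * EN q l (1 + m) u := by
  rw [EN_succ', ← mul_assoc, mul_inv_cancel₀ (rl_pos _).ne', one_mul]

lemma rl_mul (l : ℕ) : rl l * (2 * (l : ℝ) / 3 + 1 / 9) = 1 := by
  unfold rl
  have : 2 * (l : ℝ) / 3 + 1 / 9 ≠ 0 := by positivity
  field_simp

lemma rl_le {l : ℕ} (hl : 5 ≤ l) : rl l ≤ 9 / 31 := by
  have := rl_mul l
  have h5 : (5 : ℝ) ≤ l := by exact_mod_cast hl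
  have hp := rl_pos l
  nlinarith

/-- Level one chain estimate. -/
lemma chain_one (q : Fin 3 → E2) {l : ℕ → ℕ} (hl : ∀ m, 5 ≤ l m) (m : ℕ) (u : E2 → ℝ)
    {i i' : ℕ × ℕ} (hi : i ∈ Sset (l 0)) (hi' : i' ∈ Sset (l 0)) (hne : i ≠ i') {X Y ρ₀ ρ₁ : ℝ}
    (h0 : 0 ≤ ρ₀) (h1 : 0 ≤ ρ₁)
    (hX : ∀ j, (X - u (fmap q (l 0) i (q j))) ^ 2 ≤ ρ₀ * EN q (sh l 1) m (u ∘ fmap q (l 0) i))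
    (hY : ∀ j, (Y - u (fmap q (l 0) i' (q j))) ^ 2 ≤ ρ₁ * EN q (sh l 1) m (u ∘ fmap q (l 0) i')) :
    (X - Y) ^ 2 ≤ (ρ₀ + ρ₁ + ((l 0 : ℕ) - 7 / 3)) * (rl (l 0) * EN q l (1 + m) u) := by
  obtain ⟨t, ht, hc⟩ := Ch_short (hl 0) hi hi'
  have := chain_main (adj1 (l 0)) (SF (l 0)) (fun x y h => ⟨mem_SF.2 h.1, mem_SF.2 h.2.1⟩)
    (fun i => EN q (sh l 1) m (u ∘ fmap q (l 0) i)) (fun _ => EN_nonneg _ _ _ _)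
    (fun i j => u (fmap q (l 0) i (q j)))
    (fun x y h => by obtain ⟨j, j', e⟩ := adj1_vertex q h; exact ⟨j, j', by rw [e]⟩)
    (fun x j j' => (e0_ge q (u ∘ fmap q (l 0) x) j j').trans
      (mul_le_mul_of_nonneg_left (e0_le_EN q (sh_five hl 1) _ m) (by norm_num)))
    hc hne h0 h1 hX hY
  rw [sum_EN_one] at this
  refine this.trans ?_
  apply mul_le_mul_of_nonneg_right _ (mul_nonneg (rl_pos _).le (EN_nonneg _ _ _ _))
  have h' : 2 * (t : ℝ) + 5 ≤ 3 * (l 0 : ℕ) := by exact_mod_cast ht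
  linarith

lemma T_est (q : Fin 3 → E2) (m : ℕ) : ∀ {l : ℕ → ℕ} (_ : ∀ m, 5 ≤ l m) (u : E2 → ℝ) {x : E2}
    (_ : x ∈ Vn q l m) (j : Fin 3), (u x - u (q j)) ^ 2 ≤ 18 / 11 * EN q l m u := by
  induction m with
  | zero =>
    intro l hl u x hx j
    obtain ⟨w, hw, j', rfl⟩ := mem_Vn.1 hx
    rw [EN_zero]
    have := e0_ge q u j' j
    have h0 := e0_nonneg q u
    simp only [wordMap, id]
    linarith
  | succ m ih =>
    intro l hl u x hx j
    rw [Nat.add_comm] at hx ⊢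
    obtain ⟨i, hi, z, hz, rfl⟩ := Vn_one_add hx
    have hE := EN_nonneg q l (1 + m) u
    have hr := rl_pos (l 0)
    have hr' := rl_le (hl 0)
    have hrm := rl_mul (l 0)
    by_cases hne : i = cc (l 0 - 2) j
    · have h := ih (sh_five hl 1) (u ∘ fmap q (l 0) i) hz j
      simp only [Function.comp] at h
      have h1 : EN q (sh l 1) m (u ∘ fmap q (l 0) i) ≤ rl (l 0) * EN q l (1 + m) u := by
        rw [← sum_EN_one]
        exact Finset.single_le_sum (f := fun i => EN q (sh l 1) m (u ∘ fmap q (l 0) i))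
          (fun i _ => EN_nonneg _ _ _ _) (mem_SF.2 hi)
      have h2 : fmap q (l 0) i (q j) = q j := by rw [hne, corner_fix q (hl 0)]
      rw [h2] at h
      simp only [Function.comp_def] at h h1
      nlinarith
    · have := chain_one q hl m u hi (cc_mem' (hl 0) j) hne (X := u (fmap q (l 0) i z)) (Y := u (q j))
        (ρ₀ := 18 / 11) (ρ₁ := 2 / 3) (by norm_num) (by norm_num)
        (fun j => ih (sh_five hl 1) (u ∘ fmap q (l 0) i) hz j)
        (fun j' => by
          have h := e0_ge q (u ∘ fmap q (l 0) (cc (l 0 - 2) j)) j j'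
          simp only [Function.comp, corner_fix q (hl 0)] at h
          refine h.trans (mul_le_mul_of_nonneg_left (e0_le_EN q (sh_five hl 1) _ m) (by norm_num)))
      refine this.trans ?_
      rw [← mul_assoc]
      apply mul_le_mul_of_nonneg_right _ hE
      have h5 : (5 : ℝ) ≤ (l 0 : ℕ) := by exact_mod_cast hl 0
      nlinarith

/-- Estimate within one cell. -/
lemma T2_est (q : Fin 3 → E2) (m : ℕ) {l : ℕ → ℕ} (hl : ∀ m, 5 ≤ l m) (u : E2 → ℝ) {x y : E2}
    (hx : x ∈ Vn q l (1 + m)) (hy : y ∈ Vn q l (1 + m)) :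
    (u x - u y) ^ 2 ≤ 2 * EN q l (1 + m) u := by
  obtain ⟨i, hi, z, hz, rfl⟩ := Vn_one_add hx
  obtain ⟨i', hi', z', hz', rfl⟩ := Vn_one_add hy
  have hE := EN_nonneg q l (1 + m) u
  have hr := rl_pos (l 0)
  have hr' := rl_le (hl 0)
  have hrm := rl_mul (l 0)
  have a1 := fun j => T_est q m (sh_five hl 1) (u ∘ fmap q (l 0) i) hz j
  have a2 := fun j => T_est q m (sh_five hl 1) (u ∘ fmap q (l 0) i') hz' j
  by_cases hne : i = i'
  · subst hne
    have h1 : EN q (sh l 1) m (u ∘ fmap q (l 0) i) ≤ rl (l 0) * EN q l (1 + m) u := by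
      rw [← sum_EN_one]
      exact Finset.single_le_sum (f := fun i => EN q (sh l 1) m (u ∘ fmap q (l 0) i))
        (fun i _ => EN_nonneg _ _ _ _) (mem_SF.2 hi)
    have b1 := a1 0
    have b2 := a2 0
    have h3 : rl (l 0) * EN q l (1 + m) u ≤ 9 / 31 * EN q l (1 + m) u :=
      mul_le_mul_of_nonneg_right hr' hE
    set A := EN q (sh l 1) m (u ∘ fmap q (l 0) i)
    simp only [Function.comp] at b1 b2
    nlinarith [sq_nonneg ((u (fmap q (l 0) i z) - u (fmap q (l 0) i (q 0)))
      + (u (fmap q (l 0) i z') - u (fmap q (l 0) i (q 0))))]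
  · have := chain_one q hl m u hi hi' hne (X := u (fmap q (l 0) i z)) (Y := u (fmap q (l 0) i' z'))
        (ρ₀ := 18 / 11) (ρ₁ := 18 / 11) (by norm_num) (by norm_num) a1 a2
    refine this.trans ?_
    rw [← mul_assoc]
    apply mul_le_mul_of_nonneg_right _ hE
    have h5 : (5 : ℝ) ≤ (l 0 : ℕ) := by exact_mod_cast hl 0
    nlinarith

/-! ### Passing to `K` -/

lemma Vn_approx {q : Fin 3 → E2} (hq : Equi q) {l : ℕ → ℕ} (hl : ∀ m, 5 ≤ l m) {x : E2}
    (hx : x ∈ Gasket q l) : ∃ p : ℕ → E2, (∀ m, p m ∈ Vn q l m) ∧ (∀ m, p m ∈ Gasket q l) ∧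
      Tendsto p atTop (nhds x) := by
  have h : ∀ m, ∃ p, p ∈ Vn q l m ∧ p ∈ Gasket q l ∧ dist p x ≤ (1 / 5 : ℝ) ^ m := by
    intro m
    obtain ⟨w, hw, z, hz, rfl⟩ := exists_word hl m hx
    refine ⟨wordMap q l w m (q 0), mem_Vn.2 ⟨w, hw, 0, rfl⟩,
      wordMap_mem_Gasket hl hw (q_mem q (sh_five hl m) 0), ?_⟩
    rw [wordMap_dist]
    have h1 := Tri_dist hq (q_mem_Tri q 0) (Gasket_sub_Tri q _ hz)
    have h2 : (5 : ℝ) ^ m ≤ Ln l m := by exact_mod_cast five_pow_le hl m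
    have h3 : (0 : ℝ) < 5 ^ m := by positivity
    calc (Ln l m : ℝ)⁻¹ * dist (q 0) z ≤ (5 ^ m : ℝ)⁻¹ * 1 := by
          apply mul_le_mul _ h1 dist_nonneg (by positivity)
          exact inv_anti₀ h3 h2
      _ = (1 / 5 : ℝ) ^ m := by rw [mul_one, one_div, inv_pow]
  choose p h1 h2 h3 using h
  refine ⟨p, h1, h2, ?_⟩
  rw [tendsto_iff_dist_tendsto_zero]
  exact squeeze_zero (fun _ => dist_nonneg) h3
    (tendsto_pow_atTop_nhds_zero_of_lt_one (by norm_num) (by norm_num))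

lemma cont_lim {s : Set E2} {u : E2 → ℝ} (hu : ContinuousOn u s) {x : E2} (hx : x ∈ s)
    {p : ℕ → E2} (hp : ∀ m, p m ∈ s) (h : Tendsto p atTop (nhds x)) :
    Tendsto (fun m => u (p m)) atTop (nhds (u x)) :=
  (hu x hx).tendsto.comp (tendsto_nhdsWithin_iff.2 ⟨h, Eventually.of_forall hp⟩)

lemma T_K {q : Fin 3 → E2} (hq : Equi q) {l : ℕ → ℕ} (hl : ∀ m, 5 ≤ l m) {u : E2 → ℝ}
    (hu : ContinuousOn u (Gasket q l)) {C : ℝ} (hC : ∀ n, EN q l n u ≤ C) {x : E2}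
    (hx : x ∈ Gasket q l) (j : Fin 3) : (u x - u (q j)) ^ 2 ≤ 18 / 11 * C := by
  obtain ⟨p, p1, p2, p3⟩ := Vn_approx hq hl hx
  refine le_of_tendsto' (((cont_lim hu hx p2 p3).sub_const _).pow 2) fun m => ?_
  exact (T_est q m hl u (p1 m) j).trans (by linarith [hC m])

lemma T2_K {q : Fin 3 → E2} (hq : Equi q) {l : ℕ → ℕ} (hl : ∀ m, 5 ≤ l m) {u : E2 → ℝ}
    (hu : ContinuousOn u (Gasket q l)) {C : ℝ} (hC : ∀ n, EN q l n u ≤ C) {x y : E2}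
    (hx : x ∈ Gasket q l) (hy : y ∈ Gasket q l) : (u x - u y) ^ 2 ≤ 2 * C := by
  obtain ⟨p, p1, p2, p3⟩ := Vn_approx hq hl hx
  obtain ⟨p', p1', p2', p3'⟩ := Vn_approx hq hl hy
  have t := ((cont_lim hu hx p2 p3).sub (cont_lim hu hy p2' p3')).pow 2
  have t' := t.comp (tendsto_add_atTop_nat 1)
  refine le_of_tendsto' t' fun m => ?_
  simp only [Function.comp]
  have a := p1 (m + 1)
  have a' := p1' (m + 1)
  rw [Nat.add_comm] at a a' ⊢
  exact (T2_est q m hl u a a').trans (by linarith [hC (1 + m)])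

lemma REc_bdd {q : Fin 3 → E2} (hq : Equi q) {l : ℕ → ℕ} (hl : ∀ m, 5 ≤ l m) {x y : E2}
    (hx : x ∈ Gasket q l) (hy : y ∈ Gasket q l) : BddAbove (REcSet q l x y) := by
  refine ⟨2, ?_⟩
  rintro t ⟨u, hu, hc, hpos, rfl⟩
  rw [div_le_iff₀ hpos]
  exact T2_K hq hl hc (EN_le_EForm q hl hu) hx hy

/-! ### Chains of words -/

def adjW (q : Fin 3 → E2) (l : ℕ → ℕ) (n : ℕ) (w v : ℕ → ℕ × ℕ) : Prop :=
  w ∈ Wn l n ∧ v ∈ Wn l n ∧ (Cell q l n w ∩ Cell q l n v).Nonempty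

lemma adjW_symm {q : Fin 3 → E2} {l : ℕ → ℕ} {n : ℕ} (w v : ℕ → ℕ × ℕ) (h : adjW q l n w v) :
    adjW q l n v w := ⟨h.2.1, h.1, by rw [Set.inter_comm]; exact h.2.2⟩

lemma adjW_vertex {q : Fin 3 → E2} (hq : Equi q) {l : ℕ → ℕ} (hl : ∀ m, 5 ≤ l m) {n : ℕ}
    {w v : ℕ → ℕ × ℕ} (h : adjW q l n w v) :
    ∃ j j', wordMap q l w n (q j) = wordMap q l v n (q j') := by
  obtain ⟨hw, hv, z, ⟨-, x, hx, rfl⟩, ⟨-, y, hy, e⟩⟩ := h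
  by_cases hne : w = v
  · subst hne; exact ⟨0, 0, rfl⟩
  · obtain ⟨j, j', rfl, rfl⟩ := cell_inter q hq hl n hw hv hne hx hy e.symm
    exact ⟨j, j', e.symm⟩

lemma vertex_mem_Cell {q : Fin 3 → E2} {l : ℕ → ℕ} (hl : ∀ m, 5 ≤ l m) {n : ℕ} {w : ℕ → ℕ × ℕ}
    (hw : w ∈ Wn l n) (j : Fin 3) : wordMap q l w n (q j) ∈ Cell q l n w :=
  ⟨wordMap_mem_Gasket hl hw (q_mem q (sh_five hl n) j), q j, q_mem_Tri q j, rfl⟩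

lemma adjW_of {q : Fin 3 → E2} {l : ℕ → ℕ} (hl : ∀ m, 5 ≤ l m) {n : ℕ} {w v : ℕ → ℕ × ℕ}
    (hw : w ∈ Wn l n) (hv : v ∈ Wn l n) {j j' : Fin 3}
    (h : wordMap q l w n (q j) = wordMap q l v n (q j')) : adjW q l n w v :=
  ⟨hw, hv, _, vertex_mem_Cell hl hw j, by rw [h]; exact vertex_mem_Cell hl hv j'⟩

lemma Lam_Ch {q : Fin 3 → E2} {l : ℕ → ℕ} {n k : ℕ} {w v : ℕ → ℕ × ℕ} (h : v ∈ Lam q l n w k) :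
    Ch (adjW q l n) k w v := by
  obtain ⟨hv, c, c0, ck, c1, c2⟩ := h
  exact ⟨c, c0, ck, fun j hj => ⟨c1 j (by omega), c1 (j + 1) (by omega), c2 j hj⟩⟩

lemma Ch_Lam {q : Fin 3 → E2} {l : ℕ → ℕ} {n k : ℕ} {w v : ℕ → ℕ × ℕ} (hw : w ∈ Wn l n)
    (h : Ch (adjW q l n) k w v) : v ∈ Lam q l n w k := by
  obtain ⟨c, c0, ck, c1⟩ := h
  have hm : ∀ j ≤ k, c j ∈ Wn l n := by
    intro j hj
    rcases Nat.eq_zero_or_pos j with h0 | h0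
    · rw [h0, c0]; exact hw
    · have := (c1 (j - 1) (by omega)).2.1
      rwa [show j - 1 + 1 = j by omega] at this
  exact ⟨ck ▸ hm k le_rfl, c, c0, ck, hm, fun j hj => (c1 j hj).2.2⟩

lemma adjW_refl {q : Fin 3 → E2} {l : ℕ → ℕ} (hl : ∀ m, 5 ≤ l m) {n : ℕ} {w : ℕ → ℕ × ℕ}
    (hw : w ∈ Wn l n) : adjW q l n w w := adjW_of hl hw hw (j := 0) rfl

lemma Ch_mono {q : Fin 3 → E2} {l : ℕ → ℕ} (hl : ∀ m, 5 ≤ l m) {n : ℕ} {w v : ℕ → ℕ × ℕ}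
    (hv : v ∈ Wn l n) {k k' : ℕ} (hk : k ≤ k') (h : Ch (adjW q l n) k w v) :
    Ch (adjW q l n) k' w v := by
  obtain ⟨d, rfl⟩ := Nat.exists_eq_add_of_le hk
  exact Ch_trans h ⟨fun _ => v, rfl, rfl, fun _ _ => adjW_refl hl hv⟩

/-- Lifting of level one chains. -/
lemma adjW_lift {q : Fin 3 → E2} {l : ℕ → ℕ} (hl : ∀ m, 5 ≤ l m) {n : ℕ} {w : ℕ → ℕ × ℕ}
    (hw : w ∈ Wn l n) {i i' : ℕ × ℕ} (h : adj1 (l n) i i') :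
    adjW q l (n + 1) (cat n w (single i)) (cat n w (single i')) := by
  obtain ⟨j, j', e⟩ := adj1_vertex q h
  have h0 : sh l n 0 = l n := by simp [sh]
  refine adjW_of hl (cat_mem hw (single_mem (by rw [h0]; exact h.1)))
    (cat_mem hw (single_mem (by rw [h0]; exact h.2.1))) (j := j) (j' := j') ?_
  rw [wordMap_cat, wordMap_cat, wordMap_single, wordMap_single, h0]
  simp only [Function.comp, e]

/-! ### Upper bound for the resistance -/

lemma sum_EN (q : Fin 3 → E2) (l : ℕ → ℕ) (n m : ℕ) (u : E2 → ℝ) :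
    ∑ w ∈ WF l n, EN q (sh l n) m (u ∘ wordMap q l w n) = Rn l n * EN q l (n + m) u := by
  rw [EN_add, ← mul_assoc, mul_inv_cancel₀ (Rn_pos _ _).ne', one_mul]

lemma cont_cell {q : Fin 3 → E2} {l : ℕ → ℕ} (hl : ∀ m, 5 ≤ l m) {n : ℕ} {w : ℕ → ℕ × ℕ}
    (hw : w ∈ Wn l n) {u : E2 → ℝ} (hu : ContinuousOn u (Gasket q l)) :
    ContinuousOn (u ∘ wordMap q l w n) (Gasket q (sh l n)) :=
  hu.comp (wordMap_continuous q l w n).continuousOn fun _ hz => wordMap_mem_Gasket hl hw hz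

lemma RE_upper {q : Fin 3 → E2} (hq : Equi q) {l : ℕ → ℕ} (hl : ∀ m, 5 ≤ l m) {n : ℕ}
    {w v : ℕ → ℕ × ℕ} (hw : w ∈ Wn l n) (hv : v ∈ Wn l n) {k : ℕ} (hk : 1 ≤ k)
    (hch : Ch (adjW q l n) k w v) {u : E2 → ℝ} (hu : ContinuousOn u (Gasket q l)) {C : ℝ}
    (hC : ∀ n, EN q l n u ≤ C) {x y : E2} (hx : x ∈ Cell q l n w) (hy : y ∈ Cell q l n v) :
    (u x - u y) ^ 2 ≤ (2 / 3 * (k : ℝ) + 3) * Rn l n * C := by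
  rw [Cell_eq hq hl hw] at hx
  rw [Cell_eq hq hl hv] at hy
  obtain ⟨z, hz, rfl⟩ := hx
  obtain ⟨z', hz', rfl⟩ := hy
  have hR := Rn_pos l n
  have hC0 : 0 ≤ C := (EN_nonneg q l 0 u).trans (hC 0)
  have hk1 : (1 : ℝ) ≤ k := by exact_mod_cast hk
  by_cases hne : w = v
  · subst hne
    have := T2_K hq (sh_five hl n) (cont_cell hl hw hu) (C := Rn l n * C) (fun m => by
      have h1 : EN q (sh l n) m (u ∘ wordMap q l w n) ≤ Rn l n * EN q l (n + m) u := by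
        rw [← sum_EN]
        exact Finset.single_le_sum (f := fun w => EN q (sh l n) m (u ∘ wordMap q l w n))
          (fun i _ => EN_nonneg _ _ _ _) (mem_WF.2 hw)
      exact h1.trans (mul_le_mul_of_nonneg_left (hC _) hR.le)) hz hz'
    simp only [Function.comp] at this
    have h2 : 0 ≤ Rn l n * C := mul_nonneg hR.le hC0
    nlinarith
  · obtain ⟨p, p1, p2, p3⟩ := Vn_approx hq (sh_five hl n) hz
    obtain ⟨p', p1', p2', p3'⟩ := Vn_approx hq (sh_five hl n) hz'
    refine le_of_tendsto' (((cont_lim (cont_cell hl hw hu) hz p2 p3).sub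
      (cont_lim (cont_cell hl hv hu) hz' p2' p3')).pow 2) fun m => ?_
    have := chain_main (adjW q l n) (WF l n) (fun x y h => ⟨mem_WF.2 h.1, mem_WF.2 h.2.1⟩)
      (fun w => EN q (sh l n) m (u ∘ wordMap q l w n)) (fun _ => EN_nonneg _ _ _ _)
      (fun w j => u (wordMap q l w n (q j)))
      (fun x y h => by obtain ⟨j, j', e⟩ := adjW_vertex hq hl h; exact ⟨j, j', by rw [e]⟩)
      (fun x j j' => (e0_ge q (u ∘ wordMap q l x n) j j').trans
        (mul_le_mul_of_nonneg_left (e0_le_EN q (sh_five hl n) _ m) (by norm_num)))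
      hch hne (by norm_num : (0 : ℝ) ≤ 18 / 11) (by norm_num : (0 : ℝ) ≤ 18 / 11)
      (fun j => T_est q m (sh_five hl n) (u ∘ wordMap q l w n) (p1 m) j)
      (fun j => T_est q m (sh_five hl n) (u ∘ wordMap q l v n) (p1' m) j)
    rw [sum_EN] at this
    refine this.trans ?_
    rw [mul_assoc]
    apply mul_le_mul _ (mul_le_mul_of_nonneg_left (hC _) hR.le)
      (mul_nonneg hR.le (EN_nonneg _ _ _ _)) (by positivity)
    linarith

lemma REc_upper {q : Fin 3 → E2} (hq : Equi q) {l : ℕ → ℕ} (hl : ∀ m, 5 ≤ l m) {n : ℕ}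
    {w : ℕ → ℕ × ℕ} (hw : w ∈ Wn l n) {k : ℕ} (hk : 1 ≤ k) {x y : E2}
    (hx : x ∈ Cell q l n w) (hy : y ∈ Unwk q l n w k) :
    REc q l x y < (2 / 3 * (k : ℝ) + 10 / 3) * Rn l n := by
  obtain ⟨v, hv, hyv⟩ := Set.mem_iUnion₂.1 hy
  have hR := Rn_pos l n
  have h1 : REc q l x y ≤ (2 / 3 * (k : ℝ) + 3) * Rn l n := by
    apply Real.sSup_le _ (by positivity)
    rintro t ⟨u, hu, hc, hpos, rfl⟩
    rw [div_le_iff₀ hpos]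
    exact RE_upper hq hl hw hv.1 hk (Lam_Ch hv) hc (EN_le_EForm q hl hu) hx hyv
  refine h1.trans_lt ?_
  apply mul_lt_mul_of_pos_right _ hR
  linarith

/-! ## Upper bound for the geodesic distance -/

lemma pdist_path {q : Fin 3 → E2} {l : ℕ → ℕ} {x y : E2} {a : ℝ≥0∞} (h : pdist q l x y < a) :
    ∃ γ : ℝ → E2, ContinuousOn γ (Set.Icc 0 1) ∧ Set.MapsTo γ (Set.Icc 0 1) (Gasket q l) ∧
      γ 0 = x ∧ γ 1 = y ∧ eVariationOn γ (Set.Icc 0 1) < a := by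
  simpa only [pdist, iInf_lt_iff, exists_prop] using h

lemma pdist_le {q : Fin 3 → E2} {l : ℕ → ℕ} {x y : E2} {a : ℝ≥0∞} (γ : ℝ → E2)
    (h1 : ContinuousOn γ (Set.Icc 0 1)) (h2 : Set.MapsTo γ (Set.Icc 0 1) (Gasket q l))
    (h3 : γ 0 = x) (h4 : γ 1 = y) (h5 : eVariationOn γ (Set.Icc 0 1) ≤ a) : pdist q l x y ≤ a :=
  iInf₂_le_of_le γ h1 (iInf₂_le_of_le h2 h3 (iInf_le_of_le h4 h5))

lemma pdist_comm (q : Fin 3 → E2) (l : ℕ → ℕ) (x y : E2) : pdist q l x y = pdist q l y x := by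
  have key : ∀ x y : E2, pdist q l x y ≤ pdist q l y x := by
    intro x y
    refine le_of_forall_gt_imp_ge_of_dense fun a ha => ?_
    obtain ⟨γ, h1, h2, h3, h4, h5⟩ := pdist_path ha
    have hm : Set.MapsTo (fun t : ℝ => 1 - t) (Set.Icc 0 1) (Set.Icc 0 1) := fun t ht => by
      simp only [Set.mem_Icc] at ht ⊢; constructor <;> linarith
    refine pdist_le (γ ∘ fun t => 1 - t) (h1.comp (by fun_prop) hm) (h2.comp hm) (by simp [h4])
      (by simp [h3]) ((eVariationOn.comp_le_of_antitoneOn γ _ ?_ hm).trans h5.le)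
    intro a _ b _ hab
    simp only; linarith
  exact le_antisymm (key x y) (key y x)

lemma eVar_add (f g : ℝ → E2) (c : E2) (s : Set ℝ) :
    eVariationOn (fun t => f t + (g t - c)) s ≤ eVariationOn f s + eVariationOn g s := by
  refine iSup_le ?_
  rintro ⟨n, u, hu, us⟩
  refine le_trans ?_ (add_le_add (eVariationOn.sum_le (f := f) (n := n) hu us)
    (eVariationOn.sum_le (f := g) (n := n) hu us))
  rw [← Finset.sum_add_distrib]
  refine Finset.sum_le_sum fun i _ => ?_
  refine (edist_add_add_le _ _ _ _).trans ?_
  rw [edist_sub_right]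

lemma pdist_triangle (q : Fin 3 → E2) (l : ℕ → ℕ) (x y z : E2) :
    pdist q l x z ≤ pdist q l x y + pdist q l y z := by
  refine ENNReal.le_of_forall_pos_le_add fun ε hε hfin => ?_
  have hε' : ((ε : ℝ≥0∞) / 2) ≠ 0 := by simp [hε.ne']
  rw [ENNReal.add_lt_top] at hfin
  obtain ⟨γ, h1, h2, h3, h4, h5⟩ := pdist_path (ENNReal.lt_add_right hfin.1.ne hε')
  obtain ⟨δ, k1, k2, k3, k4, k5⟩ := pdist_path (ENNReal.lt_add_right hfin.2.ne hε')
  set φ : ℝ → ℝ := fun t => min 1 (2 * t) with hφ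
  set ψ : ℝ → ℝ := fun t => max 0 (2 * t - 1) with hψ
  have m1 : Set.MapsTo φ (Set.Icc 0 1) (Set.Icc 0 1) := fun t ht => by
    simp only [Set.mem_Icc, hφ] at ht ⊢
    exact ⟨le_min (by norm_num) (by linarith), min_le_left _ _⟩
  have m2 : Set.MapsTo ψ (Set.Icc 0 1) (Set.Icc 0 1) := fun t ht => by
    simp only [Set.mem_Icc, hψ] at ht ⊢
    exact ⟨le_max_left _ _, max_le (by norm_num) (by linarith)⟩
  have c1 : ContinuousOn φ (Set.Icc 0 1) := by simp only [hφ]; fun_prop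
  have c2 : ContinuousOn ψ (Set.Icc 0 1) := by simp only [hψ]; fun_prop
  have o1 : MonotoneOn φ (Set.Icc 0 1) := fun a _ b _ hab => by
    simp only [hφ]; exact min_le_min le_rfl (by linarith)
  have o2 : MonotoneOn ψ (Set.Icc 0 1) := fun a _ b _ hab => by
    simp only [hψ]; exact max_le_max le_rfl (by linarith)
  refine pdist_le (fun t => (γ ∘ φ) t + ((δ ∘ ψ) t - y)) ?_ ?_ ?_ ?_ ?_
  · exact (h1.comp c1 m1).add ((k1.comp c2 m2).sub continuousOn_const)
  · intro t ht
    simp only [Function.comp]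
    rcases le_total t (1 / 2) with h | h
    · have : ψ t = 0 := by simp only [hψ]; exact max_eq_left (by linarith)
      rw [this, k3, sub_self, add_zero]
      exact h2 (m1 ht)
    · have : φ t = 1 := by simp only [hφ]; exact min_eq_left (by linarith)
      rw [this, h4, add_sub_cancel]
      exact k2 (m2 ht)
  · simp [hφ, hψ, h3, k3]
  · have e1 : φ 1 = 1 := by simp [hφ]
    have e2 : ψ 1 = 1 := by simp [hψ]; norm_num
    simp only [Function.comp, e1, e2, h4, k4, add_sub_cancel]
  · refine (eVar_add _ _ _ _).trans ?_
    refine (add_le_add (eVariationOn.comp_le_of_monotoneOn γ φ o1 m1)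
      (eVariationOn.comp_le_of_monotoneOn δ ψ o2 m2)).trans ?_
    refine (add_le_add h5.le k5.le).trans (le_of_eq ?_)
    rw [add_add_add_comm, ENNReal.add_halves]

/-- `pd q l x y c`: geodesic distance at most `c`. -/
def pd (q : Fin 3 → E2) (l : ℕ → ℕ) (x y : E2) (c : ℝ) : Prop :=
  0 ≤ c ∧ pdist q l x y ≤ ENNReal.ofReal c

lemma pd_symm {q : Fin 3 → E2} {l : ℕ → ℕ} {x y : E2} {c : ℝ} (h : pd q l x y c) :
    pd q l y x c := ⟨h.1, by rw [pdist_comm]; exact h.2⟩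

lemma pd_trans {q : Fin 3 → E2} {l : ℕ → ℕ} {x y z : E2} {c d : ℝ} (h : pd q l x y c)
    (h' : pd q l y z d) : pd q l x z (c + d) := by
  refine ⟨add_nonneg h.1 h'.1, (pdist_triangle q l x y z).trans ?_⟩
  rw [ENNReal.ofReal_add h.1 h'.1]
  exact add_le_add h.2 h'.2

lemma pd_mono {q : Fin 3 → E2} {l : ℕ → ℕ} {x y : E2} {c d : ℝ} (h : pd q l x y c)
    (h' : c ≤ d) : pd q l x y d := ⟨h.1.trans h', h.2.trans (ENNReal.ofReal_le_ofReal h')⟩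

lemma pd_refl {q : Fin 3 → E2} {l : ℕ → ℕ} {x : E2} (hx : x ∈ Gasket q l) : pd q l x x 0 := by
  refine ⟨le_rfl, pdist_le (fun _ => x) continuousOn_const (fun _ _ => hx) rfl rfl ?_⟩
  refine iSup_le ?_
  rintro ⟨n, u, hu, us⟩
  simp

lemma lip_var {f : ℝ → E2} {C : ℝ} (hC : 0 ≤ C) (h : ∀ s t, dist (f s) (f t) ≤ C * |s - t|) :
    eVariationOn f (Set.Icc 0 1) ≤ ENNReal.ofReal C := by
  have hL : LipschitzOnWith (Real.toNNReal C) f (Set.Icc 0 1) :=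
    (LipschitzWith.of_dist_le_mul fun s t => by
      rw [Real.coe_toNNReal _ hC, Real.dist_eq]; exact h s t).lipschitzOnWith
  have := hL.comp_eVariationOn_le (g := fun t : ℝ => t) (s := Set.Icc 0 1) (fun t ht => ht)
  have h2 : eVariationOn (fun t : ℝ => t) (Set.Icc 0 1) ≤ 1 := by
    have := (monotoneOn_id (s := Set.Icc (0 : ℝ) 1)).eVariationOn_le (a := 0) (b := 1)
      (by simp) (by simp)
    rw [Set.inter_self] at this
    refine (show eVariationOn (fun t : ℝ => t) (Set.Icc 0 1) ≤ _ from this).trans ?_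
    simp
  refine (show eVariationOn f (Set.Icc 0 1) ≤ _ from this).trans ?_
  calc _ ≤ (Real.toNNReal C : ℝ≥0∞) * 1 := by gcongr
    _ = _ := by simp [ENNReal.ofReal]

lemma pd_edge {q : Fin 3 → E2} (hq : Equi q) {l : ℕ → ℕ} (hl : ∀ m, 5 ≤ l m) (a b : Fin 3) :
    pd q l (q a) (q b) 1 := by
  refine ⟨by norm_num, ?_⟩
  set s : ℝ → ℝ := fun t => (1 - t) * (ev a).1 + t * (ev b).1 with hs
  set r : ℝ → ℝ := fun t => (1 - t) * (ev a).2 + t * (ev b).2 with hr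
  refine pdist_le (fun t => PP q (s t) (r t)) ?_ ?_ ?_ ?_ (lip_var (by norm_num) ?_)
  · simp only [PP, hs, hr]; fun_prop
  · intro t ht
    simp only [Set.mem_Icc] at ht
    apply bdry_mem q hl <;> simp only [hs, hr]
    all_goals
      rcases ev_cases a with ⟨-, h⟩ | ⟨-, h⟩ | ⟨-, h⟩ <;>
      rcases ev_cases b with ⟨-, h'⟩ | ⟨-, h'⟩ | ⟨-, h'⟩ <;> rw [h, h'] <;> push_cast <;>
      first | ring1 | linarith | nlinarith
  · rw [q_eq q a]; simp [hs, hr]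
  · rw [q_eq q b]; simp [hs, hr]
  · intro t t'
    rw [one_mul]
    apply abs_le_of_sq_le_sq' _ (abs_nonneg _) |>.2
    rw [PP_dist_sq q hq, sq_abs]
    simp only [hs, hr]
    rcases ev_cases a with ⟨-, h⟩ | ⟨-, h⟩ | ⟨-, h⟩ <;>
      rcases ev_cases b with ⟨-, h'⟩ | ⟨-, h'⟩ | ⟨-, h'⟩ <;> rw [h, h'] <;> push_cast <;>
      nlinarith [sq_nonneg (t - t')]

lemma pd_scale {q : Fin 3 → E2} {l : ℕ → ℕ} (hl : ∀ m, 5 ≤ l m) {n : ℕ} {w : ℕ → ℕ × ℕ}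
    (hw : w ∈ Wn l n) {x y : E2} {c : ℝ} (h : pd q (sh l n) x y c) :
    pd q l (wordMap q l w n x) (wordMap q l w n y) (c / Ln l n) := by
  have hL : (0 : ℝ) < Ln l n := by exact_mod_cast Ln_pos hl n
  refine ⟨div_nonneg h.1 hL.le, ?_⟩
  refine ENNReal.le_of_forall_pos_le_add fun ε hε _ => ?_
  have h1 : pdist q (sh l n) x y < ENNReal.ofReal (c + ε) :=
    h.2.trans_lt (by
      rw [ENNReal.ofReal_lt_ofReal_iff (by have := h.1; positivity)]
      have : (0 : ℝ) < ε := hε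
      linarith)
  obtain ⟨γ, h1, h2, h3, h4, h5⟩ := pdist_path h1
  refine pdist_le (wordMap q l w n ∘ γ) ((wordMap_continuous q l w n).comp_continuousOn h1)
    (fun t ht => wordMap_mem_Gasket hl hw (h2 ht)) (by simp [h3]) (by simp [h4]) ?_
  have hL2 : LipschitzOnWith (Real.toNNReal (Ln l n : ℝ)⁻¹) (wordMap q l w n) Set.univ :=
    (LipschitzWith.of_dist_le_mul fun s t => by
      rw [Real.coe_toNNReal _ (by positivity), wordMap_dist]).lipschitzOnWith
  have h6 := hL2.comp_eVariationOn_le (g := γ) (s := Set.Icc 0 1) (fun t ht => Set.mem_univ _)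
  refine h6.trans ?_
  have h7 : ((Real.toNNReal (Ln l n : ℝ)⁻¹ : NNReal) : ℝ≥0∞) * eVariationOn γ (Set.Icc 0 1) ≤
      ENNReal.ofReal ((Ln l n : ℝ)⁻¹) * ENNReal.ofReal (c + ε) := by
    rw [ENNReal.ofReal]; gcongr
  refine h7.trans ?_
  rw [← ENNReal.ofReal_mul (by positivity), mul_add,
    ENNReal.ofReal_add (by have := h.1; positivity) (by positivity)]
  refine add_le_add (by rw [div_eq_inv_mul]) ?_
  have hL1 : (1 : ℝ) ≤ Ln l n := by exact_mod_cast Ln_pos hl n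
  rw [← ENNReal.ofReal_coe_nnreal]
  apply ENNReal.ofReal_le_ofReal
  have : (Ln l n : ℝ)⁻¹ ≤ 1 := inv_le_one_of_one_le₀ hL1
  have h0 : (0 : ℝ) ≤ ε := ε.2
  nlinarith

lemma pd_chain {q : Fin 3 → E2} (hq : Equi q) {l : ℕ → ℕ} (hl : ∀ m, 5 ≤ l m) {n k : ℕ}
    {w v : ℕ → ℕ × ℕ} (hw : w ∈ Wn l n) (h : Ch (adjW q l n) k w v) (a : Fin 3) :
    v ∈ Wn l n ∧ ∃ b, pd q l (wordMap q l w n (q a)) (wordMap q l v n (q b)) (k / Ln l n) := by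
  induction k generalizing v with
  | zero =>
    obtain ⟨c, c0, ck, -⟩ := h
    obtain rfl : w = v := c0.symm.trans ck
    refine ⟨hw, a, ?_⟩
    simpa using pd_refl (vertex_mem_Cell hl hw a).1
  | succ k ih =>
    obtain ⟨c, c0, ck, hc⟩ := h
    obtain ⟨h1, b, hb⟩ := ih ⟨c, c0, rfl, fun j hj => hc j (by omega)⟩
    have h2 := hc k (by omega)
    rw [ck] at h2
    obtain ⟨j, j', e⟩ := adjW_vertex hq hl h2
    refine ⟨h2.2.1, j', ?_⟩
    rw [← e]
    have := pd_trans hb (pd_scale hl h1 (pd_edge hq (sh_five hl n) b j))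
    refine pd_mono this (le_of_eq ?_)
    push_cast; ring

lemma adjW_one {q : Fin 3 → E2} {l : ℕ → ℕ} (hl : ∀ m, 5 ≤ l m) {i i' : ℕ × ℕ}
    (h : adj1 (l 0) i i') : adjW q l 1 (single i) (single i') := by
  obtain ⟨j, j', e⟩ := adj1_vertex q h
  exact adjW_of hl (single_mem h.1) (single_mem h.2.1) (j := j) (j' := j')
    (by rw [wordMap_single, wordMap_single, e])

lemma Ln_one (l : ℕ → ℕ) : Ln l 1 = l 0 := by simp [Ln]

/-- From a corner to some vertex of a first level cell. -/
lemma pd_to_cell {q : Fin 3 → E2} (hq : Equi q) {l : ℕ → ℕ} (hl : ∀ m, 5 ≤ l m) {i : ℕ × ℕ}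
    (hi : i ∈ Sset (l 0)) (j : Fin 3) :
    ∃ b, pd q l (q j) (fmap q (l 0) i (q b)) (3 / 2 - (5 / 2) / (l 0 : ℕ)) := by
  obtain ⟨t, ht, hc⟩ := Ch_short (hl 0) (cc_mem' (hl 0) j) hi
  obtain ⟨-, b, hb⟩ := pd_chain hq hl (single_mem (cc_mem' (hl 0) j))
    (Ch_map (s := adjW q l 1) single (fun x y h => adjW_one hl h) hc) j
  rw [wordMap_single, wordMap_single, corner_fix q (hl 0), Ln_one] at hb
  refine ⟨b, pd_mono hb ?_⟩
  have h0 : (0 : ℝ) < (l 0 : ℕ) := by have := hl 0; positivity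
  have h' : 2 * (t : ℝ) + 5 ≤ 3 * (l 0 : ℕ) := by exact_mod_cast ht
  rw [div_le_iff₀ h0, sub_mul, div_mul_cancel₀ _ h0.ne']
  linarith

/-! Infinite concatenation. -/

/-- Time change used for the `m`-th piece. -/
def phi (m : ℕ) (t : ℝ) : ℝ := max 0 (min 1 (2 ^ (m + 1) * (t - 1) + 2))

lemma phi_mem (m : ℕ) (t : ℝ) : phi m t ∈ Set.Icc (0 : ℝ) 1 :=
  ⟨le_max_left _ _, max_le (by norm_num) (min_le_left _ _)⟩

lemma phi_cont (m : ℕ) : Continuous (phi m) := by unfold phi; fun_prop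

lemma phi_mono (m : ℕ) : Monotone (phi m) := fun a b hab => by
  unfold phi; gcongr

lemma phi_zero {m : ℕ} {t : ℝ} (h : 2 ^ m * (t - 1) ≤ -1) : phi m t = 0 := by
  unfold phi
  apply max_eq_left
  apply (min_le_right _ _).trans
  rw [pow_succ]; linarith

lemma phi_one {m : ℕ} {t : ℝ} (h : -1 ≤ 2 ^ (m + 1) * (t - 1)) : phi m t = 1 := by
  unfold phi
  rw [min_eq_left (by linarith)]
  norm_num

/-- Partial concatenations. -/
def pcat (γ : ℕ → ℝ → E2) (x : ℕ → E2) : ℕ → ℝ → E2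
  | 0 => fun _ => x 0
  | m + 1 => fun t => pcat γ x m t + ((γ m ∘ phi m) t - x m)

lemma pdist_series {q : Fin 3 → E2} {l : ℕ → ℕ} {x : ℕ → E2} {y : E2} {C : ℝ} (hC : 0 ≤ C)
    (hK : ∀ m, x m ∈ Gasket q l)
    (h : ∀ m, pdist q l (x m) (x (m + 1)) < ENNReal.ofReal (C * (1 / 5) ^ m))
    (hy : Tendsto x atTop (nhds y)) : pd q l (x 0) y (5 / 4 * C) := by
  choose γ h1 h2 h3 h4 h5 using fun m => pdist_path (h m)
  set P := pcat γ x with hP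
  have hS : ∀ m t, P (m + 1) t = P m t + ((γ m ∘ phi m) t - x m) := fun m t => rfl
  have hend : ∀ m t, t ≤ 1 → -1 ≤ 2 ^ m * (t - 1) → P m t = x m := by
    intro m
    induction m with
    | zero => intro t _ _; rfl
    | succ m ih =>
      intro t ht1 ht
      rw [hS, ih t ht1 (by rw [pow_succ] at ht; nlinarith [pow_pos (two_pos (α := ℝ)) m])]
      simp only [Function.comp, phi_one ht, h4, add_sub_cancel]
  have hmem : ∀ m, ∀ t ∈ Set.Icc (0 : ℝ) 1, P m t ∈ Gasket q l := by
    intro m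
    induction m with
    | zero => intro t _; exact hK 0
    | succ m ih =>
      intro t ht
      rw [hS]
      rcases le_total (2 ^ m * (t - 1)) (-1) with h' | h'
      · simp only [Function.comp, phi_zero h', h3, sub_self, add_zero]
        exact ih t ht
      · rw [hend m t ht.2 h', add_sub_cancel]
        exact h2 m (phi_mem m t)
  have hcont : ∀ m, ContinuousOn (P m) (Set.Icc 0 1) := by
    intro m
    induction m with
    | zero => exact continuousOn_const
    | succ m ih =>
      exact ih.add (((h1 m).comp (phi_cont m).continuousOn fun t _ => phi_mem m t).sub
        continuousOn_const)
  have hzero : ∀ m, P m 0 = x 0 := by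
    intro m
    induction m with
    | zero => rfl
    | succ m ih =>
      rw [hS, ih]
      have : phi m 0 = 0 := phi_zero (by
        have : (1 : ℝ) ≤ 2 ^ m := one_le_pow₀ (by norm_num)
        linarith)
      simp only [Function.comp, this, h3, sub_self, add_zero]
  have hvar : ∀ m, eVariationOn (P m) (Set.Icc 0 1) ≤
      ENNReal.ofReal (5 / 4 * C * (1 - (1 / 5) ^ m)) := by
    intro m
    induction m with
    | zero =>
      refine iSup_le ?_
      rintro ⟨n, u, hu, us⟩
      simp [hP, pcat]
    | succ m ih =>
      refine (eVar_add (P m) (γ m ∘ phi m) (x m) _).trans ?_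
      refine (add_le_add ih ((eVariationOn.comp_le_of_monotoneOn (γ m) (phi m)
        ((phi_mono m).monotoneOn _) (fun t _ => phi_mem m t)).trans (h5 m).le)).trans ?_
      have : ((1 : ℝ) / 5) ^ m ≤ 1 := pow_le_one₀ (by norm_num) (by norm_num)
      rw [← ENNReal.ofReal_add (mul_nonneg (by positivity) (by linarith)) (by positivity)]
      apply ENNReal.ofReal_le_ofReal
      rw [pow_succ]; linarith
  have hd : ∀ t m, dist (P m t) (P (m + 1) t) ≤ C * (1 / 5) ^ m := by
    intro t m
    rw [hS, dist_self_add_right]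
    have e1 := (eVariationOn.edist_le (γ m) (phi_mem m t)
      (show (0 : ℝ) ∈ Set.Icc 0 1 by simp)).trans (h5 m).le
    rw [edist_dist, ENNReal.ofReal_le_ofReal_iff (by positivity), h3, dist_eq_norm] at e1
    exact e1
  have hcau : ∀ t, ∃ z, Tendsto (fun m => P m t) atTop (nhds z) := fun t =>
    cauchySeq_tendsto_of_complete (cauchySeq_of_le_geometric (1 / 5) C (by norm_num) (hd t))
  choose F hF using hcau
  have hFd : ∀ t m, dist (P m t) (F t) ≤ C * (1 / 5) ^ m / (1 - 1 / 5) := fun t m =>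
    dist_le_of_le_geometric_of_tendsto (1 / 5) C (by norm_num) (hd t) (hF t) m
  refine ⟨by positivity, pdist_le F ?_ ?_ ?_ ?_ ?_⟩
  · have hU : TendstoUniformlyOn P F atTop (Set.Icc 0 1) := by
      rw [Metric.tendstoUniformlyOn_iff]
      intro ε hε
      have : Tendsto (fun m : ℕ => C * (1 / 5 : ℝ) ^ m / (1 - 1 / 5)) atTop (nhds 0) := by
        have := ((tendsto_pow_atTop_nhds_zero_of_lt_one (r := (1 / 5 : ℝ)) (by norm_num)
          (by norm_num)).const_mul C).div_const (1 - 1 / 5)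
        simpa using this
      filter_upwards [this.eventually_lt_const hε] with m hm t _
      rw [dist_comm]
      exact (hFd t m).trans_lt hm
    exact hU.continuousOn (Eventually.of_forall hcont).frequently
  · intro t ht
    exact (Gasket_closed q l).mem_of_tendsto (hF t) (Eventually.of_forall fun m => hmem m t ht)
  · exact tendsto_nhds_unique (hF 0) (by simp only [hzero]; exact tendsto_const_nhds)
  · refine tendsto_nhds_unique (hF 1) ?_
    have : (fun m => P m 1) = x := by funext m; exact hend m 1 le_rfl (by simp)
    rw [this]; exact hy
  · by_contra hcon
    rw [not_le] at hcon
    obtain ⟨m, hm⟩ := (eVariationOn.lowerSemicontinuous_aux (F := P) (p := atTop)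
      (fun t _ => hF t) hcon).exists
    refine absurd hm (not_lt.2 ((hvar m).trans (ENNReal.ofReal_le_ofReal ?_)))
    have : (0 : ℝ) ≤ (1 / 5) ^ m := by positivity
    nlinarith

lemma pd_crude {q : Fin 3 → E2} (hq : Equi q) {l : ℕ → ℕ} (hl : ∀ m, 5 ≤ l m) {x : E2}
    (hx : x ∈ Gasket q l) : pd q l (q 0) x (5 / 2) := by
  have hstep : ∀ m : ℕ, ∀ z ∈ Gasket q (sh l m), ∃ z' i, z' ∈ Gasket q (sh l (m + 1)) ∧
      i ∈ Sset (l m) ∧ fmap q (l m) i z' = z := by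
    intro m z hz
    obtain ⟨w, hw, z', hz', e⟩ := exists_word (sh_five hl m) 1 hz
    have h0 : sh l m 0 = l m := by simp [sh]
    refine ⟨z', w 0, by rw [sh_sh] at hz'; exact hz', ?_, ?_⟩
    · rw [← h0]; exact hw.1 0 (by omega)
    · rw [eq_single hw, wordMap_single, h0] at e; exact e
  choose! Z I hZ hI hfm using hstep
  let z : ℕ → E2 := fun m => Nat.rec x (fun m z => Z m z) m
  have hz0 : z 0 = x := rfl
  have hzs : ∀ m, z (m + 1) = Z m (z m) := fun m => rfl
  have hzK : ∀ m, z m ∈ Gasket q (sh l m) := by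
    intro m
    induction m with
    | zero => rw [hz0, sh_zero]; exact hx
    | succ m ih => rw [hzs]; exact hZ m _ ih
  set W : ℕ → ℕ × ℕ := fun m => I m (z m) with hW
  have hWS : ∀ m, W m ∈ Sset (l m) := fun m => hI m _ (hzK m)
  have hWz : ∀ m, fmap q (l m) (W m) (z (m + 1)) = z m := fun m => hfm m _ (hzK m)
  have hx' : ∀ m, wordMap q l W m (z m) = x := by
    intro m
    induction m with
    | zero => rfl
    | succ m ih =>
      simp only [wordMap, Function.comp]
      rw [hWz, ih]
  have hpre : ∀ m, wordMap q l W m = wordMap q l (pre m W) m := fun m =>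
    wordMap_congr q l m (fun k hk => by simp [pre, hk])
  have hpm : ∀ m, pre m W ∈ Wn l m := fun m =>
    ⟨fun k hk => by simp only [pre, hk, if_true]; exact hWS k,
     fun k hk => by simp [pre, not_lt.2 hk]⟩
  have h5 : ∀ m, ((Ln l m : ℕ) : ℝ)⁻¹ ≤ (1 / 5) ^ m := by
    intro m
    have : (5 : ℝ) ^ m ≤ Ln l m := by exact_mod_cast five_pow_le hl m
    rw [one_div, inv_pow]
    exact inv_anti₀ (by positivity) this
  have := pdist_series (q := q) (l := l) (x := fun m => wordMap q l W m (q 0)) (y := x) (C := 2)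
    (by norm_num) ?_ ?_ ?_
  · exact pd_mono this (by norm_num)
  · intro m
    simp only [hpre]
    exact wordMap_mem_Gasket hl (hpm m) (q_mem q (sh_five hl m) 0)
  · intro m
    simp only [hpre m, show wordMap q l W (m + 1) = wordMap q l W m ∘ fmap q (l m) (W m) from rfl,
      Function.comp]
    have h0 : sh l m 0 = l m := by simp [sh]
    obtain ⟨b, hb⟩ := pd_to_cell hq (sh_five hl m) (i := W m) (by rw [h0]; exact hWS m) 0
    rw [h0] at hb
    have hL : (0 : ℝ) < (l m : ℕ) := by have := hl m; positivity
    have hbb : pd q (sh l m) (fmap q (l m) (W m) (q b)) (fmap q (l m) (W m) (q 0))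
        (1 / (l m : ℕ)) := by
      have := pd_scale (sh_five hl m) (single_mem (l := sh l m) (i := W m)
        (by rw [h0]; exact hWS m)) (pd_edge hq (sh_five (sh_five hl m) 1) b 0)
      rwa [wordMap_single, Ln_one, h0] at this
    have h' := pd_scale hl (hpm m) (pd_trans hb hbb)
    refine h'.2.trans_lt ?_
    rw [ENNReal.ofReal_lt_ofReal_iff (by positivity), div_eq_mul_inv]
    have e : (3 / 2 - 5 / 2 / ((l m : ℕ) : ℝ) + 1 / (l m : ℕ)) ≤ 3 / 2 := by
      have : (5 / 2 / ((l m : ℕ) : ℝ)) = 5 / 2 * (1 / (l m : ℕ)) := by ring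
      have h8 : 0 < 1 / ((l m : ℕ) : ℝ) := by positivity
      linarith
    have h9 : (0 : ℝ) < ((Ln l m : ℕ) : ℝ)⁻¹ := by
      have := Ln_pos hl m; positivity
    have := h5 m
    nlinarith
  · rw [tendsto_iff_dist_tendsto_zero]
    refine squeeze_zero (fun _ => dist_nonneg) (g := fun m : ℕ => (1 / 5 : ℝ) ^ m) ?_
      (tendsto_pow_atTop_nhds_zero_of_lt_one (by norm_num) (by norm_num))
    intro m
    conv_lhs => rw [← hx' m]
    rw [wordMap_dist]
    have := Tri_dist hq (q_mem_Tri q 0) (Gasket_sub_Tri q _ (hzK m))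
    refine (mul_le_of_le_one_right (by positivity) this).trans (h5 m)

lemma pd_improve {q : Fin 3 → E2} (hq : Equi q) {l : ℕ → ℕ} (hl : ∀ m, 5 ≤ l m) {B : ℝ}
    (hB : ∀ z ∈ Gasket q (sh l 1), ∀ b, pd q (sh l 1) (q b) z B) {x : E2}
    (hx : x ∈ Gasket q l) (j : Fin 3) :
    pd q l (q j) x (3 / 2 - (5 / 2) / (l 0 : ℕ) + B / (l 0 : ℕ)) := by
  obtain ⟨w, hw, z, hz, rfl⟩ := exists_word hl 1 hx
  have hi := hw.1 0 (by omega)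
  obtain ⟨b, hb⟩ := pd_to_cell hq hl hi j
  have h2 := pd_scale hl hw (hB z hz b)
  rw [eq_single hw, wordMap_single, Ln_one] at h2
  rw [eq_single hw, wordMap_single]
  exact pd_trans hb h2

lemma pd_32 {q : Fin 3 → E2} (hq : Equi q) {l : ℕ → ℕ} (hl : ∀ m, 5 ≤ l m) {x : E2}
    (hx : x ∈ Gasket q l) (j : Fin 3) : pd q l (q j) x (3 / 2) := by
  have h72 : ∀ l' : ℕ → ℕ, (∀ m, 5 ≤ l' m) → ∀ z ∈ Gasket q l', ∀ b, pd q l' (q b) z (7 / 2) :=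
    fun l' hl' z hz b => pd_mono (pd_trans (pd_edge hq hl' b 0) (pd_crude hq hl' hz)) (by norm_num)
  have h2 : ∀ l' : ℕ → ℕ, (∀ m, 5 ≤ l' m) → ∀ z ∈ Gasket q l', ∀ b, pd q l' (q b) z (5 / 2) := by
    intro l' hl' z hz b
    refine pd_mono (pd_improve hq hl' (h72 _ (sh_five hl' 1)) hz b) ?_
    have : (5 : ℝ) ≤ (l' 0 : ℕ) := by exact_mod_cast hl' 0
    have h0 : (0 : ℝ) < (l' 0 : ℕ) := by linarith
    rw [sub_add, ← sub_div, sub_le_iff_le_add, ← sub_le_iff_le_add', le_div_iff₀ h0]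
    linarith
  refine pd_mono (pd_improve hq hl (h2 _ (sh_five hl 1)) hx j) (le_of_eq (by ring))

lemma pd_strict {q : Fin 3 → E2} (hq : Equi q) {l : ℕ → ℕ} (hl : ∀ m, 5 ≤ l m) {x : E2}
    (hx : x ∈ Gasket q l) (j : Fin 3) : pd q l (q j) x (3 / 2 - 1 / (l 0 : ℕ)) :=
  pd_mono (pd_improve hq hl (fun z hz b => pd_32 hq (sh_five hl 1) hz b) hx j)
    (le_of_eq (by ring))

lemma gdist_upper {q : Fin 3 → E2} (hq : Equi q) {l : ℕ → ℕ} (hl : ∀ m, 5 ≤ l m) {n : ℕ}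
    {w : ℕ → ℕ × ℕ} (hw : w ∈ Wn l n) {k : ℕ} (hk : 1 ≤ k) {x y : E2}
    (hx : x ∈ Cell q l n w) (hy : y ∈ Unwk q l n w k) :
    gdist q l x y < ((k : ℝ) + 2) / (Ln l n : ℝ) := by
  obtain ⟨v, hv, hyv⟩ := Set.mem_iUnion₂.1 hy
  have hvW : v ∈ Wn l n := hv.1
  obtain ⟨c, c0, ck, hc⟩ := Lam_Ch hv
  obtain ⟨k, rfl⟩ : ∃ k', k = k' + 1 := ⟨k - 1, by omega⟩
  have h0 := hc 0 (by omega)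
  obtain ⟨a, a', e⟩ := adjW_vertex hq hl h0
  obtain ⟨-, b, hb⟩ := pd_chain hq hl (k := k) (v := v) h0.2.1
    ⟨fun j => c (j + 1), rfl, ck, fun j hj => hc (j + 1) (by omega)⟩ a'
  rw [Cell_eq hq hl hw] at hx
  rw [Cell_eq hq hl hvW] at hyv
  obtain ⟨z, hz, rfl⟩ := hx
  obtain ⟨z', hz', rfl⟩ := hyv
  have A := pd_scale hl hw (pd_symm (pd_strict hq (sh_five hl n) hz a))
  have B := pd_scale hl hvW (pd_strict hq (sh_five hl n) hz' b)
  rw [c0] at e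
  rw [← e] at hb
  have T := pd_trans A (pd_trans hb B)
  refine (ENNReal.toReal_le_of_le_ofReal T.1 T.2).trans_lt ?_
  have hL : (0 : ℝ) < Ln l n := by exact_mod_cast Ln_pos hl n
  rw [← add_div, ← add_div]
  apply div_lt_div_of_pos_right _ hL
  have : (0 : ℝ) < 1 / ((sh l n 0 : ℕ) : ℝ) := by have := sh_five hl n 0; positivity
  push_cast
  linarith

lemma pdist_fin {q : Fin 3 → E2} (hq : Equi q) {l : ℕ → ℕ} (hl : ∀ m, 5 ≤ l m) {x y : E2}
    (hx : x ∈ Gasket q l) (hy : y ∈ Gasket q l) : pdist q l x y ≠ ⊤ :=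
  ((pd_trans (pd_symm (pd_32 hq hl hx 0)) (pd_32 hq hl hy 0)).2.trans_lt ENNReal.ofReal_lt_top).ne

/-! ## Gluing functions along cells -/

open Classical in
/-- Glue functions `u w` (in local coordinates) along the cells of level `n`. -/
def glueW (q : Fin 3 → E2) (l : ℕ → ℕ) (n : ℕ) (u : (ℕ → ℕ × ℕ) → E2 → ℝ) (x : E2) : ℝ :=
  if h : ∃ p : (ℕ → ℕ × ℕ) × E2, p.1 ∈ Wn l n ∧ p.2 ∈ Gasket q (sh l n) ∧
    wordMap q l p.1 n p.2 = x then u h.choose.1 h.choose.2 else 0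

/-- Compatibility at shared vertices. -/
def Compat (q : Fin 3 → E2) (l : ℕ → ℕ) (n : ℕ) (u : (ℕ → ℕ × ℕ) → E2 → ℝ) : Prop :=
  ∀ w ∈ Wn l n, ∀ v ∈ Wn l n, ∀ j j', wordMap q l w n (q j) = wordMap q l v n (q j') →
    u w (q j) = u v (q j')

lemma glue_spec {q : Fin 3 → E2} (hq : Equi q) {l : ℕ → ℕ} (hl : ∀ m, 5 ≤ l m) {n : ℕ}
    {u : (ℕ → ℕ × ℕ) → E2 → ℝ} (hu : Compat q l n u) {w : ℕ → ℕ × ℕ} (hw : w ∈ Wn l n) {z : E2}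
    (hz : z ∈ Gasket q (sh l n)) : glueW q l n u (wordMap q l w n z) = u w z := by
  have h : ∃ p : (ℕ → ℕ × ℕ) × E2, p.1 ∈ Wn l n ∧ p.2 ∈ Gasket q (sh l n) ∧
    wordMap q l p.1 n p.2 = wordMap q l w n z := ⟨(w, z), hw, hz, rfl⟩
  rw [glueW, dif_pos h]
  obtain ⟨h1, h2, h3⟩ := h.choose_spec
  generalize h.choose = p at h1 h2 h3 ⊢
  by_cases hne : p.1 = w
  · rw [hne] at h3 ⊢
    rw [wordMap_inj q l hl w n h3]
  · obtain ⟨j, j', e, e'⟩ := cell_inter q hq hl n h1 hw hne (Gasket_sub_Tri q _ h2)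
      (Gasket_sub_Tri q _ hz) h3
    rw [e, e'] at h3 ⊢
    exact hu _ h1 _ hw _ _ h3

lemma glue_cont {q : Fin 3 → E2} (hq : Equi q) {l : ℕ → ℕ} (hl : ∀ m, 5 ≤ l m) {n : ℕ}
    {u : (ℕ → ℕ × ℕ) → E2 → ℝ} (hu : Compat q l n u)
    (hc : ∀ w ∈ Wn l n, ContinuousOn (u w) (Gasket q (sh l n))) :
    ContinuousOn (glueW q l n u) (Gasket q l) := by
  intro x hx
  obtain ⟨δ, hδ, hcov⟩ := local_cover hl n x (q := q)
  rw [Metric.continuousWithinAt_iff]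
  intro ε hε
  have hex : ∀ w ∈ Wn l n, ∃ η > 0, x ∈ Cell q l n w → ∀ y ∈ Cell q l n w, dist y x < η →
      dist (glueW q l n u y) (glueW q l n u x) < ε := by
    intro w hw
    by_cases hxw : x ∈ Cell q l n w
    · have hxw' := hxw
      rw [Cell_eq hq hl hw] at hxw'
      obtain ⟨z, hz, rfl⟩ := hxw'
      have h1 := hc w hw z hz
      rw [Metric.continuousWithinAt_iff] at h1
      obtain ⟨η, hη, h2⟩ := h1 ε hε
      have hL : (0 : ℝ) < Ln l n := by exact_mod_cast Ln_pos hl n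
      refine ⟨(Ln l n : ℝ)⁻¹ * η, by positivity, fun _ y hy hd => ?_⟩
      rw [Cell_eq hq hl hw] at hy
      obtain ⟨z', hz', rfl⟩ := hy
      rw [glue_spec hq hl hu hw hz, glue_spec hq hl hu hw hz']
      apply h2 hz'
      rw [wordMap_dist] at hd
      exact lt_of_mul_lt_mul_left hd (by positivity)
    · exact ⟨1, one_pos, fun h => absurd h hxw⟩
  choose! η hη hh using hex
  have hmin : ∃ η₀ > 0, ∀ w ∈ Wn l n, η₀ ≤ η w := by
    rcases (Wn_finite l n).toFinset.eq_empty_or_nonempty with he | hne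
    · refine ⟨1, one_pos, fun w hw => ?_⟩
      have : w ∈ (Wn_finite l n).toFinset := by simpa using hw
      rw [he] at this; simp at this
    · obtain ⟨w0, hw0, hm⟩ := Finset.exists_min_image _ η hne
      refine ⟨η w0, hη w0 (by simpa using hw0), fun w hw => hm w (by simpa using hw)⟩
  obtain ⟨η₀, hη₀, hle⟩ := hmin
  refine ⟨min δ η₀, lt_min hδ hη₀, fun y hy hd => ?_⟩
  obtain ⟨w, hw, hxw, hyw⟩ := hcov y hy (hd.trans_le (min_le_left _ _))
  exact hh w hw hxw y hyw (hd.trans_le ((min_le_right _ _).trans (hle w hw)))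

/-! ## Lower bound for the geodesic distance -/

lemma path_lip {γ : ℝ → E2} {ψ : ℝ → ℝ} {L : ℝ} (hL : 0 ≤ L)
    (hv : eVariationOn γ (Set.Icc 0 1) ≠ ⊤)
    (hloc : ∀ t ∈ Set.Icc (0 : ℝ) 1, ∃ ε > 0, ∀ s ∈ Set.Icc (0 : ℝ) 1, |s - t| < ε →
      |ψ s - ψ t| ≤ L * dist (γ s) (γ t)) :
    ψ 1 - ψ 0 ≤ L * (eVariationOn γ (Set.Icc 0 1)).toReal := by
  set V : ℝ → ℝ := fun t => (eVariationOn γ (Set.Icc 0 t)).toReal with hV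
  have hfin : ∀ t ≤ 1, eVariationOn γ (Set.Icc 0 t) ≠ ⊤ := fun t ht =>
    ((eVariationOn.mono γ (Set.Icc_subset_Icc_right ht)).trans_lt hv.lt_top).ne
  have hadd : ∀ s t, 0 ≤ s → s ≤ t → t ≤ 1 → V s + dist (γ s) (γ t) ≤ V t := by
    intro s t hs hst ht
    have h1 := eVariationOn.Icc_add_Icc γ (s := Set.univ) hs hst (Set.mem_univ s)
    simp only [Set.univ_inter] at h1
    have h2 : eVariationOn γ (Set.Icc 0 s) + edist (γ s) (γ t) ≤ eVariationOn γ (Set.Icc 0 t) := by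
      rw [← h1]
      exact add_le_add le_rfl (eVariationOn.edist_le γ ⟨le_rfl, hst⟩ ⟨hst, le_rfl⟩)
    have h3 := ENNReal.toReal_mono (hfin t ht) h2
    rw [ENNReal.toReal_add (hfin s (hst.trans ht)) (edist_ne_top _ _), edist_dist,
      ENNReal.toReal_ofReal dist_nonneg] at h3
    exact h3
  set S : Set ℝ := {t | t ∈ Set.Icc (0 : ℝ) 1 ∧ ψ t - ψ 0 ≤ L * V t} with hS
  have h0 : (0 : ℝ) ∈ S := ⟨by simp, by simp only [sub_self]; positivity⟩
  have hbd : BddAbove S := ⟨1, fun t ht => ht.1.2⟩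
  set T := sSup S with hT
  have hT0 : 0 ≤ T := le_csSup hbd h0
  have hT1 : T ≤ 1 := csSup_le ⟨0, h0⟩ fun t ht => ht.1.2
  obtain ⟨ε, hε, hl⟩ := hloc T ⟨hT0, hT1⟩
  obtain ⟨s, hs, hsT⟩ := exists_lt_of_lt_csSup ⟨0, h0⟩ (show T - ε < sSup S by rw [← hT]; linarith)
  have hs' : s ≤ T := le_csSup hbd hs
  have hTS : ψ T - ψ 0 ≤ L * V T := by
    have h1 := hl s hs.1 (by rw [abs_lt]; constructor <;> linarith)
    have h2 := hadd s T hs.1.1 hs' hT1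
    have h3 := hs.2
    have h4 := (abs_le.1 h1).1
    nlinarith [mul_le_mul_of_nonneg_left h2 hL]
  set t := min 1 (T + ε / 2) with ht
  have htT : T ≤ t := le_min hT1 (by linarith)
  have ht1 : t ≤ 1 := min_le_left _ _
  have htS : t ∈ S := by
    refine ⟨⟨hT0.trans htT, ht1⟩, ?_⟩
    have h1 := hl t ⟨hT0.trans htT, ht1⟩ (by
      rw [abs_lt]
      have : t ≤ T + ε / 2 := min_le_right _ _
      constructor <;> linarith)
    have h2 := hadd T t hT0 htT ht1
    have h4 := (abs_le.1 h1).2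
    rw [dist_comm] at h4
    nlinarith [mul_le_mul_of_nonneg_left h2 hL]
  have : t ≤ T := le_csSup hbd htS
  have hT' : T = 1 := by
    rcases min_cases 1 (T + ε / 2) with ⟨h, -⟩ | ⟨h, -⟩
    · rw [← ht] at h; linarith
    · rw [← ht] at h; linarith
  rw [hT'] at hTS
  exact hTS

open Classical in
/-- Number of neighbourhoods not containing `p`. -/
def hgt (q : Fin 3 → E2) (l : ℕ → ℕ) (n : ℕ) (w : ℕ → ℕ × ℕ) (k : ℕ) (p : E2) : ℝ :=
  (((Finset.range k).filter fun j => p ∉ Unwk q l n w j).card : ℝ)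

lemma w_mem_Lam {q : Fin 3 → E2} {l : ℕ → ℕ} (hl : ∀ m, 5 ≤ l m) {n : ℕ} {w : ℕ → ℕ × ℕ}
    (hw : w ∈ Wn l n) (j : ℕ) : w ∈ Lam q l n w j :=
  Ch_Lam hw (Ch_mono hl hw (Nat.zero_le j) (Ch_zero _ w))

lemma U_step {q : Fin 3 → E2} {l : ℕ → ℕ} {n : ℕ} {w v : ℕ → ℕ × ℕ}
    (hw : w ∈ Wn l n) (hv : v ∈ Wn l n) {j : ℕ} {p : E2} (hp : p ∈ Unwk q l n w j)
    (hpv : p ∈ Cell q l n v) : v ∈ Lam q l n w (j + 1) := by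
  obtain ⟨v', hv', hp'⟩ := Set.mem_iUnion₂.1 hp
  exact Ch_Lam hw (Ch_trans (Lam_Ch hv') (Ch_one ⟨hv'.1, hv, p, hp', hpv⟩))

lemma hgt_step {q : Fin 3 → E2} {l : ℕ → ℕ} {n : ℕ} {w v : ℕ → ℕ × ℕ}
    (hw : w ∈ Wn l n) (hv : v ∈ Wn l n) (k : ℕ) {p p' : E2} (hp : p ∈ Cell q l n v)
    (hp' : p' ∈ Cell q l n v) : hgt q l n w k p' ≤ hgt q l n w k p + 1 := by
  classical
  unfold hgt
  have : ((Finset.range k).filter fun j => p' ∉ Unwk q l n w j) ⊆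
      insert 0 (((Finset.range k).filter fun j => p ∉ Unwk q l n w j).image Nat.succ) := by
    intro j hj
    simp only [Finset.mem_filter, Finset.mem_range] at hj
    rw [Finset.mem_insert]
    rcases Nat.eq_zero_or_pos j with h | h
    · exact Or.inl h
    · right
      rw [Finset.mem_image]
      obtain ⟨j', rfl⟩ : ∃ j', j = j' + 1 := ⟨j - 1, by omega⟩
      refine ⟨j', ?_, rfl⟩
      simp only [Finset.mem_filter, Finset.mem_range]
      refine ⟨by omega, fun h' => hj.2 ?_⟩
      exact Set.mem_iUnion₂.2 ⟨v, U_step hw hv h' hp, hp'⟩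
  have h2 := (Finset.card_le_card this).trans ((Finset.card_insert_le _ _).trans
    (Nat.add_le_add_right Finset.card_image_le 1))
  exact_mod_cast h2

lemma hgt_zero {q : Fin 3 → E2} {l : ℕ → ℕ} (hl : ∀ m, 5 ≤ l m) {n : ℕ} {w : ℕ → ℕ × ℕ}
    (hw : w ∈ Wn l n) (k : ℕ) {p : E2} (hp : p ∈ Cell q l n w) : hgt q l n w k p = 0 := by
  classical
  unfold hgt
  rw [Finset.filter_eq_empty_iff.2]
  · simp
  · intro j _ h
    exact h (Set.mem_iUnion₂.2 ⟨w, w_mem_Lam hl hw j, hp⟩)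

lemma hgt_full {q : Fin 3 → E2} {l : ℕ → ℕ} (hl : ∀ m, 5 ≤ l m) {n : ℕ} {w v : ℕ → ℕ × ℕ}
    (hw : w ∈ Wn l n) (hv : v ∈ Wn l n) {k : ℕ} (hvk : v ∉ Lam q l n w k) {p : E2}
    (hp : p ∈ Cell q l n v) : hgt q l n w k p = k := by
  classical
  unfold hgt
  rw [Finset.filter_true_of_mem]
  · simp
  · intro j hj h
    rw [Finset.mem_range] at hj
    exact hvk (Ch_Lam hw (Ch_mono hl hv hj (Lam_Ch (U_step hw hv h hp))))

open Classical in
/-- Local pieces of the Lipschitz function. -/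
def pieceU (q : Fin 3 → E2) (l : ℕ → ℕ) (n : ℕ) (w : ℕ → ℕ × ℕ) (k : ℕ) (v : ℕ → ℕ × ℕ)
    (z : E2) : ℝ :=
  if v = w then 0 else
    min (hgt q l n w k (wordMap q l v n (q 0)) + dist z (q 0))
      (min (hgt q l n w k (wordMap q l v n (q 1)) + dist z (q 1))
        (hgt q l n w k (wordMap q l v n (q 2)) + dist z (q 2)))

lemma pieceU_lip (q : Fin 3 → E2) (l : ℕ → ℕ) (n : ℕ) (w : ℕ → ℕ × ℕ) (k : ℕ) (v : ℕ → ℕ × ℕ)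
    (z z' : E2) : |pieceU q l n w k v z - pieceU q l n w k v z'| ≤ dist z z' := by
  unfold pieceU
  split_ifs with h
  · simp
  · have key : ∀ (a : ℝ) (p : E2), |(a + dist z p) - (a + dist z' p)| ≤ dist z z' := by
      intro a p
      rw [add_sub_add_left_eq_sub]
      exact abs_dist_sub_le z z' p
    refine (abs_min_sub_min_le_max _ _ _ _).trans (max_le (key _ _) ?_)
    exact (abs_min_sub_min_le_max _ _ _ _).trans (max_le (key _ _) (key _ _))

lemma pieceU_vertex {q : Fin 3 → E2} (hq : Equi q) {l : ℕ → ℕ} (hl : ∀ m, 5 ≤ l m) {n : ℕ}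
    {w v : ℕ → ℕ × ℕ} (hw : w ∈ Wn l n) (hv : v ∈ Wn l n) (k : ℕ) (j : Fin 3) :
    pieceU q l n w k v (q j) = hgt q l n w k (wordMap q l v n (q j)) := by
  unfold pieceU
  split_ifs with h
  · subst h
    exact (hgt_zero hl hw k (vertex_mem_Cell hl hw j)).symm
  · have hs : ∀ j j' : Fin 3, hgt q l n w k (wordMap q l v n (q j)) ≤
        hgt q l n w k (wordMap q l v n (q j')) + dist (q j) (q j') := by
      intro j j'
      by_cases hj : j = j'
      · subst hj; simp
      · rw [hq j j' hj]
        exact hgt_step hw hv k (vertex_mem_Cell hl hv j') (vertex_mem_Cell hl hv j)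
    apply le_antisymm
    · have : j = 0 ∨ j = 1 ∨ j = 2 := by fin_cases j <;> simp
      rcases this with h | h | h <;> subst h
      · exact (min_le_left _ _).trans (by simp)
      · exact (min_le_right _ _).trans ((min_le_left _ _).trans (by simp))
      · exact (min_le_right _ _).trans ((min_le_right _ _).trans (by simp))
    · exact le_min (hs _ _) (le_min (hs _ _) (hs _ _))

lemma gdist_lower {q : Fin 3 → E2} (hq : Equi q) {l : ℕ → ℕ} (hl : ∀ m, 5 ≤ l m) {n : ℕ}
    {w : ℕ → ℕ × ℕ} (hw : w ∈ Wn l n) {k : ℕ} {x y : E2}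
    (hx : x ∈ Cell q l n w) (hy : y ∈ Gasket q l \ Unwk q l n w k) :
    (k : ℝ) / (Ln l n : ℝ) ≤ gdist q l x y := by
  have hL : (0 : ℝ) < Ln l n := by exact_mod_cast Ln_pos hl n
  have hcomp : Compat q l n (pieceU q l n w k) := by
    intro v hv v' hv' j j' e
    rw [pieceU_vertex hq hl hw hv, pieceU_vertex hq hl hw hv', e]
  set φ := glueW q l n (pieceU q l n w k) with hφ
  have hφx : φ x = 0 := by
    have hx' := hx
    rw [Cell_eq hq hl hw] at hx'
    obtain ⟨z, hz, rfl⟩ := hx'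
    rw [hφ, glue_spec hq hl hcomp hw hz]
    simp [pieceU]
  have hφy : (k : ℝ) ≤ φ y := by
    obtain ⟨v, hv, hyv⟩ := exists_Cell hl n hy.1
    have hvk : v ∉ Lam q l n w k := fun h => hy.2 (Set.mem_iUnion₂.2 ⟨v, h, hyv⟩)
    have hvw : v ≠ w := fun h => hvk (by rw [h]; exact w_mem_Lam hl hw k)
    rw [Cell_eq hq hl hv] at hyv
    obtain ⟨z, hz, rfl⟩ := hyv
    rw [hφ, glue_spec hq hl hcomp hv hz, pieceU, if_neg hvw]
    simp only [hgt_full hl hw hv hvk (vertex_mem_Cell hl hv _)]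
    refine le_min ?_ (le_min ?_ ?_) <;> linarith [dist_nonneg (x := z) (y := q 0),
      dist_nonneg (x := z) (y := q 1), dist_nonneg (x := z) (y := q 2)]
  have hcell : ∀ v ∈ Wn l n, ∀ p ∈ Cell q l n v, ∀ p' ∈ Cell q l n v,
      |φ p - φ p'| ≤ Ln l n * dist p p' := by
    intro v hv p hp p' hp'
    rw [Cell_eq hq hl hv] at hp hp'
    obtain ⟨z, hz, rfl⟩ := hp
    obtain ⟨z', hz', rfl⟩ := hp'
    rw [hφ, glue_spec hq hl hcomp hv hz, glue_spec hq hl hcomp hv hz', wordMap_dist,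
      mul_inv_cancel_left₀ hL.ne']
    exact pieceU_lip _ _ _ _ _ _ _ _
  have hmain : ENNReal.ofReal ((k : ℝ) / Ln l n) ≤ pdist q l x y := by
    refine le_of_forall_gt_imp_ge_of_dense fun a ha => ?_
    obtain ⟨γ, h1, h2, h3, h4, h5⟩ := pdist_path ha
    refine le_trans ?_ h5.le
    by_cases hv : eVariationOn γ (Set.Icc 0 1) = ⊤
    · rw [hv]; exact le_top
    apply ENNReal.ofReal_le_of_le_toReal
    have := path_lip (γ := γ) (ψ := φ ∘ γ) hL.le hv (by
      intro t ht
      obtain ⟨δ, hδ, hcov⟩ := local_cover hl n (γ t) (q := q)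
      obtain ⟨ε, hε, hcont⟩ := Metric.continuousWithinAt_iff.1 (h1 t ht) δ hδ
      refine ⟨ε, hε, fun s hs hd => ?_⟩
      obtain ⟨v, hv, e1, e2⟩ := hcov (γ s) (h2 hs) (hcont hs hd)
      exact hcell v hv _ e2 _ e1)
    simp only [Function.comp, h3, h4, hφx] at this
    rw [div_le_iff₀ hL]
    linarith
  have hfin := pdist_fin hq hl hx.1 hy.1
  exact (ENNReal.ofReal_le_iff_le_toReal hfin).1 hmain

/-! ## Harmonic extension -/

lemma EN_congr {q : Fin 3 → E2} {l : ℕ → ℕ} (hl : ∀ m, 5 ≤ l m) (m : ℕ) {u u' : E2 → ℝ}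
    (h : ∀ x ∈ Gasket q l, u x = u' x) : EN q l m u = EN q l m u' := by
  unfold EN
  congr 1
  refine Finset.sum_congr rfl fun w hw => ?_
  have hj : ∀ j, u (wordMap q l w m (q j)) = u' (wordMap q l w m (q j)) := fun j =>
    h _ (wordMap_mem_Gasket hl (mem_WF.1 hw) (q_mem q (sh_five hl m) j))
  simp only [e0, Function.comp, hj]

lemma compat_of {q : Fin 3 → E2} (hq : Equi q) {l : ℕ → ℕ} (hl : ∀ m, 5 ≤ l m) {n : ℕ}
    {u : (ℕ → ℕ × ℕ) → E2 → ℝ} (g : ℕ × ℕ → ℝ)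
    (h : ∀ w ∈ Wn l n, ∀ j, u w (q j) = g (pos l w n + ev j)) : Compat q l n u := by
  intro w hw v hv j j' e
  rw [h w hw, h v hv, (vertex_eq_iff q hq hl n j j').1 e]

lemma pos_one (l : ℕ → ℕ) (w : ℕ → ℕ × ℕ) : pos l w 1 = w 0 := by
  simp [pos]

/-- Glueing with energy bounds. -/
lemma glue_energy {q : Fin 3 → E2} (hq : Equi q) {l : ℕ → ℕ} (hl : ∀ m, 5 ≤ l m) {n : ℕ}
    {u : (ℕ → ℕ × ℕ) → E2 → ℝ} (hu : Compat q l n u) {c : (ℕ → ℕ × ℕ) → ℝ}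
    (hc : ∀ w ∈ Wn l n, ∀ m, EN q (sh l n) m (u w) ≤ c w) (m : ℕ) :
    EN q l m (glueW q l n u) ≤ (Rn l n)⁻¹ * ∑ w ∈ WF l n, c w := by
  refine (EN_mono q hl _ (Nat.le_add_left m n)).trans ?_
  show EN q l (n + m) _ ≤ _
  rw [EN_add]
  refine mul_le_mul_of_nonneg_left (Finset.sum_le_sum fun w hw => ?_)
    (inv_nonneg.2 (Rn_pos l n).le)
  have hw' := mem_WF.1 hw
  rw [EN_congr (sh_five hl n) m (u := glueW q l n u ∘ wordMap q l w n) (u' := u w)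
    (fun z hz => glue_spec hq hl hu hw' hz)]
  exact hc w hw' m

/-- Boundary values of the harmonic extension on the cell `i`. -/
def ext3 (l : ℕ) (v : Fin 3 → ℝ) (i : ℕ × ℕ) : Fin 3 → ℝ := fun j =>
  hU l v (i + ev j).1 (i + ev j).2

/-- Energy of boundary values. -/
def ee (v : Fin 3 → ℝ) : ℝ := e3 (v 0) (v 1) (v 2)

lemma ee_nonneg (v : Fin 3 → ℝ) : 0 ≤ ee v := e3_nonneg _ _ _

lemma ext3_e (l : ℕ) (v : Fin 3 → ℝ) (i : ℕ × ℕ) : ee (ext3 l v i) = eU (hU l v) i := by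
  simp [ee, ext3, ev, eU]

lemma ext3_sum {l : ℕ} (hl : 5 ≤ l) (v : Fin 3 → ℝ) :
    ∑ i ∈ SF l, ee (ext3 l v i) = rl l * ee v := by
  simp only [ext3_e]; exact hU_energy hl v

lemma ext3_le {l : ℕ} (hl : 5 ≤ l) (v : Fin 3 → ℝ) {i : ℕ × ℕ} (hi : i ∈ Sset l) :
    ee (ext3 l v i) ≤ (2 / 3) ^ 2 * ee v := by
  have h1 := Finset.single_le_sum (f := fun i => ee (ext3 l v i)) (fun i _ => ee_nonneg _)
    (mem_SF.2 hi)
  simp only [ext3_sum hl v] at h1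
  nlinarith [rl_le hl, ee_nonneg v]

lemma ext3_corner {l : ℕ} (hl : 5 ≤ l) (v : Fin 3 → ℝ) (j : Fin 3) :
    ext3 l v (cc (l - 2) j) j = v j := by
  obtain ⟨h0, h1, h2⟩ := hU_zero hl v
  have : l - 2 + 1 + 1 = l := by omega
  fin_cases j <;> simp [ext3, cc, ev, h0, h1, h2, this]

/-- Approximations of the harmonic extension. -/
def GG (q : Fin 3 → E2) : ℕ → (ℕ → ℕ) → (Fin 3 → ℝ) → E2 → ℝ
  | 0, _, v, z => v 0 + (v 1 - v 0) * max 0 (1 - dist z (q 1)) +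
      (v 2 - v 0) * max 0 (1 - dist z (q 2))
  | m + 1, l, v, z => glueW q l 1 (fun w => GG q m (sh l 1) (ext3 (l 0) v (w 0))) z

lemma GG_succ (q : Fin 3 → E2) (m : ℕ) (l : ℕ → ℕ) (v : Fin 3 → ℝ) :
    GG q (m + 1) l v = glueW q l 1 (fun w => GG q m (sh l 1) (ext3 (l 0) v (w 0))) := rfl

lemma GG_compat {q : Fin 3 → E2} (hq : Equi q) {m : ℕ}
    (h : ∀ {l : ℕ → ℕ}, (∀ m, 5 ≤ l m) → ∀ v j, GG q m l v (q j) = v j)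
    {l : ℕ → ℕ} (hl : ∀ m, 5 ≤ l m) (v : Fin 3 → ℝ) :
    Compat q l 1 (fun w => GG q m (sh l 1) (ext3 (l 0) v (w 0))) := by
  refine compat_of hq hl (fun p => hU (l 0) v p.1 p.2) fun w _ j => ?_
  rw [h (sh_five hl 1), pos_one]; rfl

lemma GG_q {q : Fin 3 → E2} (hq : Equi q) (m : ℕ) : ∀ {l : ℕ → ℕ}, (∀ m, 5 ≤ l m) →
    ∀ v j, GG q m l v (q j) = v j := by
  induction m with
  | zero =>
    intro l hl v j
    have h01 := hq 0 1 (by decide)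
    have h02 := hq 0 2 (by decide)
    have h12 := hq 1 2 (by decide)
    have h21 := hq 2 1 (by decide)
    fin_cases j <;> simp [GG, h01, h02, h12, h21]
  | succ m ih =>
    intro l hl v j
    have hc := cc_mem' (hl 0) j
    have h1 := glue_spec hq hl (GG_compat hq ih hl v) (single_mem (l := l) hc)
      (q_mem q (sh_five hl 1) j)
    rw [wordMap_single, corner_fix q (hl 0) j, ih (sh_five hl 1)] at h1
    rw [GG_succ, h1]
    exact ext3_corner (hl 0) v j

lemma GG_cont {q : Fin 3 → E2} (hq : Equi q) (m : ℕ) : ∀ {l : ℕ → ℕ}, (∀ m, 5 ≤ l m) →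
    ∀ v, ContinuousOn (GG q m l v) (Gasket q l) := by
  induction m with
  | zero =>
    intro l hl v
    have : GG q 0 l v = fun z => v 0 + (v 1 - v 0) * max 0 (1 - dist z (q 1)) +
      (v 2 - v 0) * max 0 (1 - dist z (q 2)) := rfl
    rw [this]
    apply Continuous.continuousOn
    fun_prop
  | succ m ih =>
    intro l hl v
    rw [GG_succ]
    exact glue_cont hq hl (GG_compat hq (fun h => GG_q hq m h) hl v)
      fun w _ => ih (sh_five hl 1) _

lemma GG_fmap {q : Fin 3 → E2} (hq : Equi q) (m : ℕ) {l : ℕ → ℕ} (hl : ∀ m, 5 ≤ l m)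
    (v : Fin 3 → ℝ) {i : ℕ × ℕ} (hi : i ∈ Sset (l 0)) {z : E2} (hz : z ∈ Gasket q (sh l 1)) :
    GG q (m + 1) l v (fmap q (l 0) i z) = GG q m (sh l 1) (ext3 (l 0) v i) z := by
  have h1 := glue_spec hq hl (GG_compat hq (fun h => GG_q hq m h) hl v) (single_mem (l := l) hi) hz
  rw [wordMap_single] at h1
  exact h1

lemma exists_fmap {q : Fin 3 → E2} {l : ℕ → ℕ} (hl : ∀ m, 5 ≤ l m) {x : E2}
    (hx : x ∈ Gasket q l) : ∃ i ∈ Sset (l 0), ∃ z ∈ Gasket q (sh l 1), fmap q (l 0) i z = x := by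
  obtain ⟨w, hw, z, hz, h⟩ := exists_word hl 1 hx
  refine ⟨w 0, hw.1 0 one_pos, z, hz, ?_⟩
  rw [eq_single hw, wordMap_single] at h
  exact h

lemma ee_abs (v : Fin 3 → ℝ) : |v 1 - v 0| ≤ √(ee v) ∧ |v 2 - v 0| ≤ √(ee v) := by
  have h := Real.sq_sqrt (ee_nonneg v)
  have h0 := Real.sqrt_nonneg (ee v)
  constructor <;> apply abs_le_of_sq_le_sq _ h0 <;> rw [h] <;> unfold ee e3 <;>
    nlinarith [sq_nonneg (v 0 - v 1), sq_nonneg (v 1 - v 2), sq_nonneg (v 2 - v 0)]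

lemma GG_zero_est (q : Fin 3 → E2) (l : ℕ → ℕ) (v : Fin 3 → ℝ) (z : E2) :
    |GG q 0 l v z - v 0| ≤ 2 * √(ee v) := by
  obtain ⟨h1, h2⟩ := ee_abs v
  have hm : ∀ j, |max 0 (1 - dist z (q j))| ≤ 1 := by
    intro j
    rw [abs_of_nonneg (le_max_left _ _)]
    exact max_le zero_le_one (by linarith [dist_nonneg (x := z) (y := q j)])
  have e : GG q 0 l v z - v 0 = (v 1 - v 0) * max 0 (1 - dist z (q 1)) +
      (v 2 - v 0) * max 0 (1 - dist z (q 2)) := by unfold GG; ring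
  rw [e]
  refine (abs_add_le _ _).trans ?_
  rw [abs_mul, abs_mul]
  have := mul_le_mul h1 (hm 1) (abs_nonneg _) (Real.sqrt_nonneg _)
  have := mul_le_mul h2 (hm 2) (abs_nonneg _) (Real.sqrt_nonneg _)
  linarith

lemma GG_EN_one {q : Fin 3 → E2} (hq : Equi q) {l : ℕ → ℕ} (hl : ∀ m, 5 ≤ l m)
    (v : Fin 3 → ℝ) : EN q l 1 (GG q 1 l v) = ee v := by
  rw [EN_one]
  have : ∀ i ∈ SF (l 0), e0 q (GG q 1 l v ∘ fmap q (l 0) i) = ee (ext3 (l 0) v i) := by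
    intro i hi
    have hj : ∀ j, GG q 1 l v (fmap q (l 0) i (q j)) = ext3 (l 0) v i j := fun j => by
      rw [GG_fmap hq 0 hl v (mem_SF.1 hi) (q_mem q (sh_five hl 1) j), GG_q hq 0 (sh_five hl 1)]
    simp only [e0, Function.comp, hj]; rfl
  rw [Finset.sum_congr rfl this, ext3_sum (hl 0), inv_mul_cancel_left₀ (rl_pos _).ne']

lemma sqrt_ext3 {l : ℕ} (hl : 5 ≤ l) (v : Fin 3 → ℝ) {i : ℕ × ℕ} (hi : i ∈ Sset l) :
    √(ee (ext3 l v i)) ≤ 2 / 3 * √(ee v) := by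
  have := Real.sqrt_le_sqrt (ext3_le hl v hi)
  rwa [Real.sqrt_mul (by positivity), Real.sqrt_sq (by norm_num)] at this

lemma GG_step {q : Fin 3 → E2} (hq : Equi q) (m : ℕ) : ∀ {l : ℕ → ℕ}, (∀ m, 5 ≤ l m) →
    ∀ v, ∀ x ∈ Gasket q l, |GG q (m + 1) l v x - GG q m l v x| ≤ 6 * √(ee v) * (2 / 3) ^ m := by
  induction m with
  | zero =>
    intro l hl v x hx
    obtain ⟨i, hi, z, hz, rfl⟩ := exists_fmap hl hx
    have h1 := GG_zero_est q l v (fmap q (l 0) i z)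
    have h2 := GG_zero_est q (sh l 1) (ext3 (l 0) v i) z
    rw [← GG_fmap hq 0 hl v hi hz] at h2
    have h3 := sqrt_ext3 (hl 0) v hi
    have h4 : |ext3 (l 0) v i 0 - v 0| ≤ 3 / 2 * √(ee v) := by
      have hT := T_est q 1 hl (GG q 1 l v) (x := fmap q (l 0) i (q 0))
        (mem_Vn.2 ⟨single i, single_mem hi, 0, by rw [wordMap_single]⟩) 0
      rw [GG_EN_one hq hl, GG_q hq 1 hl,
        GG_fmap hq 0 hl v hi (q_mem q (sh_five hl 1) 0), GG_q hq 0 (sh_five hl 1)] at hT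
      apply abs_le_of_sq_le_sq _ (by positivity)
      rw [mul_pow, Real.sq_sqrt (ee_nonneg v)]
      linarith [ee_nonneg v]
    have h0 := Real.sqrt_nonneg (ee v)
    rw [abs_le] at *
    simp only [pow_zero, mul_one, Nat.zero_add] at *
    constructor <;> linarith [h1.1, h1.2, h2.1, h2.2, h4.1, h4.2]
  | succ m ih =>
    intro l hl v x hx
    obtain ⟨i, hi, z, hz, rfl⟩ := exists_fmap hl hx
    rw [GG_fmap hq (m + 1) hl v hi hz, GG_fmap hq m hl v hi hz]
    refine (ih (sh_five hl 1) _ z hz).trans ?_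
    have := sqrt_ext3 (hl 0) v hi
    rw [pow_succ]
    have hp : (0 : ℝ) < (2 / 3) ^ m := by positivity
    nlinarith [mul_le_mul_of_nonneg_right this hp.le]

/-- The harmonic extension. -/
def HH (q : Fin 3 → E2) (l : ℕ → ℕ) (v : Fin 3 → ℝ) (x : E2) : ℝ :=
  limUnder atTop fun m => GG q m l v x

lemma HH_tendsto {q : Fin 3 → E2} (hq : Equi q) {l : ℕ → ℕ} (hl : ∀ m, 5 ≤ l m)
    (v : Fin 3 → ℝ) {x : E2} (hx : x ∈ Gasket q l) :
    Tendsto (fun m => GG q m l v x) atTop (nhds (HH q l v x)) := by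
  have hc : CauchySeq fun m => GG q m l v x := by
    refine cauchySeq_of_le_geometric (2 / 3) (6 * √(ee v)) (by norm_num) fun m => ?_
    rw [dist_comm, Real.dist_eq]
    exact GG_step hq m hl v x hx
  obtain ⟨a, ha⟩ := cauchySeq_tendsto_of_complete hc
  exact tendsto_nhds_limUnder ⟨a, ha⟩

lemma HH_unif {q : Fin 3 → E2} (hq : Equi q) {l : ℕ → ℕ} (hl : ∀ m, 5 ≤ l m)
    (v : Fin 3 → ℝ) : ContinuousOn (HH q l v) (Gasket q l) := by
  have hu : TendstoUniformlyOn (fun m => GG q m l v) (HH q l v) atTop (Gasket q l) := by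
    rw [Metric.tendstoUniformlyOn_iff]
    intro ε hε
    have ht : Tendsto (fun m : ℕ => 6 * √(ee v) * (2 / 3 : ℝ) ^ m / (1 - 2 / 3)) atTop
        (nhds 0) := by
      have := ((tendsto_pow_atTop_nhds_zero_of_lt_one (r := (2 / 3 : ℝ)) (by norm_num)
        (by norm_num)).const_mul (6 * √(ee v))).div_const (1 - 2 / 3)
      simpa using this
    filter_upwards [ht.eventually_lt_const hε] with m hm x hx
    rw [dist_comm]
    refine lt_of_le_of_lt ?_ hm
    refine dist_le_of_le_geometric_of_tendsto (2 / 3) (6 * √(ee v)) (by norm_num) (fun m => ?_)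
      (HH_tendsto hq hl v hx) m
    rw [dist_comm, Real.dist_eq]
    exact GG_step hq m hl v x hx
  exact hu.continuousOn (Frequently.of_forall fun m => GG_cont hq m hl v)

lemma HH_q {q : Fin 3 → E2} (hq : Equi q) {l : ℕ → ℕ} (hl : ∀ m, 5 ≤ l m)
    (v : Fin 3 → ℝ) (j : Fin 3) : HH q l v (q j) = v j := by
  have h1 := HH_tendsto hq hl v (q_mem q hl j)
  simp only [GG_q hq _ hl] at h1
  exact tendsto_nhds_unique h1 tendsto_const_nhds

lemma HH_fmap {q : Fin 3 → E2} (hq : Equi q) {l : ℕ → ℕ} (hl : ∀ m, 5 ≤ l m)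
    (v : Fin 3 → ℝ) {i : ℕ × ℕ} (hi : i ∈ Sset (l 0)) {z : E2} (hz : z ∈ Gasket q (sh l 1)) :
    HH q l v (fmap q (l 0) i z) = HH q (sh l 1) (ext3 (l 0) v i) z := by
  have hx : fmap q (l 0) i z ∈ Gasket q l := by
    have := wordMap_mem_Gasket hl (single_mem (l := l) hi) hz
    rwa [wordMap_single] at this
  have h1 := (HH_tendsto hq hl v hx).comp (tendsto_add_atTop_nat 1)
  have h2 := HH_tendsto hq (sh_five hl 1) (ext3 (l 0) v i) hz
  refine tendsto_nhds_unique h1 (h2.congr fun m => ?_)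
  exact (GG_fmap hq m hl v hi hz).symm

lemma HH_EN {q : Fin 3 → E2} (hq : Equi q) (m : ℕ) : ∀ {l : ℕ → ℕ}, (∀ m, 5 ≤ l m) →
    ∀ v, EN q l m (HH q l v) = ee v := by
  induction m with
  | zero =>
    intro l hl v
    simp only [EN_zero, e0, HH_q hq hl]; rfl
  | succ m ih =>
    intro l hl v
    rw [Nat.add_comm, EN_succ']
    have : ∀ i ∈ SF (l 0), EN q (sh l 1) m (HH q l v ∘ fmap q (l 0) i) =
        ee (ext3 (l 0) v i) := by
      intro i hi
      rw [EN_congr (sh_five hl 1) m (u := HH q l v ∘ fmap q (l 0) i) (u' := HH q (sh l 1) (ext3 (l 0) v i))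
        (fun z hz => HH_fmap hq hl v (mem_SF.1 hi) hz), ih (sh_five hl 1)]
    rw [Finset.sum_congr rfl this, ext3_sum (hl 0), inv_mul_cancel_left₀ (rl_pos _).ne']

lemma HH_const {q : Fin 3 → E2} (hq : Equi q) {l : ℕ → ℕ} (hl : ∀ m, 5 ≤ l m)
    {v : Fin 3 → ℝ} {c : ℝ} (h : ∀ j, v j = c) {x : E2} (hx : x ∈ Gasket q l) :
    HH q l v x = c := by
  have h0 : ee v = 0 := by simp [ee, e3, h]
  have := T_K hq hl (HH_unif hq hl v) (C := 0) (fun n => by rw [HH_EN hq n hl, h0]) hx 0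
  rw [HH_q hq hl, h] at this
  have h2 : HH q l v x - c = 0 := by
    apply pow_eq_zero_iff (two_ne_zero) |>.1
    nlinarith [sq_nonneg (HH q l v x - c)]
  linarith

/-- Extension from a lattice function on the first level. -/
def LatE (q : Fin 3 → E2) (l : ℕ → ℕ) (U : ℕ → ℕ → ℝ) : E2 → ℝ :=
  glueW q l 1 (fun w => HH q (sh l 1) (fun j => U (w 0 + ev j).1 (w 0 + ev j).2))

lemma LatE_compat {q : Fin 3 → E2} (hq : Equi q) {l : ℕ → ℕ} (hl : ∀ m, 5 ≤ l m)
    (U : ℕ → ℕ → ℝ) :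
    Compat q l 1 (fun w => HH q (sh l 1) (fun j => U (w 0 + ev j).1 (w 0 + ev j).2)) := by
  refine compat_of hq hl (fun p => U p.1 p.2) fun w _ j => ?_
  rw [HH_q hq (sh_five hl 1), pos_one]

lemma LatE_cont {q : Fin 3 → E2} (hq : Equi q) {l : ℕ → ℕ} (hl : ∀ m, 5 ≤ l m)
    (U : ℕ → ℕ → ℝ) : ContinuousOn (LatE q l U) (Gasket q l) :=
  glue_cont hq hl (LatE_compat hq hl U) fun _ _ => HH_unif hq (sh_five hl 1) _

lemma LatE_EN {q : Fin 3 → E2} (hq : Equi q) {l : ℕ → ℕ} (hl : ∀ m, 5 ≤ l m)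
    (U : ℕ → ℕ → ℝ) (m : ℕ) : EN q l m (LatE q l U) ≤ (rl (l 0))⁻¹ * ∑ i ∈ SF (l 0), eU U i := by
  have h := glue_energy hq hl (LatE_compat hq hl U)
    (c := fun w => ee (fun j => U (w 0 + ev j).1 (w 0 + ev j).2))
    (fun w _ m => (HH_EN hq m (sh_five hl 1) _).le) m
  rw [sum_WF_one] at h
  refine h.trans (le_of_eq ?_)
  have : Rn l 1 = rl (l 0) := by simp [Rn]
  rw [this]
  simp [ee, ev, eU, single]

lemma LatE_q {q : Fin 3 → E2} (hq : Equi q) {l : ℕ → ℕ} (hl : ∀ m, 5 ≤ l m)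
    (U : ℕ → ℕ → ℝ) {i : ℕ × ℕ} (hi : i ∈ Sset (l 0)) (j : Fin 3) :
    LatE q l U (fmap q (l 0) i (q j)) = U (i + ev j).1 (i + ev j).2 := by
  have h1 := glue_spec hq hl (LatE_compat hq hl U) (single_mem (l := l) hi)
    (q_mem q (sh_five hl 1) j)
  rw [wordMap_single, HH_q hq (sh_five hl 1)] at h1
  exact h1

lemma LatE_corner {q : Fin 3 → E2} (hq : Equi q) {l : ℕ → ℕ} (hl : ∀ m, 5 ≤ l m)
    (U : ℕ → ℕ → ℝ) (j : Fin 3) :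
    LatE q l U (q j) = U (cc (l 0 - 2) j + ev j).1 (cc (l 0 - 2) j + ev j).2 := by
  have := LatE_q hq hl U (cc_mem' (hl 0) j) j
  rwa [corner_fix q (hl 0)] at this

lemma LatE_const {q : Fin 3 → E2} (hq : Equi q) {l : ℕ → ℕ} (hl : ∀ m, 5 ≤ l m)
    {U : ℕ → ℕ → ℝ} {i : ℕ × ℕ} (hi : i ∈ Sset (l 0)) {c : ℝ}
    (h : ∀ j, U (i + ev j).1 (i + ev j).2 = c) {z : E2} (hz : z ∈ Gasket q (sh l 1)) :
    LatE q l U (fmap q (l 0) i z) = c := by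
  have h1 := glue_spec hq hl (LatE_compat hq hl U) (single_mem (l := l) hi) hz
  rw [wordMap_single] at h1
  refine Eq.trans h1 ?_
  exact HH_const hq (sh_five hl 1) h hz

/-! ## Test functions on one level -/

lemma Iv_val {n : ℕ} (hn : 3 ≤ n) {i : ℕ × ℕ} {lo hi : ℕ} (h : Iv n i lo hi) (g : ℕ → ℝ)
    (hg : g (3 * n) = g 0) {c : ℝ} (hc : ∀ τ, lo ≤ τ → τ ≤ hi → g τ = c) (j : Fin 3) :
    g (nd n (i + ev j).1 (i + ev j).2) = c := by
  rcases h with ⟨τ, h, rfl, rfl, rfl⟩ | ⟨a, rfl, rfl, rfl⟩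
  · obtain ⟨h1, h2, h3⟩ := nd_rc hn h g hg
    have e1 := hc lo le_rfl (by omega)
    have e2 := hc (lo + 1) (by omega) le_rfl
    rw [e1, e2] at h1 h2 h3
    simp only [Set.pair_eq_singleton, Set.mem_singleton_iff] at h1 h2 h3
    fin_cases j
    · simpa [ev] using h1
    · simpa [ev] using h2
    · simpa [ev] using h3
  · have := nd_cc hn a g hg j
    rw [hc _ le_rfl le_rfl] at this
    exact this

/-- Capped ring distance to the interval `[lo, hi]`. -/
def rd (M lo hi k τ : ℕ) : ℕ :=
  if τ ≤ lo then min k (min (lo - τ) (M + τ - hi)) else min k (min (τ - hi) (M + lo - τ))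

lemma rd_energy {M lo hi k : ℕ} (h1 : lo ≤ hi) (h2 : hi ≤ lo + 1) (h3 : hi ≤ M) (hk : k ≤ M) :
    ∑ τ ∈ Finset.range M, (((rd M lo hi k (τ + 1) : ℕ) : ℝ) - (rd M lo hi k τ : ℕ)) ^ 2
      ≤ 2 * (k : ℝ) := by
  classical
  set A := (Finset.range k).image (fun a => if hi + a < M then hi + a else hi + a - M) with hA
  set B := (Finset.range k).image (fun a => if a < lo then lo - 1 - a else M + lo - 1 - a) with hB
  have hle : ∀ τ ∈ Finset.range M,
      (((rd M lo hi k (τ + 1) : ℕ) : ℝ) - (rd M lo hi k τ : ℕ)) ^ 2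
        ≤ if τ ∈ A ∪ B then 1 else 0 := by
    intro τ hτ
    rw [Finset.mem_range] at hτ
    have hcase : rd M lo hi k (τ + 1) = rd M lo hi k τ ∨
        (rd M lo hi k (τ + 1) = rd M lo hi k τ + 1 ∧ τ ∈ A) ∨
        (rd M lo hi k τ = rd M lo hi k (τ + 1) + 1 ∧ τ ∈ B) := by
      by_cases e0 : rd M lo hi k (τ + 1) = rd M lo hi k τ
      · exact Or.inl e0
      · right
        by_cases e1 : rd M lo hi k (τ + 1) = rd M lo hi k τ + 1
        · left
          refine ⟨e1, ?_⟩
          rw [hA, Finset.mem_image]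
          by_cases hc : hi ≤ τ
          · refine ⟨τ - hi, ?_, ?_⟩
            · rw [Finset.mem_range]
              unfold rd at e1; split_ifs at e1 <;> omega
            · split_ifs <;> omega
          · refine ⟨M + τ - hi, ?_, ?_⟩
            · rw [Finset.mem_range]
              unfold rd at e1; split_ifs at e1 <;> omega
            · split_ifs <;> omega
        · right
          have e2 : rd M lo hi k τ = rd M lo hi k (τ + 1) + 1 := by
            unfold rd at e0 e1 ⊢; split_ifs at e0 e1 ⊢ <;> omega
          refine ⟨e2, ?_⟩
          rw [hB, Finset.mem_image]
          by_cases hc : τ < lo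
          · refine ⟨lo - 1 - τ, ?_, ?_⟩
            · rw [Finset.mem_range]
              unfold rd at e2; split_ifs at e2 <;> omega
            · split_ifs <;> omega
          · refine ⟨M + lo - 1 - τ, ?_, ?_⟩
            · rw [Finset.mem_range]
              unfold rd at e2; split_ifs at e2 <;> omega
            · split_ifs <;> omega
    rcases hcase with e | ⟨e, hm⟩ | ⟨e, hm⟩
    · rw [e]; split_ifs <;> simp
    · rw [e, if_pos (Finset.mem_union_left _ hm)]; push_cast; ring_nf; rfl
    · rw [e, if_pos (Finset.mem_union_right _ hm)]; push_cast; ring_nf; rfl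
  refine (Finset.sum_le_sum hle).trans ?_
  rw [← Finset.sum_filter, Finset.sum_const, nsmul_eq_mul, mul_one]
  have hc : ((Finset.range M).filter (· ∈ A ∪ B)).card ≤ 2 * k := by
    refine (Finset.card_le_card (t := A ∪ B) fun τ hτ => (Finset.mem_filter.1 hτ).2).trans ?_
    refine (Finset.card_union_le _ _).trans ?_
    have h1 : A.card ≤ k := Finset.card_image_le.trans (by simp)
    have h2 : B.card ≤ k := Finset.card_image_le.trans (by simp)
    omega
  exact_mod_cast hc

lemma tent {l : ℕ} (hl : 5 ≤ l) {i i' : ℕ × ℕ} (hi : i ∈ Sset l) (hi' : i' ∈ Sset l) {k : ℕ}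
    (hk : ∀ m ≤ k, ¬ Ch (adj1 l) m i i') :
    ∃ U : ℕ → ℕ → ℝ, (∀ a b, 0 ≤ U a b ∧ U a b ≤ k) ∧ (∀ j, U (i + ev j).1 (i + ev j).2 = 0) ∧
      (∀ j, U (i' + ev j).1 (i' + ev j).2 = k) ∧ ∑ s ∈ SF l, eU U s ≤ 4 * k := by
  obtain ⟨n, rfl⟩ : ∃ n, l = n + 2 := ⟨l - 2, by omega⟩
  have hn : 3 ≤ n := by omega
  have hne : i ≠ i' := by rintro rfl; exact hk 0 (Nat.zero_le _) (Ch_zero _ _)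
  obtain ⟨lo, h, hv⟩ := Iv_exists hn hi
  obtain ⟨lo', h', hv'⟩ := Iv_exists hn hi'
  obtain ⟨b1, b2, b3⟩ := Iv_bd hv
  obtain ⟨b1', b2', b3'⟩ := Iv_bd hv'
  have hor : (h ≤ lo' ∧ k ≤ lo' - h ∧ k ≤ 3 * n + lo - h') ∨
      (h' ≤ lo ∧ k ≤ lo - h' ∧ k ≤ 3 * n + lo' - h) := by
    rcases Iv_order hn hv hv' hne with ho | ho
    · left
      have c1 := Ch_Iv hn hv hv' hne ho
      have c2 := Ch_Iv' hn hv hv' hne ho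
      refine ⟨ho, ?_, ?_⟩
      · by_contra hcon; exact hk _ (by omega) c1
      · by_contra hcon; exact hk _ (by omega) c2
    · right
      have c1 := Ch_symm adj1_symm (Ch_Iv hn hv' hv hne.symm ho)
      have c2 := Ch_symm adj1_symm (Ch_Iv' hn hv' hv hne.symm ho)
      refine ⟨ho, ?_, ?_⟩
      · by_contra hcon; exact hk _ (by omega) c1
      · by_contra hcon; exact hk _ (by omega) c2
  set g : ℕ → ℝ := fun τ => (rd (3 * n) lo h k τ : ℕ) with hgdef
  have hg : g (3 * n) = g 0 := by
    simp only [hgdef]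
    norm_cast
    unfold rd
    split_ifs <;> omega
  refine ⟨fun a b => g (nd n a b), fun a b => ⟨by simp only [hgdef]; positivity, ?_⟩, ?_, ?_, ?_⟩
  · simp only [hgdef]
    norm_cast
    unfold rd
    split_ifs <;> omega
  · intro j
    refine Iv_val hn hv g hg (fun τ t1 t2 => ?_) j
    simp only [hgdef]
    norm_cast
    unfold rd
    split_ifs <;> omega
  · intro j
    refine Iv_val hn hv' g hg (fun τ t1 t2 => ?_) j
    simp only [hgdef]
    norm_cast
    unfold rd
    split_ifs <;> omega
  · have h1 := ring_energy hn g hg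
    have h2 := rd_energy (M := 3 * n) (k := k) b1 b2 b3 (by omega)
    simp only [hgdef] at h1 ⊢
    linarith

/-- Test function reaching a corner vertex. -/
lemma tent_corner {l : ℕ} (hl : 5 ≤ l) {i : ℕ × ℕ} (hi : i ∈ Sset l) (a : Fin 3) :
    ∃ (d : ℕ) (U : ℕ → ℕ → ℝ), Ch (adj1 l) d i (cc (l - 2) a) ∧
      (∀ x y, 0 ≤ U x y ∧ U x y ≤ d) ∧
      (∀ j, U (i + ev j).1 (i + ev j).2 = 0) ∧
      U (cc (l - 2) a + ev a).1 (cc (l - 2) a + ev a).2 = d ∧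
      ∑ s ∈ SF l, eU U s ≤ 4 * d := by
  classical
  have hcm := cc_mem' hl a
  have hex : ∃ t, Ch (adj1 l) t i (cc (l - 2) a) := by
    obtain ⟨t, -, ht⟩ := Ch_short hl hi hcm
    exact ⟨t, ht⟩
  obtain ⟨d, hd, hmin⟩ : ∃ d, Ch (adj1 l) d i (cc (l - 2) a) ∧
      ∀ m < d, ¬ Ch (adj1 l) m i (cc (l - 2) a) :=
    ⟨Nat.find hex, Nat.find_spec hex, fun m hm => Nat.find_min hex hm⟩
  rcases Nat.eq_zero_or_pos d with rfl | hpos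
  · exact ⟨0, fun _ _ => 0, hd, by simp, by simp, by simp, by simp [eU, e3]⟩
  obtain ⟨k, rfl⟩ : ∃ k, d = k + 1 := ⟨d - 1, by omega⟩
  obtain ⟨U, u1, u2, u3, u4⟩ := tent hl hi hcm (k := k) (fun m hm => hmin m (by omega))
  have hne : i ≠ cc (l - 2) a := by rintro rfl; exact hmin 0 hpos (Ch_zero _ _)
  -- the corner vertex lies only in the corner cell
  have huniq : ∀ s ∈ Sset l, ∀ j, s + ev j = cc (l - 2) a + ev a → s = cc (l - 2) a ∧ j = a := by
    rintro ⟨s, t⟩ ⟨hs, -⟩ j e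
    simp only [Prod.ext_iff, Prod.fst_add, Prod.snd_add] at e ⊢
    rcases cc_cases (l - 2) a with ⟨rfl, h2, -⟩ | ⟨rfl, h2, -⟩ | ⟨rfl, h2, -⟩ <;>
      rw [h2] at e ⊢ <;> fin_cases j <;> simp [ev] at e ⊢ <;> omega
  set c := cc (l - 2) a with hc
  set U' : ℕ → ℕ → ℝ := fun x y => U x y + if (x, y) = c + ev a then 1 else 0 with hU'
  have hval : ∀ s ∈ Sset l, ∀ j, U' (s + ev j).1 (s + ev j).2 =
      U (s + ev j).1 (s + ev j).2 + if s = c ∧ j = a then 1 else 0 := by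
    intro s hs j
    simp only [hU', Prod.mk.eta]
    congr 1
    by_cases h : s + ev j = c + ev a
    · rw [if_pos h, if_pos (huniq s hs j h)]
    · rw [if_neg h, if_neg]
      rintro ⟨rfl, rfl⟩; exact h rfl
  refine ⟨k + 1, U', hd, ?_, ?_, ?_, ?_⟩
  · intro x y
    have := u1 x y
    simp only [hU']
    push_cast
    split_ifs <;> constructor <;> linarith
  · intro j
    rw [hval i hi j, u2, if_neg (fun h => hne h.1), add_zero]
  · rw [hval c hcm a, u3, if_pos ⟨rfl, rfl⟩]; push_cast; rfl
  · have hle : ∀ s ∈ SF l, eU U' s ≤ eU U s + if s = c then 2 else 0 := by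
      intro s hs
      have hs' := mem_SF.1 hs
      have key : ∀ V : ℕ → ℕ → ℝ, eU V s = ee (fun j => V (s + ev j).1 (s + ev j).2) := by
        intro V; simp [eU, ee, ev]
      rw [key, key]
      by_cases h : s = c
      · rw [if_pos h]
        subst h
        simp only [hval _ hcm, u3, ee, e3]
        rcases cc_cases (l - 2) a with ⟨h1, -, -⟩ | ⟨h1, -, -⟩ | ⟨h1, -, -⟩ <;>
          rw [h1] <;> simp <;> norm_num
      · rw [if_neg h, add_zero]
        apply le_of_eq
        congr 1
        funext j
        rw [hval s hs' j, if_neg (fun e => h e.1), add_zero]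
    have := Finset.sum_le_sum hle
    rw [Finset.sum_add_distrib, Finset.sum_ite_eq' (SF l) c (fun _ => (2 : ℝ)),
      if_pos (mem_SF.2 hcm)] at this
    push_cast
    linarith

/-! ## Lower bound for the resistance metric -/

lemma REc_ge {q : Fin 3 → E2} (hq : Equi q) {l : ℕ → ℕ} (hl : ∀ m, 5 ≤ l m) {x y : E2}
    (hx : x ∈ Gasket q l) (hy : y ∈ Gasket q l) {F : E2 → ℝ} (hF : ContinuousOn F (Gasket q l))
    {C : ℝ} (hC : ∀ m, EN q l m F ≤ C) (h0 : F x = 0) (h1 : F y = 1) : C⁻¹ ≤ REc q l x y := by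
  have hd := FDom_of hC
  have hT := T2_K hq hl hF (fun n => EN_le_EForm q hl hd n) hx hy
  rw [h0, h1] at hT
  have hpos : 0 < EForm q l F F := by linarith
  have hle := EForm_le q hl hC
  have hmem : ((F x - F y) ^ 2 / EForm q l F F) ∈ REcSet q l x y := ⟨F, hd, hF, hpos, rfl⟩
  refine le_trans ?_ (le_csSup (REc_bdd hq hl hx hy) hmem)
  rw [h0, h1]
  norm_num
  exact inv_anti₀ hpos hle

lemma incid {q : Fin 3 → E2} (hq : Equi q) {l : ℕ → ℕ} (hl : ∀ m, 5 ≤ l m) {N : ℕ}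
    {T : Finset (ℕ → ℕ × ℕ)} [DecidableEq (ℕ → ℕ × ℕ)] [DecidableEq E2]
    {P : ℕ → ℕ × ℕ} (hP : P ∈ Wn l N) (hPT : P ∈ T) (a : Fin 3) :
    ∑ Q ∈ (WF l N).filter (· ∉ T), ∑ j : Fin 3,
      (if wordMap q l P N (q a) = wordMap q l Q N (q j) then (1 : ℝ) else 0) ≤ 1 := by
  rw [← Finset.sum_product', ← Finset.sum_filter, Finset.sum_const, nsmul_eq_mul, mul_one]
  have : (Finset.filter (fun x : (ℕ → ℕ × ℕ) × Fin 3 =>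
      wordMap q l P N (q a) = wordMap q l x.1 N (q x.2))
      ((WF l N).filter (· ∉ T) ×ˢ Finset.univ)).card ≤ 1 := by
    rw [Finset.card_le_one]
    rintro ⟨Q, j⟩ h1 ⟨Q', j'⟩ h2
    simp only [Finset.mem_filter, Finset.mem_product, Finset.mem_univ, and_true, mem_WF] at h1 h2
    obtain ⟨⟨hQ, hQT⟩, e1⟩ := h1
    obtain ⟨⟨hQ', hQT'⟩, e2⟩ := h2
    have n1 : P ≠ Q := by rintro rfl; exact hQT hPT
    have n2 : P ≠ Q' := by rintro rfl; exact hQT' hPT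
    have : Q = Q' := by
      by_contra hne
      exact no_three q hq hl N hP hQ hQ' n1 n2 hne e1 e2
    subst this
    have := wordMap_inj q l hl Q N (e1.symm.trans e2)
    rw [q_inj q hq this]
  exact_mod_cast this

lemma build {q : Fin 3 → E2} (hq : Equi q) {l : ℕ → ℕ} (hl : ∀ m, 5 ≤ l m) {N : ℕ}
    (T : Finset (ℕ → ℕ × ℕ)) (hT : ∀ P ∈ T, P ∈ Wn l N) (hcard : T.card ≤ 2)
    (u : (ℕ → ℕ × ℕ) → E2 → ℝ) (c : (ℕ → ℕ × ℕ) → ℝ)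
    (hcont : ∀ P ∈ T, ContinuousOn (u P) (Gasket q (sh l N)))
    (hc : ∀ P ∈ T, ∀ m, EN q (sh l N) m (u P) ≤ c P)
    (h01 : ∀ P ∈ T, ∀ j, 0 ≤ u P (q j) ∧ u P (q j) ≤ 1)
    (hcomp : ∀ P ∈ T, ∀ P' ∈ T, ∀ j j', wordMap q l P N (q j) = wordMap q l P' N (q j') →
      u P (q j) = u P' (q j')) :
    ∃ F : E2 → ℝ, ContinuousOn F (Gasket q l) ∧
      (∀ P ∈ T, ∀ z ∈ Gasket q (sh l N), F (wordMap q l P N z) = u P z) ∧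
      ∀ m, EN q l m F ≤ (Rn l N)⁻¹ * (∑ P ∈ T, c P + 9 / 2) := by
  classical
  set g : E2 → ℝ := fun p => if h : ∃ Pj : (ℕ → ℕ × ℕ) × Fin 3, Pj.1 ∈ T ∧
    wordMap q l Pj.1 N (q Pj.2) = p then u h.choose.1 (q h.choose.2) else 1 / 2 with hg
  have hgT : ∀ P ∈ T, ∀ j, g (wordMap q l P N (q j)) = u P (q j) := by
    intro P hP j
    have h : ∃ Pj : (ℕ → ℕ × ℕ) × Fin 3, Pj.1 ∈ T ∧
      wordMap q l Pj.1 N (q Pj.2) = wordMap q l P N (q j) := ⟨(P, j), hP, rfl⟩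
    simp only [hg]
    rw [dif_pos h]
    obtain ⟨h1, h2⟩ := h.choose_spec
    exact hcomp _ h1 _ hP _ _ h2
  have hgN : ∀ p, (¬ ∃ Pj : (ℕ → ℕ × ℕ) × Fin 3, Pj.1 ∈ T ∧
      wordMap q l Pj.1 N (q Pj.2) = p) → g p = 1 / 2 := by
    intro p h
    simp only [hg]
    rw [dif_neg h]
  set u' : (ℕ → ℕ × ℕ) → E2 → ℝ := fun Q => if Q ∈ T then u Q else
    HH q (sh l N) (fun j => g (wordMap q l Q N (q j))) with hu'
  have hu'T : ∀ Q ∈ T, u' Q = u Q := fun Q hQ => by simp only [hu']; rw [if_pos hQ]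
  have hu'N : ∀ Q, Q ∉ T → u' Q = HH q (sh l N) (fun j => g (wordMap q l Q N (q j))) :=
    fun Q hQ => by simp only [hu']; rw [if_neg hQ]
  have hu'g : ∀ Q j, u' Q (q j) = g (wordMap q l Q N (q j)) := by
    intro Q j
    by_cases hQ : Q ∈ T
    · rw [hu'T Q hQ, hgT Q hQ]
    · rw [hu'N Q hQ, HH_q hq (sh_five hl N)]
  have hcompat : Compat q l N u' := by
    intro w _ v _ j j' e
    rw [hu'g, hu'g, e]
  set c' : (ℕ → ℕ × ℕ) → ℝ := fun Q => if Q ∈ T then c Q else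
    ee (fun j => g (wordMap q l Q N (q j))) with hc'
  refine ⟨glueW q l N u', ?_, ?_, ?_⟩
  · refine glue_cont hq hl hcompat fun w _ => ?_
    by_cases hQ : w ∈ T
    · rw [hu'T w hQ]; exact hcont w hQ
    · rw [hu'N w hQ]; exact HH_unif hq (sh_five hl N) _
  · intro P hP z hz
    rw [glue_spec hq hl hcompat (hT P hP) hz, hu'T P hP]
  · intro m
    have h1 := glue_energy hq hl hcompat (c := c') (fun w hw m => by
      by_cases hQ : w ∈ T
      · rw [hu'T w hQ]; simp only [hc']; rw [if_pos hQ]; exact hc w hQ m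
      · rw [hu'N w hQ, HH_EN hq m (sh_five hl N)]; simp only [hc']; rw [if_neg hQ]) m
    refine h1.trans (mul_le_mul_of_nonneg_left ?_ (inv_nonneg.2 (Rn_pos l N).le))
    simp only [hc']
    rw [Finset.sum_ite]
    have hTe : (WF l N).filter (· ∈ T) = T := by
      ext Q
      simp only [Finset.mem_filter, mem_WF]
      exact ⟨fun h => h.2, fun h => ⟨hT Q h, h⟩⟩
    rw [hTe]
    refine add_le_add le_rfl ?_
    -- boundary terms
    have hg2 : ∀ p, (g p - 1 / 2) ^ 2 ≤ 1 / 4 * ∑ P ∈ T, ∑ a : Fin 3,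
        (if wordMap q l P N (q a) = p then (1 : ℝ) else 0) := by
      intro p
      have hnn : ∀ P a, (0 : ℝ) ≤ (if wordMap q l P N (q a) = p then (1 : ℝ) else 0) :=
        fun P a => by split_ifs <;> norm_num
      by_cases h : ∃ Pj : (ℕ → ℕ × ℕ) × Fin 3, Pj.1 ∈ T ∧ wordMap q l Pj.1 N (q Pj.2) = p
      · obtain ⟨⟨P, a⟩, hP, rfl⟩ := h
        simp only at hP ⊢
        have h2 := Finset.single_le_sum (f := fun a' => (if wordMap q l P N (q a') =
          wordMap q l P N (q a) then (1 : ℝ) else 0)) (fun a' _ => hnn P a') (Finset.mem_univ a)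
        have h3 := Finset.single_le_sum (f := fun P' => ∑ a' : Fin 3, (if wordMap q l P' N (q a') =
          wordMap q l P N (q a) then (1 : ℝ) else 0))
          (fun P' _ => Finset.sum_nonneg fun a' _ => hnn P' a') hP
        simp only [if_true] at h2 h3
        rw [hgT P hP]
        obtain ⟨k1, k2⟩ := h01 P hP a
        nlinarith
      · rw [hgN p h, sub_self]
        have := Finset.sum_nonneg fun P (_ : P ∈ T) =>
          Finset.sum_nonneg fun a (_ : a ∈ (Finset.univ : Finset (Fin 3))) => hnn P a
        norm_num
        simpa using this
    have hee : ∀ Q, ee (fun j => g (wordMap q l Q N (q j))) ≤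
        3 / 4 * ∑ j : Fin 3, ∑ P ∈ T, ∑ a : Fin 3,
          (if wordMap q l P N (q a) = wordMap q l Q N (q j) then (1 : ℝ) else 0) := by
      intro Q
      have e : ∀ a b c : ℝ, e3 a b c ≤ 3 * ((a - 1 / 2) ^ 2 + (b - 1 / 2) ^ 2 + (c - 1 / 2) ^ 2) := by
        intro a b c
        unfold e3
        nlinarith [sq_nonneg (a + b + c - 3 / 2)]
      refine (e _ _ _).trans ?_
      have h0 := hg2 (wordMap q l Q N (q 0))
      have h1 := hg2 (wordMap q l Q N (q 1))
      have h2 := hg2 (wordMap q l Q N (q 2))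
      rw [Fin.sum_univ_three (fun j => ∑ P ∈ T, ∑ a : Fin 3,
          (if wordMap q l P N (q a) = wordMap q l Q N (q j) then (1 : ℝ) else 0))]
      linarith
    refine (Finset.sum_le_sum fun Q _ => hee Q).trans ?_
    rw [← Finset.mul_sum]
    have hsw : ∑ Q ∈ (WF l N).filter (· ∉ T), ∑ j : Fin 3, ∑ P ∈ T, ∑ a : Fin 3,
          (if wordMap q l P N (q a) = wordMap q l Q N (q j) then (1 : ℝ) else 0) =
        ∑ P ∈ T, ∑ a : Fin 3, ∑ Q ∈ (WF l N).filter (· ∉ T), ∑ j : Fin 3,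
          (if wordMap q l P N (q a) = wordMap q l Q N (q j) then (1 : ℝ) else 0) := by
      rw [Finset.sum_congr rfl (fun Q _ => Finset.sum_comm), Finset.sum_comm]
      refine Finset.sum_congr rfl fun P _ => ?_
      rw [Finset.sum_congr rfl (fun Q _ => Finset.sum_comm), Finset.sum_comm]
    rw [hsw]
    have : ∑ P ∈ T, ∑ a : Fin 3, ∑ Q ∈ (WF l N).filter (· ∉ T), ∑ j : Fin 3,
          (if wordMap q l P N (q a) = wordMap q l Q N (q j) then (1 : ℝ) else 0) ≤
        ∑ P ∈ T, ∑ a : Fin 3, (1 : ℝ) :=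
      Finset.sum_le_sum fun P hP => Finset.sum_le_sum fun a _ => incid hq hl (hT P hP) hP a
    simp only [Finset.sum_const, Finset.card_univ, Fintype.card_fin, nsmul_eq_mul, mul_one] at this
    have hc2 : (T.card : ℝ) ≤ 2 := by exact_mod_cast hcard
    push_cast at this
    linarith

lemma rl_k {l k : ℕ} (hk : k ≤ l) : rl l * k ≤ 3 / 2 := by
  have h1 := rl_mul l
  have h2 := rl_pos l
  have h3 : (k : ℝ) ≤ l := by exact_mod_cast hk
  nlinarith [mul_le_mul_of_nonneg_left h3 h2.le]

lemma final_const {l : ℕ → ℕ} {N k : ℕ} (hk : 1 ≤ k) (hkl : k ≤ l N) {S : ℝ}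
    (hS : rl (l N) * S ≤ 4 / k) :
    (k : ℝ) / 12 * Rn l (N + 1) ≤ ((Rn l N)⁻¹ * (S + 9 / 2))⁻¹ ∨ S + 9 / 2 ≤ 0 := by
  by_cases hneg : S + 9 / 2 ≤ 0
  · exact Or.inr hneg
  left
  have hpos : 0 < S + 9 / 2 := by linarith
  have hR := Rn_pos l N
  have hk0 : (0 : ℝ) < k := by exact_mod_cast hk
  have h1 := rl_k hkl
  have h2 : rl (l N) * S * k ≤ 4 := by rwa [le_div_iff₀ hk0] at hS
  rw [mul_inv, inv_inv, Rn_succ, ← div_eq_mul_inv, le_div_iff₀ hpos]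
  have h3 : (k : ℝ) / 12 * rl (l N) * (S + 9 / 2) ≤ 1 := by nlinarith
  calc (k : ℝ) / 12 * (Rn l N * rl (l N)) * (S + 9 / 2)
      = Rn l N * ((k : ℝ) / 12 * rl (l N) * (S + 9 / 2)) := by ring
    _ ≤ Rn l N * 1 := mul_le_mul_of_nonneg_left h3 hR.le
    _ = Rn l N := mul_one _

/-- Combine everything: a test function on at most two cells of level `N`. -/
lemma REc_build {q : Fin 3 → E2} (hq : Equi q) {l : ℕ → ℕ} (hl : ∀ m, 5 ≤ l m) {N k : ℕ}
    (hk : 1 ≤ k) (hkl : k ≤ l N)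
    (T : Finset (ℕ → ℕ × ℕ)) (hT : ∀ P ∈ T, P ∈ Wn l N) (hcard : T.card ≤ 2)
    (U : (ℕ → ℕ × ℕ) → ℕ → ℕ → ℝ)
    (h01 : ∀ P ∈ T, ∀ a b, 0 ≤ U P a b ∧ U P a b ≤ 1)
    (hE : ∑ P ∈ T, ∑ i ∈ SF (l N), eU (U P) i ≤ 4 / k)
    (hcomp : ∀ P ∈ T, ∀ P' ∈ T, P ≠ P' → ∀ j j',
      wordMap q l P N (q j) = wordMap q l P' N (q j') →
      U P (cc (l N - 2) j + ev j).1 (cc (l N - 2) j + ev j).2 =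
        U P' (cc (l N - 2) j' + ev j').1 (cc (l N - 2) j' + ev j').2)
    {P P' : ℕ → ℕ × ℕ} (hP : P ∈ T) (hP' : P' ∈ T) {i i' : ℕ × ℕ} (hi : i ∈ Sset (l N))
    (hi' : i' ∈ Sset (l N)) (hU0 : ∀ j, U P (i + ev j).1 (i + ev j).2 = 0)
    (hU1 : ∀ j, U P' (i' + ev j).1 (i' + ev j).2 = 1) {z z' : E2}
    (hz : z ∈ Gasket q (sh l (N + 1))) (hz' : z' ∈ Gasket q (sh l (N + 1))) :
    (k : ℝ) / 12 * Rn l (N + 1) ≤ REc q l (wordMap q l P N (fmap q (l N) i z))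
      (wordMap q l P' N (fmap q (l N) i' z')) := by
  have h0 : sh l N 0 = l N := by simp [sh]
  have hN := sh_five hl N
  have hs : sh l (N + 1) = sh (sh l N) 1 := by
    funext m; simp only [sh]; congr 1; omega
  rw [hs] at hz hz'
  obtain ⟨F, f1, f2, f3⟩ := build hq hl T hT hcard (fun P => LatE q (sh l N) (U P))
    (fun P => (rl (l N))⁻¹ * ∑ i ∈ SF (l N), eU (U P) i)
    (fun P _ => LatE_cont hq hN _)
    (fun P _ m => by have := LatE_EN hq hN (U P) m; rwa [h0] at this)
    (fun P hP j => by rw [LatE_corner hq hN]; exact h01 P hP _ _)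
    (fun P hP P' hP' j j' e => by
      by_cases hne : P = P'
      · subst hne
        rw [wordMap_inj q l hl P N e]
      · rw [LatE_corner hq hN, LatE_corner hq hN, h0]
        exact hcomp P hP P' hP' hne j j' e)
  have hm : ∀ {i : ℕ × ℕ}, i ∈ Sset (l N) → ∀ {z : E2}, z ∈ Gasket q (sh (sh l N) 1) →
      fmap q (l N) i z ∈ Gasket q (sh l N) := by
    intro i hi z hz
    have := wordMap_mem_Gasket hN (single_mem (l := sh l N) (i := i) (by rwa [h0])) hz
    rwa [wordMap_single, h0] at this
  have hx := hm hi hz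
  have hy := hm hi' hz'
  have e0 : F (wordMap q l P N (fmap q (l N) i z)) = 0 := by
    rw [f2 P hP _ hx]
    have := LatE_const hq hN (U := U P) (i := i) (by rwa [h0]) hU0 hz
    rwa [h0] at this
  have e1 : F (wordMap q l P' N (fmap q (l N) i' z')) = 1 := by
    rw [f2 P' hP' _ hy]
    have := LatE_const hq hN (U := U P') (i := i') (by rwa [h0]) hU1 hz'
    rwa [h0] at this
  have hR := REc_ge hq hl (wordMap_mem_Gasket hl (hT P hP) hx) (wordMap_mem_Gasket hl (hT P' hP') hy)
    f1 f3 e0 e1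
  have hS : rl (l N) * (∑ P ∈ T, (rl (l N))⁻¹ * ∑ i ∈ SF (l N), eU (U P) i) ≤ 4 / k := by
    rw [← Finset.mul_sum, mul_inv_cancel_left₀ (rl_pos _).ne']
    exact hE
  rcases final_const hk hkl hS with h | h
  · exact h.trans hR
  · exfalso
    have : 0 ≤ ∑ P ∈ T, (rl (l N))⁻¹ * ∑ i ∈ SF (l N), eU (U P) i :=
      Finset.sum_nonneg fun P _ => mul_nonneg (inv_nonneg.2 (rl_pos _).le)
        (Finset.sum_nonneg fun i _ => eU_nonneg _ _)
    linarith

lemma eU_affine (U : ℕ → ℕ → ℝ) (a b : ℝ) (i : ℕ × ℕ) :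
    eU (fun x y => a + b * U x y) i = b ^ 2 * eU U i := by
  unfold eU e3; ring

lemma sum_eU_affine (U : ℕ → ℕ → ℝ) (a b : ℝ) (l : ℕ) :
    ∑ i ∈ SF l, eU (fun x y => a + b * U x y) i = b ^ 2 * ∑ i ∈ SF l, eU U i := by
  rw [Finset.mul_sum]
  exact Finset.sum_congr rfl fun i _ => eU_affine U a b i

lemma split_point {q : Fin 3 → E2} (hq : Equi q) {l : ℕ → ℕ} (hl : ∀ m, 5 ≤ l m) {N : ℕ}
    {w : ℕ → ℕ × ℕ} (hw : w ∈ Wn l (N + 1)) {x : E2} (hx : x ∈ Cell q l (N + 1) w) :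
    ∃ P ∈ Wn l N, ∃ i ∈ Sset (l N), w = cat N P (single i) ∧ ∃ z ∈ Gasket q (sh l (N + 1)),
      x = wordMap q l P N (fmap q (l N) i z) := by
  have h0 : sh l N 0 = l N := by simp [sh]
  have h1 := suf_mem hw
  refine ⟨pre N w, pre_mem hw, suf N w 0, by have := h1.1 0 one_pos; rwa [h0] at this, ?_, ?_⟩
  · rw [← eq_single h1, cat_pre_suf]
  · rw [Cell_eq hq hl hw] at hx
    obtain ⟨z, hz, rfl⟩ := hx
    refine ⟨z, hz, ?_⟩
    rw [wordMap_split]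
    simp only [Function.comp]
    rw [eq_single h1, wordMap_single, h0]
    rfl

lemma REc_lower {q : Fin 3 → E2} (hq : Equi q) {l : ℕ → ℕ} (hl : ∀ m, 5 ≤ l m) {N : ℕ}
    {w : ℕ → ℕ × ℕ} (hw : w ∈ Wn l (N + 1)) {k : ℕ} (hk : 1 ≤ k) (hkl : k ≤ l N) {x y : E2}
    (hx : x ∈ Cell q l (N + 1) w) (hy : y ∈ Gasket q l \ Unwk q l (N + 1) w k) :
    (k : ℝ) / 12 * Rn l (N + 1) ≤ REc q l x y := by
  classical
  obtain ⟨v, hv, hyv⟩ := exists_Cell hl (N + 1) hy.1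
  have hnL : v ∉ Lam q l (N + 1) w k := fun h => hy.2 (Set.mem_iUnion₂.2 ⟨v, h, hyv⟩)
  have hno : ∀ m ≤ k, ¬ Ch (adjW q l (N + 1)) m w v := fun m hm h =>
    hnL (Ch_Lam hw (Ch_mono hl hv hm h))
  obtain ⟨P, hP, i, hi, rfl, z, hz, rfl⟩ := split_point hq hl hw hx
  obtain ⟨P', hP', i', hi', rfl, z', hz', rfl⟩ := split_point hq hl hv hyv
  have hk0 : (0 : ℝ) < k := by exact_mod_cast hk
  have hlift : ∀ {Q : ℕ → ℕ × ℕ}, Q ∈ Wn l N → ∀ {m : ℕ} {s t : ℕ × ℕ}, Ch (adj1 (l N)) m s t →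
      Ch (adjW q l (N + 1)) m (cat N Q (single s)) (cat N Q (single t)) := fun hQ m s t h =>
    Ch_map (fun s => cat N _ (single s)) (fun a b hab => adjW_lift hl hQ hab) h
  by_cases hPP : P = P'
  · subst hPP
    obtain ⟨U, u1, u2, u3, u4⟩ := tent (hl N) hi hi' (k := k) (fun m hm h => hno m hm (hlift hP h))
    refine REc_build hq hl hk hkl {P} (by simpa using hP) (by simp)
      (fun _ x y => 0 + (k : ℝ)⁻¹ * U x y) ?_ ?_ ?_ (Finset.mem_singleton_self P)
      (Finset.mem_singleton_self P) hi hi' ?_ ?_ hz hz'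
    · intro _ _ a b
      have := u1 a b
      rw [zero_add]
      exact ⟨mul_nonneg (by positivity) this.1, by
        rw [inv_mul_le_iff₀ hk0]; linarith [this.2]⟩
    · rw [Finset.sum_singleton, sum_eU_affine]
      calc ((k : ℝ)⁻¹) ^ 2 * ∑ i ∈ SF (l N), eU U i ≤ ((k : ℝ)⁻¹) ^ 2 * (4 * k) :=
            mul_le_mul_of_nonneg_left u4 (by positivity)
        _ = 4 / k := by field_simp
    · intro Q hQ Q' hQ' hne
      rw [Finset.mem_singleton] at hQ hQ'
      exact absurd (hQ.trans hQ'.symm) hne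
    · intro j; simp only [u2]; ring
    · intro j; simp only [u3]; field_simp; ring
  have hT : ∀ Q ∈ ({P, P'} : Finset (ℕ → ℕ × ℕ)), Q ∈ Wn l N := by
    intro Q hQ
    rcases Finset.mem_insert.1 hQ with rfl | h
    · exact hP
    · rw [Finset.mem_singleton.1 h]; exact hP'
  have hne' : P' ≠ P := fun h => hPP h.symm
  by_cases hsh : ∃ a a', wordMap q l P N (q a) = wordMap q l P' N (q a')
  · obtain ⟨a, a', hA⟩ := hsh
    obtain ⟨d, U, c1, c2, c3, c4, c5⟩ := tent_corner (hl N) hi a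
    obtain ⟨d', U', c1', c2', c3', c4', c5'⟩ := tent_corner (hl N) hi' a'
    have hkd : k ≤ d + d' := by
      by_contra hcon
      have h1 := hlift hP c1
      have h3 := Ch_symm adjW_symm (hlift hP' c1')
      have m1 : ∀ {Q : ℕ → ℕ × ℕ}, Q ∈ Wn l N → ∀ b, cat N Q (single (cc (l N - 2) b)) ∈ Wn l (N + 1) :=
        fun hQ b => cat_mem hQ (single_mem (by simpa [sh] using cc_mem' (hl N) b))
      have m2 : ∀ (Q : ℕ → ℕ × ℕ) b, wordMap q l (cat N Q (single (cc (l N - 2) b))) (N + 1) (q b)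
          = wordMap q l Q N (q b) := by
        intro Q b
        rw [wordMap_cat]
        simp only [Function.comp]
        rw [wordMap_single, show sh l N 0 = l N by simp [sh], corner_fix q (hl N) b]
      have h2 : adjW q l (N + 1) (cat N P (single (cc (l N - 2) a)))
          (cat N P' (single (cc (l N - 2) a'))) :=
        adjW_of hl (m1 hP a) (m1 hP' a') (j := a) (j' := a') (by rw [m2, m2, hA])
      exact hno (d + 1 + d') (by omega) (Ch_trans (Ch_trans h1 (Ch_one h2)) h3)
    have hD : (0 : ℝ) < (d : ℝ) + d' := by
      have : (k : ℝ) ≤ ((d + d' : ℕ) : ℝ) := by exact_mod_cast hkd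
      push_cast at this; linarith
    set σ : ℝ := ((d : ℝ) + d')⁻¹ with hσ
    have hσ0 : 0 < σ := inv_pos.2 hD
    have hσD : σ * ((d : ℝ) + d') = 1 := inv_mul_cancel₀ hD.ne'
    have hd0 : (0 : ℝ) ≤ d := by positivity
    have hd0' : (0 : ℝ) ≤ d' := by positivity
    refine REc_build hq hl hk hkl {P, P'} hT Finset.card_le_two
      (fun Q => if Q = P then (fun x y => 0 + σ * U x y) else fun x y => 1 + (-σ) * U' x y)
      ?_ ?_ ?_ (Finset.mem_insert_self _ _)
      (Finset.mem_insert_of_mem (Finset.mem_singleton_self P')) hi hi' ?_ ?_ hz hz'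
    · intro Q _ x y
      have h1 := c2 x y
      have h2 := c2' x y
      have h3 := mul_le_mul_of_nonneg_left h1.2 hσ0.le
      have h4 := mul_le_mul_of_nonneg_left h2.2 hσ0.le
      have h5 := mul_nonneg hσ0.le h1.1
      have h6 := mul_nonneg hσ0.le h2.1
      have h7 := mul_nonneg hσ0.le hd0
      have h8 := mul_nonneg hσ0.le hd0'
      split_ifs
      · constructor <;> linarith
      · constructor <;> linarith
    · rw [Finset.sum_pair hPP, if_pos rfl, if_neg hne', sum_eU_affine, sum_eU_affine]
      have h1 := mul_le_mul_of_nonneg_left c5 (sq_nonneg σ)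
      have h2 := mul_le_mul_of_nonneg_left c5' (sq_nonneg σ)
      have h3 : σ ^ 2 * (4 * d) + σ ^ 2 * (4 * d') = 4 * σ := by
        calc σ ^ 2 * (4 * d) + σ ^ 2 * (4 * d') = 4 * σ * (σ * ((d : ℝ) + d')) := by ring
          _ = 4 * σ := by rw [hσD, mul_one]
      have h4 : σ ≤ (k : ℝ)⁻¹ := by
        apply inv_anti₀ hk0
        exact_mod_cast hkd
      rw [neg_sq, div_eq_mul_inv]
      linarith
    · have key : ∀ j j', wordMap q l P N (q j) = wordMap q l P' N (q j') →
          0 + σ * U (cc (l N - 2) j + ev j).1 (cc (l N - 2) j + ev j).2 =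
          1 + (-σ) * U' (cc (l N - 2) j' + ev j').1 (cc (l N - 2) j' + ev j').2 := by
        intro j j' e
        obtain ⟨rfl, rfl⟩ := share_one q hq hl N hP hP' hPP hA e
        rw [c4, c4']
        linarith
      intro Q hQ Q' hQ' hne j j' e
      rcases Finset.mem_insert.1 hQ with e1 | e1 <;> rcases Finset.mem_insert.1 hQ' with e2 | e2
      · exact absurd (e1.trans e2.symm) hne
      · rw [Finset.mem_singleton] at e2
        rw [e1, e2] at e
        rw [e1, e2, if_pos rfl, if_neg hne']
        exact key j j' e
      · rw [Finset.mem_singleton] at e1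
        rw [e1, e2] at e
        rw [e1, e2, if_pos rfl, if_neg hne']
        exact (key j' j e.symm).symm
      · rw [Finset.mem_singleton] at e1 e2
        exact absurd (e1.trans e2.symm) hne
    · intro j; rw [if_pos rfl]; simp only [c3]; ring
    · intro j; rw [if_neg hne']; simp only [c3']; ring
  · refine REc_build hq hl hk hkl {P, P'} hT Finset.card_le_two
      (fun Q => if Q = P then (fun x y => 0) else fun x y => 1)
      ?_ ?_ ?_ (Finset.mem_insert_self _ _)
      (Finset.mem_insert_of_mem (Finset.mem_singleton_self P')) hi hi' ?_ ?_ hz hz'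
    · intro Q _ x y
      split_ifs <;> norm_num
    · rw [Finset.sum_pair hPP, if_pos rfl, if_neg hne']
      simp only [eU, e3, sub_self]
      norm_num
      positivity
    · intro Q hQ Q' hQ' hne j j' e
      rcases Finset.mem_insert.1 hQ with e1 | e1 <;> rcases Finset.mem_insert.1 hQ' with e2 | e2
      · exact absurd (e1.trans e2.symm) hne
      · rw [Finset.mem_singleton] at e2
        rw [e1, e2] at e
        exact absurd ⟨j, j', e⟩ hsh
      · rw [Finset.mem_singleton] at e1
        rw [e1, e2] at e
        exact absurd ⟨j', j, e.symm⟩ hsh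
      · rw [Finset.mem_singleton] at e1 e2
        exact absurd (e1.trans e2.symm) hne
    · intro j; rw [if_pos rfl]
    · intro j; rw [if_neg hne']

/-- Comparison of the neighborhoods `U^{(k)}_{n,w}` with the balls of
`d` and of `R_E`. -/
theorem stmt10 (q : Fin 3 → E2) (hq : ∀ j k : Fin 3, j ≠ k → dist (q j) (q k) = 1)
    (l : ℕ → ℕ) (hl : ∀ m, 5 ≤ l m)
    (n : ℕ) (hn : 1 ≤ n) (w : ℕ → ℕ × ℕ) (hw : w ∈ Wn l n)
    (x : E2) (hx : x ∈ Cell q l n w) (k : ℕ) (hk1 : 1 ≤ k) (hk2 : k ≤ l (n - 1)) :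
    -- (1)
    (∀ y ∈ Unwk q l n w k,
      gdist q l x y < ((k : ℝ) + 2) / (Ln l n : ℝ) ∧
      REc q l x y < ((2 / 3) * (k : ℝ) + 10 / 3) * Rn l n) ∧
    -- (2)
    (∀ y ∈ Gasket q l \ Unwk q l n w k,
      (k : ℝ) / (Ln l n : ℝ) ≤ gdist q l x y ∧
      ((k : ℝ) / 12) * Rn l n ≤ REc q l x y) ∧
    -- (3)
    (Bd q l x ((k : ℝ) / (Ln l n : ℝ)) ⊆ Unwk q l n w k ∧
     Unwk q l n w k ⊆ Bd q l x (((k : ℝ) + 2) / (Ln l n : ℝ))) ∧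
    -- (4)
    (BRc q l x (((k : ℝ) / 12) * Rn l n) ⊆ Unwk q l n w k ∧
     Unwk q l n w k ⊆ BRc q l x (((2 / 3) * (k : ℝ) + 10 / 3) * Rn l n)) := by
  have hq' : Equi q := hq
  obtain ⟨N, rfl⟩ : ∃ N, n = N + 1 := ⟨n - 1, by omega⟩
  have hkl : k ≤ l N := by simpa using hk2
  have h1 : ∀ y ∈ Unwk q l (N + 1) w k,
      gdist q l x y < ((k : ℝ) + 2) / (Ln l (N + 1) : ℝ) ∧
      REc q l x y < ((2 / 3) * (k : ℝ) + 10 / 3) * Rn l (N + 1) := fun y hy =>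
    ⟨gdist_upper hq' hl hw hk1 hx hy, REc_upper hq' hl hw hk1 hx hy⟩
  have h2 : ∀ y ∈ Gasket q l \ Unwk q l (N + 1) w k,
      (k : ℝ) / (Ln l (N + 1) : ℝ) ≤ gdist q l x y ∧
      ((k : ℝ) / 12) * Rn l (N + 1) ≤ REc q l x y := fun y hy =>
    ⟨gdist_lower hq' hl hw hx hy, REc_lower hq' hl hw hk1 hkl hx hy⟩
  have hG : ∀ y ∈ Unwk q l (N + 1) w k, y ∈ Gasket q l := by
    intro y hy
    obtain ⟨v, _, hv⟩ := Set.mem_iUnion₂.1 hy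
    exact hv.1
  refine ⟨h1, h2, ⟨?_, fun y hy => ⟨hG y hy, (h1 y hy).1⟩⟩,
    ⟨?_, fun y hy => ⟨hG y hy, (h1 y hy).2⟩⟩⟩
  · intro y hy
    by_contra hc
    exact absurd hy.2 (not_lt.2 (h2 y ⟨hy.1, hc⟩).1)
  · intro y hy
    by_contra hc
    exact absurd hy.2 (not_lt.2 (h2 y ⟨hy.1, hc⟩).2)

end
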